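/- arXiv:1303.2608 — 3 statements merged into one kernel-verified Lean document; each statement's English description precedes it below -/
import Mathlib

section
/- Let p and q be distinct prime numbers with p ≡ q ≡ 1 (mod 8) such that p is a quadratic residue modulo q. Let F be a quadratic number field containing an element α with α² = p·q and F = ℚ(α), and let M be a number field of degree 4 over ℚ containing elements a, b with a² = p, b² = q and M = ℚ(a, b). Then the class number of F is divisible by 4 if and only if the class number of M is even. -/
open NumberField

section Groups
open Module

theorem LinearMap.finrank_range_add_finrank_ker_int {G H : Type*} [AddCommGroup G]
    [AddCommGroup H] [Module.Finite ℤ G] (f : G →ₗ[ℤ] H) :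
    finrank ℤ (LinearMap.range f) + finrank ℤ (LinearMap.ker f) = finrank ℤ G := by
  rw [← f.quotKerEquivRange.finrank_eq, Submodule.finrank_quotient_add_finrank]

theorem AddSubgroup.index_range_nsmul_of_addEquiv_prod {G H T : Type*} [AddCommGroup G]
    [AddCommGroup H] [AddCommGroup T] [Module.Free ℤ H] [Module.Finite ℤ H] [Finite T]
    (f : G ≃+ H × T) (n : ℕ) (hn : n ≠ 0) :
    (nsmulAddMonoidHom (α := G) n).range.index =
      n ^ finrank ℤ G * Nat.card (nsmulAddMonoidHom (α := G) n).ker := by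
  have hrank : finrank ℤ G = finrank ℤ H := by
    have : Module.Finite ℤ T := Module.Finite.of_finite
    have hT : finrank ℤ T = 0 := by
      rw [Module.finrank_eq_zero_iff_isTorsion]
      intro x
      exact ⟨⟨addOrderOf x, mem_nonZeroDivisors_iff_ne_zero.mpr
        (by exact_mod_cast (addOrderOf_pos x).ne')⟩,
        by rw [Submonoid.mk_smul, natCast_zsmul, addOrderOf_nsmul_eq_zero]⟩
    have h := LinearMap.finrank_range_add_finrank_ker_int (LinearMap.fst ℤ H T)
    rw [LinearMap.range_eq_top.mpr Prod.fst_surjective, finrank_top, LinearMap.ker_fst,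
      LinearMap.finrank_range_of_inj LinearMap.inr_injective, hT] at h
    rw [f.toIntLinearEquiv.finrank_eq, ← h, add_zero]
  have hprod : nsmulAddMonoidHom (α := H × T) n =
      (nsmulAddMonoidHom (α := H) n).prodMap (nsmulAddMonoidHom (α := T) n) := by
    ext x <;> simp
  have hker : Nat.card (nsmulAddMonoidHom (α := G) n).ker =
      Nat.card (nsmulAddMonoidHom (α := T) n).ker := by
    refine Nat.card_congr ⟨fun x => ⟨(f x.1).2, ?_⟩, fun y => ⟨f.symm (0, y.1), ?_⟩, ?_, ?_⟩
    · have hx : n • x.1 = 0 := x.2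
      change n • (f x.1).2 = 0
      rw [← Prod.smul_snd, ← map_nsmul, hx, map_zero, Prod.snd_zero]
    · have hy : n • y.1 = 0 := y.2
      change n • f.symm (0, y.1) = 0
      rw [← map_nsmul, Prod.smul_mk, hy, smul_zero, Prod.mk_zero_zero, map_zero]
    · intro x
      have hx : n • x.1 = 0 := x.2
      have h1 : n • (f x.1).1 = 0 := by
        rw [← Prod.smul_fst, ← map_nsmul, hx, map_zero, Prod.fst_zero]
      have h2 : (f x.1).1 = 0 := by
        have : Module.IsTorsionFree ℤ H := inferInstance
        exact AddSubgroup.nsmulAddMonoidHom_injective_of_isTorsionFree hn (by simpa using h1)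
      ext
      simp [← h2]
    · intro y
      ext
      simp
  rw [hrank, hker, ← AddSubgroup.index_range_nsmul H n, ← AddSubgroup.index_range (G := T),
    ← AddSubgroup.index_prod, ← AddMonoidHom.range_prodMap, ← hprod,
    ← AddEquiv.map_range_nsmulAddMonoidHom f]
  exact (AddSubgroup.index_map_equiv _ f).symm

theorem AddSubgroup.index_range_nsmul_eq_mul_card_ker (G : Type*) [AddCommGroup G]
    [Module.Finite ℤ G] {n : ℕ} (hn : n ≠ 0) :
    (nsmulAddMonoidHom (α := G) n).range.index =
      n ^ finrank ℤ G * Nat.card (nsmulAddMonoidHom (α := G) n).ker := by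
  have : AddGroup.FG G := Module.Finite.iff_addGroup_fg.mp inferInstance
  obtain ⟨r, ι, _, p, hp, e, ⟨f⟩⟩ := AddCommGroup.equiv_free_prod_directSum_zmod G
  have : ∀ i, NeZero (p i ^ e i) := fun i => ⟨pow_ne_zero _ (hp i).ne_zero⟩
  have hTf : Finite (DirectSum ι fun i => ZMod (p i ^ e i)) :=
    Finite.of_equiv _ (DirectSum.addEquivProd _).symm.toEquiv
  exact AddSubgroup.index_range_nsmul_of_addEquiv_prod f n hn

/-- The index of the squares in a finitely generated abelian group with a unique element `z` of
order two. -/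
theorem index_range_sq {A : Type*} [CommGroup A] [Module.Finite ℤ (Additive A)] {z : A}
    (hz1 : z ≠ 1) (hz : z ^ 2 = 1) (htor : ∀ x : A, x ^ 2 = 1 → x = 1 ∨ x = z) :
    (powMonoidHom (α := A) 2).range.index = 2 ^ (finrank ℤ (Additive A) + 1) := by
  have h := AddSubgroup.index_range_nsmul_eq_mul_card_ker (Additive A) two_ne_zero
  have hk : Nat.card (nsmulAddMonoidHom (α := Additive A) 2).ker = 2 := by
    have hs : ((nsmulAddMonoidHom (α := Additive A) 2).ker : Set (Additive A)) =
        {Additive.ofMul 1, Additive.ofMul z} := by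
      ext x
      change x.toMul ^ 2 = 1 ↔ x.toMul = 1 ∨ x.toMul = z
      refine ⟨htor _, ?_⟩
      rintro (h | h) <;> rw [h]
      · exact one_pow 2
      · exact hz
    rw [← SetLike.coe_sort_coe, hs, Nat.card_coe_set_eq, Set.ncard_pair]
    exact fun h => hz1 (Additive.ofMul.injective h).symm
  rw [hk, ← pow_succ] at h
  exact h

/-- Let `s` be an involution of a finitely generated abelian group. If elements of norm `1` which
are not of the form `w / s w` are congruent modulo such quotients, then the rank hypothesis forces every
fixed element to be a norm, and some element of norm `1` not to be of the form `w / s w`. -/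
theorem exists_norm_eq_and_exists_not_div {A : Type*} [CommGroup A]
    [Module.Finite ℤ (Additive A)] (s : A →* A) (hs : ∀ x, s (s x) = x) {z : A}
    (hz1 : z ≠ 1) (hz : z ^ 2 = 1) (hsz : s z = z) (htor : ∀ x : A, x ^ 2 = 1 → x = 1 ∨ x = z)
    (hrank : finrank ℤ (Additive A) =
      2 * finrank ℤ (Additive (MonoidHom.id A / s).ker) + 1)
    (h : ∀ u v : A, u * s u = 1 → v * s v = 1 → (¬ ∃ w, u = w / s w) → (¬ ∃ w, v = w / s w) →
      ∃ w, u * v = w / s w) :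
    (∀ u, s u = u → ∃ w, u = w * s w) ∧ ∃ u, u * s u = 1 ∧ ¬ ∃ w, u = w / s w := by
  set D : A →* A := MonoidHom.id A / s with hD
  set N : A →* A := MonoidHom.id A * s with hN
  have hDa : ∀ x, D x = x / s x := fun x => rfl
  have hNa : ∀ x, N x = x * s x := fun x => rfl
  have hEmem : ∀ x, x ∈ D.ker ↔ s x = x := fun x => by
    rw [MonoidHom.mem_ker, hDa, div_eq_one, eq_comm]
  have hKmem : ∀ x, x ∈ N.ker ↔ x * s x = 1 := fun x => Iff.rfl
  have hidx : ∀ H : Subgroup A, z ∈ H →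
      (H.map (powMonoidHom 2)).relIndex H = 2 ^ (finrank ℤ (Additive H) + 1) := by
    intro H hzH
    have : Module.Finite ℤ (Additive H) :=
      Module.Finite.of_injective (MonoidHom.toAdditive H.subtype).toIntLinearMap
        (fun x y hxy => Subtype.ext hxy)
    rw [Subgroup.relIndex, Subgroup.subgroupOf_map_powMonoidHom_eq_range]
    refine index_range_sq (z := (⟨z, hzH⟩ : H)) ?_ ?_ ?_
    · exact fun h => hz1 (congrArg Subtype.val h)
    · exact Subtype.ext hz
    · intro x hx
      exact (htor x.1 (congrArg Subtype.val hx)).imp (fun h => Subtype.ext h)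
        (fun h => Subtype.ext h)
  have hE := hidx D.ker ((hEmem z).2 hsz)
  have hK := hidx N.ker ((hKmem z).2 (by rw [hsz, ← sq, hz]))
  set E2 := D.ker.map (powMonoidHom 2)
  set K2 := N.ker.map (powMonoidHom 2)
  have hNE : N.range ≤ D.ker := by
    rintro _ ⟨x, rfl⟩
    rw [hEmem, hNa, map_mul, hs, mul_comm]
  have hDK : D.range ≤ N.ker := by
    rintro _ ⟨x, rfl⟩
    rw [hKmem, hDa, map_div, hs, div_mul_div_cancel, div_self']
  have hE2 : E2 ≤ N.range := by
    rintro _ ⟨x, hx, rfl⟩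
    exact ⟨x, by rw [hNa, (hEmem x).1 hx, powMonoidHom_apply, sq]⟩
  have hK2 : K2 ≤ D.range := by
    rintro _ ⟨x, hx, rfl⟩
    refine ⟨x, ?_⟩
    rw [hDa, powMonoidHom_apply, sq, div_eq_mul_inv, ← eq_inv_of_mul_eq_one_left ((hKmem x).1 hx)]
  have hcomap : E2.comap N = K2.comap D := by
    have key : ∀ x : A, (∃ e k, s e = e ∧ k * s k = 1 ∧ x = e * k) ↔ x ∈ E2.comap N := by
      intro x
      constructor
      · rintro ⟨e, k, he, hk, rfl⟩
        refine ⟨e, (hEmem e).2 he, ?_⟩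
        rw [powMonoidHom_apply, hNa, map_mul, he, mul_mul_mul_comm, hk, mul_one, sq]
      · rintro ⟨e, he, hx⟩
        have he := (hEmem e).1 he
        rw [powMonoidHom_apply, hNa] at hx
        refine ⟨e, x / e, he, ?_, by simp⟩
        rw [map_div, he, div_mul_div_comm, ← hx, sq, div_self']
    have key' : ∀ x : A, (∃ e k, s e = e ∧ k * s k = 1 ∧ x = e * k) ↔ x ∈ K2.comap D := by
      intro x
      constructor
      · rintro ⟨e, k, he, hk, rfl⟩
        refine ⟨k, (hKmem k).2 hk, ?_⟩
        rw [powMonoidHom_apply, hDa, map_mul, he, mul_div_mul_left_eq_div, sq, div_eq_mul_inv,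
          ← eq_inv_of_mul_eq_one_left hk]
      · rintro ⟨k, hk, hx⟩
        have hk := (hKmem k).1 hk
        have hk' : s k = k⁻¹ := eq_inv_of_mul_eq_one_right hk
        rw [powMonoidHom_apply, hDa] at hx
        refine ⟨x / k, k, ?_, hk, by simp⟩
        have : s x = x / k ^ 2 := by rw [hx]; simp
        rw [map_div, hk', this, sq]
        simp [div_eq_mul_inv, mul_assoc]
    ext x
    rw [← key, ← key']
  have hm : E2.relIndex N.range = K2.relIndex D.range := by
    rw [← Subgroup.index_comap, ← Subgroup.index_comap, hcomap]
  have h1 := Subgroup.relIndex_mul_relIndex _ _ _ hE2 hNE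
  have h2 := Subgroup.relIndex_mul_relIndex _ _ _ hK2 hDK
  rw [hE] at h1
  rw [hK, ← hm] at h2
  have hrk : finrank ℤ (Additive D.ker) + 1 ≤ finrank ℤ (Additive N.ker) := by
    have h3 := LinearMap.finrank_range_add_finrank_ker_int (MonoidHom.toAdditive D).toIntLinearMap
    have h4 : finrank ℤ (LinearMap.ker (MonoidHom.toAdditive D).toIntLinearMap) =
      finrank ℤ (Additive D.ker) := rfl
    have h5 : finrank ℤ (LinearMap.range (MonoidHom.toAdditive D).toIntLinearMap) ≤
      finrank ℤ (LinearMap.ker (MonoidHom.toAdditive N).toIntLinearMap) := by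
      apply Submodule.finrank_mono
      rintro _ ⟨x, rfl⟩
      exact hDK ⟨x.toMul, rfl⟩
    have h6 : finrank ℤ (LinearMap.ker (MonoidHom.toAdditive N).toIntLinearMap) =
      finrank ℤ (Additive N.ker) := rfl
    omega
  have hle : 2 * N.range.relIndex D.ker ≤ D.range.relIndex N.ker := by
    have hpos : 0 < E2.relIndex N.range := by
      rcases Nat.eq_zero_or_pos (E2.relIndex N.range) with h0 | h0
      · rw [h0, zero_mul] at h1
        exact absurd h1.symm (by positivity)
      · exact h0
    refine Nat.le_of_mul_le_mul_left ?_ hpos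
    rw [mul_left_comm, h1, h2, ← pow_succ']
    exact Nat.pow_le_pow_right two_pos (by omega)
  have hN0 : N.range.relIndex D.ker ≠ 0 := by
    intro h0
    rw [h0, mul_zero] at h1
    exact absurd h1.symm (by positivity)
  have hrange : ∀ u, u ∈ D.range ↔ ∃ w, u = w / s w := fun u =>
    ⟨fun ⟨w, hw⟩ => ⟨w, hw.symm⟩, fun ⟨w, hw⟩ => ⟨w, hw.symm⟩⟩
  have hex : ∃ u, u * s u = 1 ∧ ¬ ∃ w, u = w / s w := by
    by_contra! hcon
    have : D.range.relIndex N.ker = 1 :=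
      Subgroup.relIndex_eq_one.2 fun u hu => (hrange u).2 (hcon u hu)
    omega
  refine ⟨?_, hex⟩
  obtain ⟨u, hu, hu'⟩ := hex
  have htwo : D.range.relIndex N.ker = 2 := by
    refine Subgroup.relIndex_eq_two_iff.2 ⟨u, hu, fun v hv => ?_⟩
    by_cases hv' : ∃ w, v = w / s w
    · refine Or.inr ⟨(hrange v).2 hv', fun hvu => hu' ((hrange u).1 ?_)⟩
      exact (Subgroup.mul_mem_cancel_left _ ((hrange v).2 hv')).1 hvu
    · exact Or.inl ⟨(hrange _).2 (h v u hv hu hv' hu'), fun hv'' => hv' ((hrange v).1 hv'')⟩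
  have hone : N.range.relIndex D.ker = 1 := by omega
  intro v hv
  obtain ⟨w, hw⟩ := Subgroup.relIndex_eq_one.1 hone ((hEmem v).2 hv)
  exact ⟨w, hw.symm⟩

end Groups

section Involution
open scoped nonZeroDivisors

variable {R S : Type*} [CommRing R] [CommRing S] [Algebra R S] (s : S ≃ₐ[R] S)

theorem Ideal.map_map_of_involutive (hs : ∀ x, s (s x) = x) (I : Ideal S) :
    (I.map s).map s = I := by
  ext y
  rw [Ideal.mem_map_of_equiv]
  constructor
  · rintro ⟨x, hx, rfl⟩
    obtain ⟨z, hz, rfl⟩ := (Ideal.mem_map_of_equiv _ _).1 hx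
    rwa [hs]
  · exact fun hy => ⟨s y, Ideal.mem_map_of_mem _ hy, hs y⟩

theorem sub_mul_mem_map_comap (hs : ∀ x, s (s x) = x)
    (hfix : ∀ x, s x = x → ∃ r, algebraMap R S r = x) {I : Ideal S} (hI : I.map s = I)
    (θ : S) {x : S} (hx : x ∈ I) :
    (θ - s θ) * x ∈ (I.comap (algebraMap R S)).map (algebraMap R S) := by
  have hsI : ∀ y ∈ I, s y ∈ I := fun y hy => hI ▸ Ideal.mem_map_of_mem s hy
  have htr : ∀ y ∈ I, y + s y ∈ (I.comap (algebraMap R S)).map (algebraMap R S) := by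
    intro y hy
    obtain ⟨r, hr⟩ := hfix (y + s y) (by rw [map_add, hs, add_comm])
    rw [← hr]
    refine Ideal.mem_map_of_mem _ ?_
    rw [Ideal.mem_comap, hr]
    exact I.add_mem hy (hsI y hy)
  have h : (θ - s θ) * x = (θ * x + s (θ * x)) - s θ * (x + s x) := by
    rw [map_mul]; ring
  rw [h]
  exact Ideal.sub_mem _ (htr _ (I.mul_mem_left θ hx)) (Ideal.mul_mem_left _ _ (htr x hx))

theorem map_comap_eq_of_map_eq (hs : ∀ x, s (s x) = x)
    (hfix : ∀ x, s x = x → ∃ r, algebraMap R S r = x) {θ₁ θ₂ : S}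
    (hθ : IsCoprime (θ₁ - s θ₁) (θ₂ - s θ₂)) {I : Ideal S} (hI : I.map s = I) :
    (I.comap (algebraMap R S)).map (algebraMap R S) = I := by
  refine le_antisymm Ideal.map_comap_le fun x hx => ?_
  obtain ⟨u, v, huv⟩ := hθ
  have h : x = u * ((θ₁ - s θ₁) * x) + v * ((θ₂ - s θ₂) * x) := by
    linear_combination -x * huv
  rw [h]
  exact Ideal.add_mem _ (Ideal.mul_mem_left _ _ (sub_mul_mem_map_comap s hs hfix hI θ₁ hx))
    (Ideal.mul_mem_left _ _ (sub_mul_mem_map_comap s hs hfix hI θ₂ hx))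

theorem exists_mul_conj_eq_mul [IsDomain S] (hs : ∀ x, s (s x) = x) {δ : S} (hδ0 : δ ≠ 0)
    (hδ : s δ = -δ) {a b : S} (ha : a ≠ 0) (hab : b * s b = a * s a) : ∃ x, x ≠ 0 ∧ b * s x = a * x := by
  by_cases h : a + b = 0
  · refine ⟨δ, hδ0, ?_⟩
    rw [hδ]
    linear_combination -δ * h
  · refine ⟨s a * (a + b), mul_ne_zero (by simpa using ha) h, ?_⟩
    rw [map_mul, hs, map_add]
    linear_combination a * hab

theorem exists_unit_mul_conj [IsDedekindDomain S] (hs : ∀ x, s (s x) = x) {I : Ideal S}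
    (hI : I ≠ ⊥) {a b : S}
    (h : Ideal.span {a} * I.map s = Ideal.span {b} * I) :
    ∃ u : Sˣ, b * s b = u * (a * s a) := by
  have hss := Ideal.map_map_of_involutive s hs I
  have h' := congrArg (Ideal.map s) h
  rw [Ideal.map_mul, Ideal.map_mul, hss, Ideal.map_span, Ideal.map_span, Set.image_singleton,
    Set.image_singleton] at h'
  have h2 : Ideal.span {a * s a} * I = Ideal.span {b * s b} * I := by
    rw [← Ideal.span_singleton_mul_span_singleton, ← Ideal.span_singleton_mul_span_singleton,
      mul_assoc, h', mul_left_comm, h]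
    ring
  have h3 := mul_right_cancel₀ hI h2
  rw [Ideal.span_singleton_eq_span_singleton] at h3
  obtain ⟨u, hu⟩ := h3
  exact ⟨u, by rw [← hu, mul_comm]⟩

theorem exists_map_span_mul_eq [IsDedekindDomain S] (hs : ∀ x, s (s x) = x) {δ : S}
    (hδ0 : δ ≠ 0) (hδ : s δ = -δ) {I : Ideal S} {a b : S} (ha : a ≠ 0) (hb : b ≠ 0)
    (h : Ideal.span {a} * I.map s = Ideal.span {b} * I) (hab : b * s b = a * s a) :
    ∃ x, x ≠ 0 ∧ (Ideal.span {x} * I).map s = Ideal.span {x} * I := by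
  obtain ⟨x, hx0, hx⟩ := exists_mul_conj_eq_mul s hs hδ0 hδ ha hab
  refine ⟨x, hx0, ?_⟩
  have hb' : Ideal.span {b} ≠ ⊥ := by simpa using hb
  apply mul_left_cancel₀ hb'
  rw [Ideal.map_mul, Ideal.map_span, Set.image_singleton, ← mul_assoc,
    Ideal.span_singleton_mul_span_singleton, hx, mul_comm a x,
    ← Ideal.span_singleton_mul_span_singleton, mul_assoc, h, mul_left_comm]

theorem mk0_span_mul [IsDedekindDomain S] {I J : Ideal S} {x y : S} (hx : x ≠ 0) (hy : y ≠ 0)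
    (hI : I ∈ (Ideal S)⁰) (hJ : J ∈ (Ideal S)⁰)
    (h : Ideal.span {x} * I = Ideal.span {y} * J) :
    ClassGroup.mk0 ⟨I, hI⟩ = ClassGroup.mk0 ⟨J, hJ⟩ :=
  ClassGroup.mk0_eq_mk0_iff.2 ⟨x, y, hx, hy, h⟩

end Involution

section Extension
open scoped nonZeroDivisors
open Module

variable {R S : Type*} [CommRing R] [CommRing S] [IsDedekindDomain R] [IsDedekindDomain S]
  [Algebra R S]

variable (s : S ≃ₐ[R] S)

theorem exists_ideal_map_eq_span (hs : ∀ x, s (s x) = x)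
    (hfix : ∀ x, s x = x → ∃ r, algebraMap R S r = x) {θ₁ θ₂ : S}
    (hθ : IsCoprime (θ₁ - s θ₁) (θ₂ - s θ₂)) {δ : S} (hδ0 : δ ≠ 0) (hδ : s δ = -δ)
    {u : Sˣ} (hu : (u : S) * s u = 1) :
    ∃ x, x ≠ 0 ∧ u * s x = x ∧ ∃ I : (Ideal R)⁰, I.1.map (algebraMap R S) = Ideal.span {x} := by
  obtain ⟨x, hx0, hx⟩ := exists_mul_conj_eq_mul s hs hδ0 hδ (a := 1) (b := u) one_ne_zero
    (by rw [hu, map_one, mul_one])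
  rw [one_mul] at hx
  have hinv : (Ideal.span {x}).map s = Ideal.span {x} := by
    rw [Ideal.map_span, Set.image_singleton, Ideal.span_singleton_eq_span_singleton]
    exact ⟨u, by rw [mul_comm, hx]⟩
  have h := map_comap_eq_of_map_eq s hs hfix hθ hinv
  refine ⟨x, hx0, hx, ⟨_, mem_nonZeroDivisors_iff_ne_zero.2 ?_⟩, h⟩
  intro h0
  have h0 : (Ideal.span {x}).comap (algebraMap R S) = 0 := h0
  rw [h0, Ideal.zero_eq_bot, Ideal.map_bot, eq_comm, Ideal.span_singleton_eq_bot] at h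
  exact hx0 h

theorem exists_eq_mul_conj_inv {u : Sˣ} {x : S} (hx0 : x ≠ 0) (hx : u * s x = x) {I : (Ideal R)⁰}
    (hI : I.1.map (algebraMap R S) = Ideal.span {x}) (h : ClassGroup.mk0 I = 1) :
    ∃ w : Sˣ, (u : S) * s w = w := by
  rw [ClassGroup.mk0_eq_one_iff] at h
  obtain ⟨y, hy⟩ := h
  rw [show (I : Ideal R) = Ideal.span {y} from hy, Ideal.map_span, Set.image_singleton,
    Ideal.span_singleton_eq_span_singleton] at hI
  obtain ⟨w, rfl⟩ := hI
  refine ⟨w, mul_left_cancel₀ (left_ne_zero_of_mul hx0) ?_⟩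
  rw [map_mul, AlgEquiv.commutes] at hx
  linear_combination hx

variable [Module.Finite R S] [IsTorsionFree R S]

theorem ClassGroup.sq_eq_one_of_extendedHom_eq_one (h2 : finrank R S = 2) {t : ClassGroup R}
    (ht : ClassGroup.extendedHom R S t = 1) : t ^ 2 = 1 := by
  obtain ⟨I, rfl⟩ := ClassGroup.mk0_surjective t
  rw [ClassGroup.extendedHom_mk0, ClassGroup.mk0_eq_one_iff] at ht
  obtain ⟨x, hx⟩ := ht
  rw [← map_pow, ClassGroup.mk0_eq_one_iff]
  have h := Ideal.relNorm_algebraMap S (I : Ideal R)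
  rw [show (I : Ideal R).map (algebraMap R S) = Ideal.span {x} from hx, Ideal.relNorm_singleton,
    h2] at h
  exact ⟨_, h.symm⟩

theorem norm_surjective_and_capitulation [Module.Finite ℤ (Additive Sˣ)] (hs : ∀ x, s (s x) = x)
    (hfix : ∀ x, s x = x → ∃ r, algebraMap R S r = x) {θ₁ θ₂ : S}
    (hθ : IsCoprime (θ₁ - s θ₁) (θ₂ - s θ₂)) {δ : S} (hδ0 : δ ≠ 0) (hδ : s δ = -δ)
    (htwo : (2 : S) ≠ 0) (h2 : finrank R S = 2)
    (hrank : finrank ℤ (Additive Sˣ) = 2 * finrank ℤ (Additive Rˣ) + 1) {c : ClassGroup R}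
    (hc : ∀ b : ClassGroup R, b ^ 2 = 1 → b = 1 ∨ b = c) :
    (∀ u : Sˣ, s u = u → ∃ w : Sˣ, (u : S) = w * s w) ∧
      ∀ b : ClassGroup R, b ^ 2 = 1 → ClassGroup.extendedHom R S b = 1 := by
  have hext : ∀ (I : (Ideal R)⁰) {x : S}, I.1.map (algebraMap R S) = Ideal.span {x} →
      ClassGroup.extendedHom R S (ClassGroup.mk0 I) = 1 := by
    intro I x hI
    rw [ClassGroup.extendedHom_mk0, ClassGroup.mk0_eq_one_iff]
    exact ⟨x, hI⟩
  set f : Sˣ →* Sˣ := Units.map (s : S →* S) with hf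
  have hfa : ∀ u : Sˣ, ((f u : Sˣ) : S) = s u := fun u => rfl
  have hdiv : ∀ u w : Sˣ, u = w / f w ↔ (u : S) * s w = w := by
    intro u w
    rw [eq_div_iff_mul_eq', ← hfa, Units.ext_iff, Units.val_mul, mul_comm]
  have hone : ∀ u : Sˣ, u * f u = 1 ↔ (u : S) * s u = 1 := by
    intro u
    rw [Units.ext_iff, Units.val_mul, hfa, Units.val_one]
  have hker : finrank ℤ (Additive (MonoidHom.id Sˣ / f).ker) = finrank ℤ (Additive Rˣ) := by
    set g : Rˣ →* Sˣ := Units.map (algebraMap R S : R →* S) with hg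
    have hginj : Function.Injective g :=
      Units.map_injective (FaithfulSMul.algebraMap_injective R S)
    have hrange : (MonoidHom.id Sˣ / f).ker = g.range := by
      ext u
      rw [MonoidHom.mem_ker, MonoidHom.div_apply, MonoidHom.id_apply, div_eq_one,
        MonoidHom.mem_range]
      constructor
      · intro hu
        obtain ⟨r, hr⟩ := hfix u (by rw [← hfa, ← hu])
        obtain ⟨r', hr'⟩ := hfix (u⁻¹ : Sˣ) (by rw [← hfa, map_inv, ← hu])
        have hrr : r * r' = 1 := by
          apply FaithfulSMul.algebraMap_injective R S
          rw [map_mul, hr, hr', map_one, Units.mul_inv]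
        exact ⟨Units.mkOfMulEqOne r r' hrr, Units.ext hr⟩
      · rintro ⟨r, rfl⟩
        ext
        rw [hfa]
        exact (AlgEquiv.commutes s _).symm
    rw [hrange]
    exact ((MulEquiv.toAdditive (MonoidHom.ofInjective hginj)).toIntLinearEquiv.finrank_eq).symm
  have key := exists_norm_eq_and_exists_not_div f (fun x => Units.ext (hs x)) (z := -1)
    (fun h => htwo ?_) (by simp) (Units.ext (by rw [hfa]; simp))
    (fun x hx => Units.eq_or_eq_neg_of_sq_eq_sq x 1 (by rw [hx, one_pow])) (by rw [hker, hrank]) ?_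
  · obtain ⟨key1, u, hu, hu'⟩ := key
    refine ⟨fun u hu => ?_, fun b hb => ?_⟩
    · obtain ⟨w, hw⟩ := key1 u (Units.ext hu)
      exact ⟨w, congrArg Units.val hw⟩
    · rcases hc b hb with rfl | rfl
      · exact map_one _
      · obtain ⟨x, hx0, hx, I, hI⟩ :=
          exists_ideal_map_eq_span s hs hfix hθ hδ0 hδ ((hone u).1 hu)
        have h1 := hext I hI
        rcases hc _ (ClassGroup.sq_eq_one_of_extendedHom_eq_one h2 h1) with h | h
        · obtain ⟨w, hw⟩ := exists_eq_mul_conj_inv s hx0 hx hI h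
          exact absurd ⟨w, (hdiv u w).2 hw⟩ hu'
        · rwa [h] at h1
  · have := congrArg Units.val h
    rw [Units.val_neg, Units.val_one] at this
    linear_combination -this
  · intro u v hu hv hu' hv'
    obtain ⟨x, hx0, hx, I, hI⟩ := exists_ideal_map_eq_span s hs hfix hθ hδ0 hδ ((hone u).1 hu)
    obtain ⟨y, hy0, hy, J, hJ⟩ := exists_ideal_map_eq_span s hs hfix hθ hδ0 hδ ((hone v).1 hv)
    have hI2 := ClassGroup.sq_eq_one_of_extendedHom_eq_one h2 (hext I hI)
    have hJ2 := ClassGroup.sq_eq_one_of_extendedHom_eq_one h2 (hext J hJ)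
    have hIc := (hc _ hI2).resolve_left fun h =>
      let ⟨w, hw⟩ := exists_eq_mul_conj_inv s hx0 hx hI h
      hu' ⟨w, (hdiv u w).2 hw⟩
    have hJc := (hc _ hJ2).resolve_left fun h =>
      let ⟨w, hw⟩ := exists_eq_mul_conj_inv s hy0 hy hJ h
      hv' ⟨w, (hdiv v w).2 hw⟩
    have hIJ : (I * J).1.map (algebraMap R S) = Ideal.span {x * y} := by
      rw [Submonoid.coe_mul, Ideal.map_mul, hI, hJ, Ideal.span_singleton_mul_span_singleton]
    obtain ⟨w, hw⟩ := exists_eq_mul_conj_inv s (u := u * v) (mul_ne_zero hx0 hy0)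
      (by rw [map_mul, Units.val_mul, mul_mul_mul_comm, hx, hy]) hIJ
      (by rw [map_mul, hJc, ← hIc, ← sq, hI2])
    exact ⟨w, (hdiv _ w).2 hw⟩

end Extension

section Parity
open scoped nonZeroDivisors
open Module

theorem four_dvd_card_of_map_ne_one {G H : Type*} [CommGroup G] [CommGroup H] (f : G →* H)
    (hf : ∀ b, b ^ 2 = 1 → f b = 1) {g : G} (hg1 : f g ≠ 1) (hg : f g ^ 2 = 1) :
    4 ∣ Nat.card G := by
  have ho : orderOf (f g) = 2 := orderOf_eq_prime hg hg1
  obtain ⟨m, hm⟩ : 2 ∣ Nat.card G :=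
    ho ▸ (orderOf_map_dvd f g).trans (orderOf_dvd_natCard g)
  have h1 : f (g ^ m) = 1 := hf _ (by rw [← pow_mul, mul_comm, ← hm, pow_card_eq_one'])
  rw [map_pow] at h1
  obtain ⟨k, rfl⟩ := ho ▸ orderOf_dvd_of_pow_eq_one h1
  exact ⟨k, by omega⟩

theorem exists_sq_ne_one_and_pow_four {G : Type*} [CommGroup G] [Finite G] {c : G}
    (hc : ∀ b : G, b ^ 2 = 1 → b = 1 ∨ b = c) (h : 4 ∣ Nat.card G) :
    ∃ t : G, t ^ 2 ≠ 1 ∧ t ^ 4 = 1 := by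
  have h1 := (powMonoidHom (α := G) 2).ker.card_mul_index
  rw [Subgroup.index_ker] at h1
  have h2 : Nat.card (powMonoidHom (α := G) 2).ker ≤ 2 := by
    rw [← SetLike.coe_sort_coe, Nat.card_coe_set_eq]
    exact (Set.ncard_le_ncard (t := {1, c}) fun b hb => hc b hb).trans
      ((Set.ncard_insert_le _ _).trans (by rw [Set.ncard_singleton]))
  have h3 : 2 ∣ Nat.card (powMonoidHom (α := G) 2).range := by
    have h4 : 0 < Nat.card (powMonoidHom (α := G) 2).ker := Nat.card_pos
    interval_cases Nat.card (powMonoidHom (α := G) 2).ker <;> omega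
  obtain ⟨⟨r, hr⟩, ht⟩ := exists_prime_orderOf_dvd_card' 2 h3
  obtain ⟨t, rfl⟩ := MonoidHom.mem_range.1 hr
  rw [Subgroup.orderOf_mk, powMonoidHom_apply] at ht
  refine ⟨t, fun h => ?_, ?_⟩
  · rw [h, orderOf_one] at ht
    omega
  · have h5 := pow_orderOf_eq_one (t ^ 2)
    rwa [ht, ← pow_mul] at h5

variable {R S : Type*} [CommRing R] [CommRing S] [IsDedekindDomain R] [IsDedekindDomain S]
  [Algebra R S] (s : S ≃ₐ[R] S)

omit [IsDedekindDomain R] in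
theorem exists_invariant_ideal (hs : ∀ x, s (s x) = x) {δ : S} (hδ0 : δ ≠ 0) (hδ : s δ = -δ)
    (hnorm : ∀ u : Sˣ, s u = u → ∃ w : Sˣ, (u : S) = w * s w) {t : ClassGroup S}
    (ht1 : t ≠ 1) (ht : t ^ 2 = 1) :
    ∃ J : (Ideal S)⁰, J.1.map s = J.1 ∧ ClassGroup.mk0 J ≠ 1 ∧ ClassGroup.mk0 J ^ 2 = 1 := by
  obtain ⟨I, rfl⟩ := ClassGroup.mk0_surjective t
  have hmem : ∀ J : (Ideal S)⁰, J.1.map s ∈ (Ideal S)⁰ := fun J =>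
    mem_nonZeroDivisors_iff_ne_zero.2 fun h => nonZeroDivisors.coe_ne_zero J <| by
      rw [← Ideal.map_map_of_involutive s hs J.1, h, Ideal.zero_eq_bot, Ideal.map_bot]
  set I' : (Ideal S)⁰ := ⟨I.1.map s, hmem I⟩ with hI'
  have ht' : ClassGroup.mk0 I' ^ 2 = 1 := by
    rw [← map_pow, ClassGroup.mk0_eq_one_iff] at ht ⊢
    obtain ⟨a, ha⟩ := ht
    refine ⟨s a, ?_⟩
    have h := congrArg (Ideal.map s) ha
    rw [SubmonoidClass.coe_pow, Ideal.map_pow, Ideal.submodule_span_eq, Ideal.map_span,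
      Set.image_singleton] at h
    exact h
  by_cases h : ClassGroup.mk0 (I * I') = 1
  · have h' : ClassGroup.mk0 I' = ClassGroup.mk0 I := by
      rw [map_mul] at h
      rw [sq] at ht'
      exact mul_right_cancel (ht'.trans h.symm)
    obtain ⟨a, b, ha, hb, hab⟩ := ClassGroup.mk0_eq_mk0_iff.1 h'
    have hab : Ideal.span {a} * I.1.map s = Ideal.span {b} * I.1 := hab
    obtain ⟨u, hu⟩ := exists_unit_mul_conj s hs (nonZeroDivisors.coe_ne_zero I) hab
    obtain ⟨v, hv⟩ := hnorm u <| by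
      have h2 := congrArg s hu
      rw [map_mul, map_mul, map_mul, hs, hs, mul_comm (s b), hu, mul_comm (s a)] at h2
      exact (mul_right_cancel₀ (mul_ne_zero ha (by simpa using ha)) h2).symm
    obtain ⟨x, hx0, hx⟩ := exists_map_span_mul_eq s hs hδ0 hδ (a := a * v) (b := b)
      (mul_ne_zero ha v.ne_zero) hb
      (by rw [← hab, Ideal.span_singleton_mul_right_unit v.isUnit])
      (by rw [hu, hv, map_mul]; ring)
    have hJ : Ideal.span {x} * I.1 ∈ (Ideal S)⁰ :=
      mul_mem (mem_nonZeroDivisors_iff_ne_zero.2 (by simpa using hx0)) I.2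
    have hc : ClassGroup.mk0 (⟨_, hJ⟩ : (Ideal S)⁰) = ClassGroup.mk0 I :=
      ClassGroup.mk0_eq_mk0_iff.2 ⟨1, x, one_ne_zero, hx0, by simp⟩
    exact ⟨⟨_, hJ⟩, hx, by rwa [hc], by rwa [hc]⟩
  · refine ⟨I * I', ?_, h, by rw [map_mul, mul_pow, ht, ht', one_mul]⟩
    rw [Submonoid.coe_mul, Ideal.map_mul, hI', Ideal.map_map_of_involutive s hs, mul_comm]

theorem four_dvd_card_classGroup_iff [Module.Finite R S] [IsTorsionFree R S]
    [Module.Finite ℤ (Additive Sˣ)] [Finite (ClassGroup R)] [Finite (ClassGroup S)]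
    (hs : ∀ x, s (s x) = x)
    (hfix : ∀ x, s x = x → ∃ r, algebraMap R S r = x) {θ₁ θ₂ : S}
    (hθ : IsCoprime (θ₁ - s θ₁) (θ₂ - s θ₂)) {δ : S} (hδ0 : δ ≠ 0) (hδ : s δ = -δ)
    (htwo : (2 : S) ≠ 0) (h2 : finrank R S = 2)
    (hrank : finrank ℤ (Additive Sˣ) = 2 * finrank ℤ (Additive Rˣ) + 1) {c : ClassGroup R}
    (hc : ∀ b : ClassGroup R, b ^ 2 = 1 → b = 1 ∨ b = c) :
    4 ∣ Nat.card (ClassGroup R) ↔ 2 ∣ Nat.card (ClassGroup S) := by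
  obtain ⟨hnorm, hcap⟩ :=
    norm_surjective_and_capitulation s hs hfix hθ hδ0 hδ htwo h2 hrank hc
  constructor
  · intro h
    obtain ⟨t, ht2, ht4⟩ := exists_sq_ne_one_and_pow_four hc h
    by_contra hodd
    refine ht2 (ClassGroup.sq_eq_one_of_extendedHom_eq_one (S := S) h2 ?_)
    have h1 : ClassGroup.extendedHom R S t ^ 4 = 1 := by rw [← map_pow, ht4, map_one]
    have hcop : Nat.Coprime 4 (Nat.card (ClassGroup S)) :=
      (Nat.prime_two.coprime_iff_not_dvd.2 hodd).pow_left 2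
    rw [← orderOf_eq_one_iff]
    exact Nat.eq_one_of_dvd_coprimes hcop (orderOf_dvd_of_pow_eq_one h1)
      (orderOf_dvd_natCard _)
  · intro h
    obtain ⟨t, ht⟩ := exists_prime_orderOf_dvd_card' 2 h
    obtain ⟨J, hJ, hJ1, hJ2⟩ := exists_invariant_ideal s hs hδ0 hδ hnorm (t := t)
      (fun h => by rw [h, orderOf_one] at ht; omega) (ht ▸ pow_orderOf_eq_one t)
    have hmap := map_comap_eq_of_map_eq s hs hfix hθ hJ
    have hmem : J.1.comap (algebraMap R S) ∈ (Ideal R)⁰ :=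
      mem_nonZeroDivisors_iff_ne_zero.2 fun h => nonZeroDivisors.coe_ne_zero J <| by
        rw [← hmap, h, Ideal.zero_eq_bot, Ideal.map_bot, Ideal.zero_eq_bot]
    have hext : ClassGroup.extendedHom R S (ClassGroup.mk0 ⟨_, hmem⟩) = ClassGroup.mk0 J := by
      rw [ClassGroup.extendedHom_mk0]
      exact congrArg _ (Subtype.ext hmap)
    exact four_dvd_card_of_map_ne_one _ hcap (hext ▸ hJ1) (hext ▸ hJ2)

end Parity

section Genus
open scoped nonZeroDivisors
open Module

variable {O : Type*} [CommRing O] [IsDomain O] (s : O ≃ₐ[ℤ] O)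

theorem span_pair_mul_span_pair {δ m n : O} (hδ : δ ^ 2 = m * n) (hmn : IsCoprime m n) :
    Ideal.span {m, δ} * Ideal.span {n, δ} = Ideal.span {δ} := by
  obtain ⟨u, v, huv⟩ := hmn
  rw [Ideal.span_pair_mul_span_pair]
  refine le_antisymm ?_ ?_
  · rw [Ideal.span_le]
    rintro x (rfl | rfl | rfl | rfl) <;> rw [SetLike.mem_coe, Ideal.mem_span_singleton]
    · exact ⟨δ, by rw [← hδ, sq]⟩
    · exact dvd_mul_left _ _
    · exact dvd_mul_right _ _
    · exact dvd_mul_right _ _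
  · rw [Ideal.span_singleton_le_iff_mem]
    have h : δ = u * (m * δ) + v * (δ * n) := by linear_combination -δ * huv
    have h₁ : m * δ ∈ Ideal.span {m * n, m * δ, δ * n, δ * δ} := Ideal.subset_span (by simp)
    have h₂ : δ * n ∈ Ideal.span {m * n, m * δ, δ * n, δ * δ} := Ideal.subset_span (by simp)
    have h₃ := Ideal.add_mem _ (Ideal.mul_mem_left _ u h₁) (Ideal.mul_mem_left _ v h₂)
    rwa [← h] at h₃

theorem span_pair_sq {δ m n : O} (hδ : δ ^ 2 = m * n) (hmn : IsCoprime m n) :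
    Ideal.span {m, δ} * Ideal.span {m, δ} = Ideal.span {m} := by
  obtain ⟨u, v, huv⟩ := hmn
  rw [Ideal.span_pair_mul_span_pair]
  refine le_antisymm ?_ ?_
  · rw [Ideal.span_le]
    rintro x (rfl | rfl | rfl | rfl) <;> rw [SetLike.mem_coe, Ideal.mem_span_singleton]
    · exact dvd_mul_right _ _
    · exact dvd_mul_right _ _
    · exact dvd_mul_left _ _
    · exact ⟨n, by rw [← hδ, sq]⟩
  · rw [Ideal.span_singleton_le_iff_mem]
    have h : m = u * (m * m) + v * (δ * δ) := by linear_combination -m * huv - v * hδ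
    have h₁ : m * m ∈ Ideal.span {m * m, m * δ, δ * m, δ * δ} := Ideal.subset_span (by simp)
    have h₂ : δ * δ ∈ Ideal.span {m * m, m * δ, δ * m, δ * δ} := Ideal.subset_span (by simp)
    have h₃ := Ideal.add_mem _ (Ideal.mul_mem_left _ u h₁) (Ideal.mul_mem_left _ v h₂)
    rwa [← h] at h₃

variable [CharZero O]

theorem eq_span_pair_of_invariant (hs : ∀ x, s (s x) = x)
    (hfix : ∀ x, s x = x → ∃ r, algebraMap ℤ O r = x) {δ : O} (hδ : s δ = -δ) {d : ℤ}
    (hd : δ ^ 2 = d) (hsq : Squarefree d) (hodd : Odd d) {L : Ideal O} (hL : L.map s = L)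
    (hδL : δ ∈ L) : ∃ k : ℕ, (k : ℤ) ∣ d ∧ L = Ideal.span {(k : O), δ} := by
  have hd0 : d ≠ 0 := hsq.ne_zero
  have hδ0 : δ ≠ 0 := by
    rintro rfl
    simp [eq_comm, hd0] at hd
  have hsL : ∀ y ∈ L, s y ∈ L := fun y hy => hL ▸ Ideal.mem_map_of_mem s hy
  obtain ⟨k', hk'⟩ := (IsPrincipalIdealRing.principal (L.comap (algebraMap ℤ O))).principal
  obtain ⟨k, hk⟩ : ∃ k : ℕ, ∀ t : ℤ, (t : O) ∈ L ↔ (k : ℤ) ∣ t := by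
    refine ⟨k'.natAbs, fun t => ?_⟩
    rw [Int.natAbs_dvd, ← Ideal.mem_span_singleton, ← Ideal.submodule_span_eq, ← hk',
      Ideal.mem_comap, eq_intCast]
  refine ⟨k, (hk d).1 (hd ▸ L.pow_mem_of_mem hδL 2 two_pos), le_antisymm (fun x hx => ?_) ?_⟩
  · obtain ⟨t, ht⟩ := hfix (x + s x) (by rw [map_add, hs, add_comm])
    obtain ⟨m, hm⟩ := hfix (δ * (x - s x)) (by rw [map_mul, map_sub, hs, hδ]; ring)
    obtain ⟨e, he⟩ := hfix ((x - s x) ^ 2) (by rw [map_pow, map_sub, hs]; ring)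
    rw [eq_intCast] at ht hm he
    have hme : m ^ 2 = d * e := by
      have : ((m ^ 2 : ℤ) : O) = (d * e : ℤ) := by
        push_cast
        rw [hm, he, ← hd]
        ring
      exact_mod_cast this
    obtain ⟨r, rfl⟩ := (hsq.dvd_pow_iff_dvd two_ne_zero).1 ⟨e, hme⟩
    have hr : x - s x = r * δ := by
      apply mul_left_cancel₀ hδ0
      rw [← hm]
      push_cast
      rw [← hd]
      ring
    obtain ⟨t', rfl⟩ := (hk t).1 (ht ▸ L.add_mem hx (hsL x hx))
    obtain ⟨f, rfl⟩ := hodd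
    rw [Ideal.mem_span_pair]
    push_cast at hd ht
    refine ⟨-f * t', δ * x - f * r, ?_⟩
    linear_combination x * hd - f * ht + f * hr
  · rw [Ideal.span_le, Set.insert_subset_iff, Set.singleton_subset_iff]
    exact ⟨by simpa using (hk k).2 dvd_rfl, hδL⟩

variable [IsDedekindDomain O]

omit [IsDomain O] in
theorem exists_span_mul_eq_of_invariant (hs : ∀ x, s (s x) = x)
    (hfix : ∀ x, s x = x → ∃ r, algebraMap ℤ O r = x) {δ θ : O} (hδ : s δ = -δ)
    (hθ : θ - s θ = δ) {p q : ℕ} (hp : p.Prime) (hq : q.Prime) (hpq : p ≠ q) (hp2 : Odd p)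
    (hq2 : Odd q) (hd : δ ^ 2 = p * q) {J : Ideal O} (hJ0 : J ≠ ⊥) (hJ : J.map s = J) :
    ∃ (n : ℤ) (L : Ideal O), n ≠ 0 ∧ Ideal.span {δ} * J = Ideal.span {(n : O)} * L ∧
      (L = ⊤ ∨ L = Ideal.span {δ} ∨ L = Ideal.span {(p : O), δ} ∨ L = Ideal.span {(q : O), δ}) := by
  have hδ0 : δ ≠ 0 := by
    rintro rfl
    simp [eq_comm, hp.ne_zero, hq.ne_zero] at hd
  have hss := Ideal.map_map_of_involutive s hs J
  obtain ⟨n, hn⟩ := (IsPrincipalIdealRing.principal (J.comap (algebraMap ℤ O))).principal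
  rw [Ideal.submodule_span_eq] at hn
  have hsub : ∀ x ∈ J, δ * x ∈ Ideal.span {(n : O)} := by
    intro x hx
    have h := sub_mul_mem_map_comap s hs hfix hJ θ hx
    rwa [hθ, hn, Ideal.map_span, Set.image_singleton, eq_intCast] at h
  have hnJ : (n : O) ∈ J := by
    have h : n ∈ J.comap (algebraMap ℤ O) := hn ▸ Ideal.mem_span_singleton_self n
    simpa using h
  obtain ⟨x, hx, hx0⟩ := Submodule.exists_mem_ne_zero_of_ne_bot hJ0
  have hn0 : n ≠ 0 := by
    rintro rfl
    have h := hsub x hx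
    simp [hδ0, hx0] at h
  have hnO : (n : O) ≠ 0 := by exact_mod_cast hn0
  have hnI : Ideal.span {(n : O)} ≠ 0 := by simpa using hn0
  obtain ⟨L, hL⟩ : Ideal.span {(n : O)} ∣ Ideal.span {δ} * J := by
    rw [Ideal.dvd_iff_le, Ideal.span_singleton_mul_le_iff]
    exact hsub
  refine ⟨n, L, hn0, hL, ?_⟩
  have hLinv : L.map s = L := by
    apply mul_left_cancel₀ hnI
    have h := congrArg (Ideal.map s) hL
    rw [Ideal.map_mul, Ideal.map_mul, Ideal.map_span, Ideal.map_span, Set.image_singleton,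
      Set.image_singleton, hδ, hJ, map_intCast, Ideal.span_singleton_neg] at h
    rw [← h, hL]
  have hδL : δ ∈ L := by
    have h : δ * n ∈ Ideal.span {(n : O)} * L := by
      rw [← hL]
      exact Ideal.mul_mem_mul (Ideal.mem_span_singleton_self δ) hnJ
    rw [Ideal.mem_span_singleton_mul] at h
    obtain ⟨z, hz, hzn⟩ := h
    rw [mul_comm δ] at hzn
    rwa [← mul_left_cancel₀ hnO hzn]
  have hsq : Squarefree ((p * q : ℕ) : ℤ) := by
    rw [Int.squarefree_natCast, Nat.squarefree_mul ((Nat.coprime_primes hp hq).2 hpq)]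
    exact ⟨hp.prime.squarefree, hq.prime.squarefree⟩
  obtain ⟨k, hk, rfl⟩ := eq_span_pair_of_invariant s hs hfix hδ (d := ((p * q : ℕ) : ℤ))
    (by rw [hd]; push_cast; rfl) hsq (by exact_mod_cast hp2.mul hq2) hLinv hδL
  obtain ⟨k₁, k₂, h₁, h₂, rfl⟩ := Nat.dvd_mul.1 (Int.natCast_dvd_natCast.1 hk)
  rcases (Nat.dvd_prime hp).1 h₁ with rfl | rfl <;> rcases (Nat.dvd_prime hq).1 h₂ with rfl | rfl
  · left
    rw [Ideal.eq_top_iff_one]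
    exact Ideal.subset_span (by simp)
  · simp
  · simp
  · right; left
    push_cast
    rw [← hd]
    refine le_antisymm ?_ (Ideal.span_mono (by simp))
    rw [Ideal.span_le]
    rintro x (rfl | rfl) <;> rw [SetLike.mem_coe, Ideal.mem_span_singleton]
    exact dvd_pow_self _ two_ne_zero

end Genus

section TwoTorsion
open scoped nonZeroDivisors
open Module

variable {O : Type*} [CommRing O] [IsDedekindDomain O] (s : O ≃ₐ[ℤ] O)

theorem mk0_span_pair_eq {p q : ℕ} (hp : p.Prime) (hq : q.Prime) (hpq : p ≠ q) {δ : O}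
    (hd : δ ^ 2 = p * q) {P Q : (Ideal O)⁰} (hP : P.1 = Ideal.span {(p : O), δ})
    (hQ : Q.1 = Ideal.span {(q : O), δ}) : ClassGroup.mk0 Q = ClassGroup.mk0 P := by
  have hcop : IsCoprime (p : O) (q : O) := by
    simpa using ((Nat.coprime_primes hp hq).2 hpq).isCoprime.map (Int.castRingHom O)
  have h1 : ClassGroup.mk0 P * ClassGroup.mk0 Q = 1 := by
    rw [← map_mul, ClassGroup.mk0_eq_one_iff, Submonoid.coe_mul, hP, hQ,
      span_pair_mul_span_pair hd hcop]
    exact ⟨δ, rfl⟩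
  have h2 : ClassGroup.mk0 P * ClassGroup.mk0 P = 1 := by
    rw [← map_mul, ClassGroup.mk0_eq_one_iff, Submonoid.coe_mul, hP, span_pair_sq hd hcop]
    exact ⟨(p : O), rfl⟩
  exact mul_left_cancel (h1.trans h2.symm)

/-- For an involution `s` of `O`, the class `b` contains an ideal `I` such that `I.map s` is
proportional to `I`, the factors of proportionality having norms in the ratio `ε`. -/
def IsAmbiguousClass (ε : O) (b : ClassGroup O) : Prop :=
  ∃ (I : (Ideal O)⁰) (x y : O), ClassGroup.mk0 I = b ∧ x ≠ 0 ∧ y ≠ 0 ∧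
    Ideal.span {x} * I.1.map s = Ideal.span {y} * I.1 ∧ y * s y = ε * (x * s x)

variable {s}

theorem IsAmbiguousClass.mul {ε ε' : O} {b b' : ClassGroup O} (h : IsAmbiguousClass s ε b)
    (h' : IsAmbiguousClass s ε' b') : IsAmbiguousClass s (ε * ε') (b * b') := by
  obtain ⟨I, x, y, rfl, hx, hy, hI, hxy⟩ := h
  obtain ⟨I', x', y', rfl, hx', hy', hI', hxy'⟩ := h'
  refine ⟨I * I', x * x', y * y', map_mul _ _ _, mul_ne_zero hx hx', mul_ne_zero hy hy', ?_, ?_⟩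
  · rw [Submonoid.coe_mul, Ideal.map_mul, ← Ideal.span_singleton_mul_span_singleton,
      ← Ideal.span_singleton_mul_span_singleton, mul_mul_mul_comm, hI, hI', mul_mul_mul_comm]
  · rw [map_mul, map_mul]
    linear_combination y' * s y' * hxy + ε * (x * s x) * hxy'

theorem IsAmbiguousClass.exists_invariant (hs : ∀ x, s (s x) = x) {δ : O} (hδ0 : δ ≠ 0)
    (hδ : s δ = -δ) {b : ClassGroup O} (h : IsAmbiguousClass s 1 b) :
    ∃ J : (Ideal O)⁰, J.1.map s = J.1 ∧ ClassGroup.mk0 J = b := by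
  obtain ⟨I, x, y, rfl, hx, hy, hI, hxy⟩ := h
  rw [one_mul] at hxy
  obtain ⟨z, hz0, hz⟩ := exists_map_span_mul_eq s hs hδ0 hδ hx hy hI hxy
  have hJ : Ideal.span {z} * I.1 ∈ (Ideal O)⁰ :=
    mul_mem (mem_nonZeroDivisors_iff_ne_zero.2 (by simpa using hz0)) I.2
  exact ⟨⟨_, hJ⟩, hz, ClassGroup.mk0_eq_mk0_iff.2 ⟨1, z, one_ne_zero, hz0, by simp⟩⟩

theorem IsAmbiguousClass.of_unit {ε : O} {b : ClassGroup O} (h : IsAmbiguousClass s ε b) {v : Oˣ}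
    (hv : (v : O) * s v = ε) : IsAmbiguousClass s 1 b := by
  obtain ⟨I, x, y, rfl, hx, hy, hI, hxy⟩ := h
  refine ⟨I, x * v, y, rfl, mul_ne_zero hx v.ne_zero, hy, ?_, ?_⟩
  · rw [← hI, Ideal.span_singleton_mul_right_unit v.isUnit]
  · rw [hxy, ← hv, map_mul]
    ring

theorem isAmbiguousClass_of_sq_eq_one [Module.Free ℤ O] [Module.Finite ℤ O] [CharZero O]
    (h2 : finrank ℤ O = 2) (hfix : ∀ x, s x = x → ∃ r, algebraMap ℤ O r = x)
    (hs : ∀ x, s (s x) = x) {b : ClassGroup O} (hb : b ^ 2 = 1) :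
    IsAmbiguousClass s 1 b ∨ IsAmbiguousClass s (-1) b := by
  obtain ⟨I, rfl⟩ := ClassGroup.mk0_surjective b
  rw [← map_pow, ClassGroup.mk0_eq_one_iff] at hb
  obtain ⟨a, ha⟩ := hb
  rw [SubmonoidClass.coe_pow, Ideal.submodule_span_eq] at ha
  have hI0 : I.1 ≠ ⊥ := nonZeroDivisors.coe_ne_zero I
  have ha0 : a ≠ 0 := by
    rintro rfl
    rw [Ideal.span_singleton_zero] at ha
    exact hI0 (eq_zero_of_pow_eq_zero ha)
  obtain ⟨m, hm⟩ := hfix (a * s a) (by rw [map_mul, hs, mul_comm])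
  have hnm : Algebra.norm ℤ a ^ 2 = m ^ 2 := by
    have h := congrArg (Algebra.norm ℤ) hm
    rw [map_mul, Algebra.norm_eq_of_algEquiv,
      Algebra.norm_algebraMap_of_basis (Free.chooseBasis ℤ O),
      ← finrank_eq_card_chooseBasisIndex, h2] at h
    rw [h, sq]
  set n : ℕ := Ideal.absNorm I.1 with hn
  have hn0 : n ≠ 0 := by rwa [hn, Ne, Ideal.absNorm_eq_zero_iff]
  have hnn : n ^ 2 = m.natAbs := by
    rw [hn, ← map_pow, ha, Ideal.absNorm_span_singleton, Int.natAbs_eq_iff_sq_eq]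
    exact hnm
  have hmn : (m : O) = (n : O) ^ 2 ∨ (m : O) = - (n : O) ^ 2 := by
    rcases Int.natAbs_eq m with h | h
    · left; rw [h, ← hnn]; push_cast; rfl
    · right; rw [h, ← hnn]; push_cast; rfl
  rw [eq_intCast] at hm
  have hrel : Ideal.span {a} * I.1.map s = Ideal.span {(n : O)} * I.1 := by
    have h : (Ideal.span {a} * I.1.map s) ^ 2 = (Ideal.span {(n : O)} * I.1) ^ 2 := by
      have hm' : Ideal.span {(m : O)} = Ideal.span {(n : O) ^ 2} := by
        rcases hmn with h | h <;> rw [h]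
        rw [Ideal.span_singleton_neg]
      rw [mul_pow, mul_pow, ← Ideal.map_pow, ha, Ideal.map_span, Set.image_singleton, sq, mul_assoc,
        Ideal.span_singleton_mul_span_singleton, ← hm, hm', Ideal.span_singleton_pow, mul_comm]
    exact pow_left_injective two_ne_zero h
  rcases hmn with h | h
  · exact Or.inl ⟨I, a, n, rfl, ha0, by exact_mod_cast hn0, hrel,
      by rw [map_natCast, ← hm, h, sq, one_mul]⟩
  · exact Or.inr ⟨I, a, n, rfl, ha0, by exact_mod_cast hn0, hrel,
      by rw [map_natCast, ← hm, h, sq]; ring⟩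

end TwoTorsion

section TwoTorsionRank
open scoped nonZeroDivisors
open Module

theorem exists_ne_sq_and_ne_mul_sq {A : Type*} [CommGroup A] [Module.Finite ℤ (Additive A)] {z : A}
    (hz1 : z ≠ 1) (hz : z ^ 2 = 1) (htor : ∀ x : A, x ^ 2 = 1 → x = 1 ∨ x = z)
    (hrank : 1 ≤ finrank ℤ (Additive A)) : ∃ u : A, ∀ w, u ≠ w ^ 2 ∧ u ≠ z * w ^ 2 := by
  by_contra! hcon
  have h := index_range_sq hz1 hz htor
  have hle : (powMonoidHom (α := A) 2).range.index ≤ Nat.card Bool := by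
    refine Nat.card_le_card_of_surjective
      (fun i : Bool => ((if i then 1 else z : A) : A ⧸ (powMonoidHom (α := A) 2).range)) ?_
    intro x
    obtain ⟨u, rfl⟩ := QuotientGroup.mk_surjective x
    obtain ⟨w, hw⟩ := hcon u
    by_cases h1 : u = w ^ 2
    · refine ⟨true, QuotientGroup.eq.2 ⟨w, ?_⟩⟩
      simp [h1]
    · refine ⟨false, QuotientGroup.eq.2 ⟨w, ?_⟩⟩
      simp [hw h1]
  have h4 : 2 ^ 2 ≤ 2 ^ (finrank ℤ (Additive A) + 1) := Nat.pow_le_pow_right two_pos (by omega)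
  rw [Nat.card_eq_fintype_card, Fintype.card_bool] at hle
  omega

variable {O : Type*} [CommRing O] [IsDedekindDomain O] [CharZero O] (s : O ≃ₐ[ℤ] O)

theorem mk0_eq_one_or_eq_of_invariant (hs : ∀ x, s (s x) = x)
    (hfix : ∀ x, s x = x → ∃ r, algebraMap ℤ O r = x) {δ θ : O} (hδ : s δ = -δ)
    (hθ : θ - s θ = δ) {p q : ℕ} (hp : p.Prime) (hq : q.Prime) (hpq : p ≠ q) (hp2 : Odd p)
    (hq2 : Odd q) (hd : δ ^ 2 = p * q) {P J : (Ideal O)⁰} (hP : P.1 = Ideal.span {(p : O), δ})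
    (hJ : J.1.map s = J.1) : ClassGroup.mk0 J = 1 ∨ ClassGroup.mk0 J = ClassGroup.mk0 P := by
  have hδ0 : δ ≠ 0 := by
    rintro rfl
    simp [eq_comm, hp.ne_zero, hq.ne_zero] at hd
  obtain ⟨n, L, hn, hL, h⟩ := exists_span_mul_eq_of_invariant s hs hfix hδ hθ hp hq hpq hp2 hq2 hd
    (nonZeroDivisors.coe_ne_zero J) hJ
  have hn' : (n : O) ≠ 0 := by exact_mod_cast hn
  have hL0 : L ∈ (Ideal O)⁰ := by
    rw [mem_nonZeroDivisors_iff_ne_zero]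
    rintro rfl
    rw [mul_zero] at hL
    exact mul_ne_zero (by simpa using hδ0) (nonZeroDivisors.coe_ne_zero J) hL
  have hJL : ClassGroup.mk0 J = ClassGroup.mk0 ⟨L, hL0⟩ := mk0_span_mul hδ0 hn' J.2 hL0 hL
  rw [hJL]
  rcases h with rfl | rfl | rfl | rfl
  · exact Or.inl ((ClassGroup.mk0_eq_one_iff _).2 ⟨1, by simp⟩)
  · exact Or.inl ((ClassGroup.mk0_eq_one_iff _).2 ⟨δ, rfl⟩)
  · exact Or.inr (congrArg _ (Subtype.ext hP.symm))
  · exact Or.inr (mk0_span_pair_eq hp hq hpq hd hP rfl)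

theorem mk0_span_pair_eq_one (hs : ∀ x, s (s x) = x)
    (hfix : ∀ x, s x = x → ∃ r, algebraMap ℤ O r = x) {δ θ : O} (hδ : s δ = -δ)
    (hθ : θ - s θ = δ) {p q : ℕ} (hp : p.Prime) (hq : q.Prime) (hpq : p ≠ q) (hp2 : Odd p)
    (hq2 : Odd q) (hd : δ ^ 2 = p * q) {P : (Ideal O)⁰} (hP : P.1 = Ideal.span {(p : O), δ})
    (hnorm : ∀ u : Oˣ, (u : O) * s u = 1) {ε : Oˣ} (hε : ∀ w, ε ≠ w ^ 2 ∧ ε ≠ -1 * w ^ 2) :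
    ClassGroup.mk0 P = 1 := by
  have hδ0 : δ ≠ 0 := by
    rintro rfl
    simp [eq_comm, hp.ne_zero, hq.ne_zero] at hd
  obtain ⟨x, hx0, hx⟩ := exists_mul_conj_eq_mul s hs hδ0 hδ (a := 1) (b := ε) one_ne_zero
    (by rw [hnorm, map_one, mul_one])
  rw [one_mul] at hx
  have hinv : (Ideal.span {x}).map s = Ideal.span {x} := by
    rw [Ideal.map_span, Set.image_singleton, Ideal.span_singleton_eq_span_singleton]
    exact ⟨ε, by rw [mul_comm, hx]⟩
  have hx0' : Ideal.span {x} ≠ ⊥ := by simpa using hx0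
  obtain ⟨n, L, hn, hL, h⟩ := exists_span_mul_eq_of_invariant s hs hfix hδ hθ hp hq hpq hp2 hq2 hd
    hx0' hinv
  have hn' : (n : O) ≠ 0 := by exact_mod_cast hn
  have hsx : s x ≠ 0 := by simpa using hx0
  have hJ1 : ClassGroup.mk0 ⟨Ideal.span {x}, mem_nonZeroDivisors_iff_ne_zero.2 hx0'⟩ = 1 :=
    (ClassGroup.mk0_eq_one_iff _).2 ⟨x, rfl⟩
  rcases h with rfl | rfl | rfl | rfl
  · rw [Ideal.mul_top, Ideal.span_singleton_mul_span_singleton,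
      Ideal.span_singleton_eq_span_singleton] at hL
    obtain ⟨v, hv⟩ := hL
    have h1 := congrArg s hv
    rw [map_mul, map_mul, hδ, map_intCast, ← hv] at h1
    have h2 : -s v = ε * v := mul_left_cancel₀ (mul_ne_zero hδ0 hsx)
      (by linear_combination h1 - δ * v * hx)
    refine absurd ?_ (hε v⁻¹).2
    rw [inv_pow, eq_mul_inv_iff_mul_eq, Units.ext_iff]
    push_cast
    linear_combination -(v : O) * h2 - hnorm v
  · rw [mul_comm, Ideal.span_singleton_mul_span_singleton, Ideal.span_singleton_mul_span_singleton,
      Ideal.span_singleton_eq_span_singleton] at hL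
    obtain ⟨v, hv⟩ := hL
    have h0 : x * v = n := mul_right_cancel₀ hδ0 (by linear_combination hv)
    have h1 := congrArg s h0
    rw [map_mul, map_intCast, ← h0] at h1
    have h2 : s v = ε * v := mul_left_cancel₀ hsx (by linear_combination h1 - v * hx)
    refine absurd ?_ (hε v⁻¹).1
    rw [inv_pow, eq_inv_iff_mul_eq_one, Units.ext_iff]
    push_cast
    linear_combination -(v : O) * h2 + hnorm v
  · rw [← hJ1]
    exact (mk0_span_mul hδ0 hn' _ P.2 (by rw [hL, hP])).symm
  · have hQ : Ideal.span {(q : O), δ} ∈ (Ideal O)⁰ := by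
      rw [mem_nonZeroDivisors_iff_ne_zero]
      intro h
      rw [h, mul_zero] at hL
      exact mul_ne_zero (by simpa using hδ0) hx0' hL
    rw [← mk0_span_pair_eq hp hq hpq hd hP (Q := ⟨_, hQ⟩) rfl, ← hJ1]
    exact (mk0_span_mul hδ0 hn' _ hQ hL).symm

theorem exists_forall_classGroup_sq_eq_one [Module.Free ℤ O] [Module.Finite ℤ O]
    [Module.Finite ℤ (Additive Oˣ)] (hs : ∀ x, s (s x) = x)
    (hfix : ∀ x, s x = x → ∃ r, algebraMap ℤ O r = x) {δ θ : O} (hδ : s δ = -δ)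
    (hθ : θ - s θ = δ) {p q : ℕ} (hp : p.Prime) (hq : q.Prime) (hpq : p ≠ q) (hp2 : Odd p)
    (hq2 : Odd q) (hd : δ ^ 2 = p * q) (h2 : finrank ℤ O = 2)
    (hrank : 1 ≤ finrank ℤ (Additive Oˣ)) :
    ∃ c : ClassGroup O, ∀ b : ClassGroup O, b ^ 2 = 1 → b = 1 ∨ b = c := by
  have hδ0 : δ ≠ 0 := by
    rintro rfl
    simp [eq_comm, hp.ne_zero, hq.ne_zero] at hd
  have hPmem : Ideal.span {(p : O), δ} ∈ (Ideal O)⁰ := by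
    rw [mem_nonZeroDivisors_iff_ne_zero]
    intro h
    have h1 : δ ∈ Ideal.span {(p : O), δ} := Ideal.subset_span (by simp)
    rw [h] at h1
    exact hδ0 (by simpa using h1)
  have hP : (⟨_, hPmem⟩ : (Ideal O)⁰).1 = Ideal.span {(p : O), δ} := rfl
  set P : (Ideal O)⁰ := ⟨_, hPmem⟩
  have hone : ∀ b, IsAmbiguousClass s 1 b → b = 1 ∨ b = ClassGroup.mk0 P := by
    intro b hb
    obtain ⟨J, hJ, rfl⟩ := hb.exists_invariant hs hδ0 hδ
    exact mk0_eq_one_or_eq_of_invariant s hs hfix hδ hθ hp hq hpq hp2 hq2 hd hP hJ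
  have hunit : ∀ u : Oˣ, (u : O) * s u = 1 ∨ (u : O) * s u = -1 := by
    intro u
    obtain ⟨r, hr⟩ := hfix (u * s u) (by rw [map_mul, hs, mul_comm])
    have hu : ((u⁻¹ : Oˣ) : O) * s (u⁻¹ : Oˣ) * (u * s u) = 1 := by
      rw [mul_mul_mul_comm, ← map_mul, Units.inv_mul, map_one, mul_one]
    obtain ⟨r', hr'⟩ := hfix ((u⁻¹ : Oˣ) * s (u⁻¹ : Oˣ)) (by rw [map_mul, hs, mul_comm])
    rw [← hr, ← hr', eq_intCast, eq_intCast] at hu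
    have hrr : r' * r = 1 := by exact_mod_cast hu
    rw [← hr, eq_intCast]
    rcases Int.eq_one_or_neg_one_of_mul_eq_one' hrr with h | h <;> simp [h.2]
  by_cases hneg : ∃ v : Oˣ, (v : O) * s v = -1
  · obtain ⟨v, hv⟩ := hneg
    refine ⟨ClassGroup.mk0 P, fun b hb => hone b ?_⟩
    rcases isAmbiguousClass_of_sq_eq_one h2 hfix hs hb with h | h
    · exact h
    · exact h.of_unit hv
  · have hnorm : ∀ u : Oˣ, (u : O) * s u = 1 := fun u =>
      (hunit u).resolve_right fun h => hneg ⟨u, h⟩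
    obtain ⟨ε, hε⟩ := exists_ne_sq_and_ne_mul_sq (A := Oˣ) (z := -1) (fun h => by
      have h' := congrArg Units.val h
      rw [Units.val_neg, Units.val_one] at h'
      exact two_ne_zero (α := O) (by linear_combination -h')) (by simp)
      (fun x hx => Units.eq_or_eq_neg_of_sq_eq_sq x 1 (by rw [hx, one_pow])) hrank
    have hP1 := mk0_span_pair_eq_one s hs hfix hδ hθ hp hq hpq hp2 hq2 hd hP hnorm hε
    have hone' : ∀ b, IsAmbiguousClass s 1 b → b = 1 := fun b hb => by
      simpa [hP1] using hone b hb
    by_cases hc : ∃ c : ClassGroup O, IsAmbiguousClass s (-1) c ∧ c ^ 2 = 1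
    · obtain ⟨c, hc, hc2⟩ := hc
      refine ⟨c, fun b hb => ?_⟩
      rcases isAmbiguousClass_of_sq_eq_one h2 hfix hs hb with h | h
      · exact Or.inl (hone' b h)
      · right
        have h3 := h.mul hc
        rw [neg_mul_neg, one_mul] at h3
        exact mul_right_cancel ((hone' _ h3).trans (by rw [← sq, hc2]))
    · refine ⟨1, fun b hb => Or.inl ?_⟩
      rcases isAmbiguousClass_of_sq_eq_one h2 hfix hs hb with h | h
      · exact hone' b h
      · exact absurd ⟨b, h, hb⟩ hc

end TwoTorsionRank

section QuadraticExtensions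
open Module Polynomial

theorem exists_involution_of_finrank_eq_two {K L : Type*} [Field K] [Field L] [CharZero K]
    [Algebra K L] (h : finrank K L = 2) :
    ∃ σ : L ≃ₐ[K] L, σ ≠ 1 ∧ (∀ x, σ (σ x) = x) ∧ ∀ x, σ x = x → ∃ y, algebraMap K L y = x := by
  have : FiniteDimensional K L := Module.finite_of_finrank_pos (by omega)
  have : Algebra.IsQuadraticExtension K L := ⟨h⟩
  have : IsGalois K L := Algebra.IsQuadraticExtension.isGalois K L
  have hcard : Nat.card (L ≃ₐ[K] L) = 2 := (IsGalois.card_aut_eq_finrank K L).trans h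
  obtain ⟨σ, hσ, huniq⟩ : ∃ σ : L ≃ₐ[K] L, σ ≠ 1 ∧ ∀ τ, τ = 1 ∨ τ = σ := by
    obtain ⟨x, y, hxy, hall⟩ := Nat.card_eq_two_iff.1 hcard
    have hall : ∀ τ, τ = x ∨ τ = y := fun τ => by
      simpa using (hall ▸ Set.mem_univ τ : τ ∈ ({x, y} : Set (L ≃ₐ[K] L)))
    rcases hall 1 with rfl | rfl
    · exact ⟨y, hxy.symm, hall⟩
    · exact ⟨x, hxy, fun τ => (hall τ).symm⟩
  refine ⟨σ, hσ, fun x => ?_, fun x hx => ?_⟩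
  · have h1 : σ * σ = 1 := (huniq _).resolve_right fun h => hσ (mul_eq_left.1 h)
    exact DFunLike.congr_fun h1 x
  · have h1 : x ∈ (⊥ : IntermediateField K L) := (IsGalois.mem_bot_iff_fixed x).2 fun τ => by
      rcases huniq τ with rfl | rfl
      · rfl
      · exact hx
    exact IntermediateField.mem_bot.1 h1

theorem exists_algHom_of_sq_eq {F M : Type*} [Field F] [CharZero F] [Field M] [CharZero M] {α : F}
    {β : M} {d : ℚ} (hα : α ^ 2 = d) (hβ : β ^ 2 = d) (hdeg : finrank ℚ F = 2)
    (hgen : Algebra.adjoin ℚ {α} = ⊤) : ∃ f : F →ₐ[ℚ] M, f α = β := by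
  have : FiniteDimensional ℚ F := Module.finite_of_finrank_pos (by omega)
  have hintegral : IsIntegral ℚ α := IsIntegral.of_finite ℚ α
  set pb := PowerBasis.ofAdjoinEqTop hintegral hgen
  have hpb : pb.gen = α := PowerBasis.ofAdjoinEqTop_gen hintegral hgen
  have hmin : minpoly ℚ pb.gen = X ^ 2 - C d := by
    symm
    refine eq_of_monic_of_dvd_of_natDegree_le (minpoly.monic pb.isIntegral_gen)
      (monic_X_pow_sub_C d two_ne_zero) (minpoly.dvd _ _ ?_) ?_
    · simp [hpb, hα]
    · rw [natDegree_X_pow_sub_C, pb.natDegree_minpoly, ← pb.finrank, hdeg]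
  have h0 : aeval β (minpoly ℚ pb.gen) = 0 := by
    rw [hmin]
    simp [hβ]
  exact ⟨pb.lift β h0, by rw [← hpb, pb.lift_gen]⟩

theorem isTotallyReal_of_adjoin_eq_top {K : Type*} [Field K] [CharZero K] {T : Set K}
    (hT : Algebra.adjoin ℚ T = ⊤) (h : ∀ x ∈ T, ∃ n : ℕ, x ^ 2 = n) : IsTotallyReal K := by
  refine ⟨fun v => InfinitePlace.isReal_iff.2 (ComplexEmbedding.isReal_iff.2 ?_)⟩
  have hconj : (ComplexEmbedding.conjugate v.embedding).toRatAlgHom = v.embedding.toRatAlgHom := by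
    refine AlgHom.ext_of_adjoin_eq_top hT fun x hx => ?_
    obtain ⟨n, hn⟩ := h x hx
    change (starRingEnd ℂ) (v.embedding x) = v.embedding x
    have h1 : v.embedding x ^ 2 = ((√n : ℝ) : ℂ) ^ 2 := by
      rw [← map_pow, hn, map_natCast, ← Complex.ofReal_pow, Real.sq_sqrt (Nat.cast_nonneg n),
        Complex.ofReal_natCast]
    rcases sq_eq_sq_iff_eq_or_eq_neg.1 h1 with h2 | h2 <;> rw [h2] <;> simp
  ext x
  exact DFunLike.congr_fun hconj x

theorem exists_ringOfIntegers_mul_two_eq {K : Type*} [Field K] [CharZero K] {x : K} {n : ℕ}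
    (hx : x ^ 2 = n) (hn : n % 4 = 1) : ∃ θ : 𝓞 K, (θ : K) * 2 = 1 + x := by
  obtain ⟨k, rfl⟩ : ∃ k, n = 4 * k + 1 := ⟨n / 4, by omega⟩
  have hintegral : IsIntegral ℤ ((1 + x) / 2) := by
    refine ⟨X ^ 2 - X - C (k : ℤ), ?_, ?_⟩
    · rw [sub_sub]
      refine monic_X_pow_sub (lt_of_le_of_lt (degree_add_le _ _) (max_lt ?_ ?_))
      · rw [degree_X]
        norm_num
      · exact degree_C_le.trans_lt (by norm_num)
    · rw [← aeval_def]
      push_cast at hx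
      simp
      linear_combination hx / 4
  exact ⟨⟨_, hintegral⟩, div_mul_cancel₀ _ two_ne_zero⟩

theorem exists_ringOfIntegers_eq {K : Type*} [Field K] {x : K} {n : ℕ} (hx : x ^ 2 = n) :
    ∃ y : 𝓞 K, (y : K) = x :=
  ⟨⟨x, IsIntegral.of_pow two_pos (by
    rw [hx]
    exact_mod_cast isIntegral_algebraMap (R := ℤ) (A := K) (x := (n : ℤ)))⟩, rfl⟩

theorem finrank_units_of_isTotallyReal {K : Type*} [Field K] [NumberField K] [IsTotallyReal K] :
    finrank ℤ (Additive (𝓞 K)ˣ) = finrank ℚ K - 1 := by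
  rw [NumberField.Units.finrank_eq, Units.rank, IsTotallyReal.finrank,
    InfinitePlace.card_eq_nrRealPlaces_add_nrComplexPlaces,
    IsTotallyReal.nrComplexPlaces_eq_zero, add_zero]

end QuadraticExtensions

section RealQuadratic
open Module

theorem exists_forall_classGroup_quadratic_sq_eq_one {p q : ℕ} (hp : p.Prime) (hq : q.Prime)
    (hpq : p ≠ q) (hp8 : p % 8 = 1) (hq8 : q % 8 = 1) {F : Type*} [Field F] [NumberField F]
    [IsTotallyReal F] {α : F} (hα : α ^ 2 = (p : F) * q) (hdeg : finrank ℚ F = 2)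
    (hgen : Algebra.adjoin ℚ {α} = ⊤) :
    ∃ c : ClassGroup (𝓞 F), ∀ b : ClassGroup (𝓞 F), b ^ 2 = 1 → b = 1 ∨ b = c := by
  obtain ⟨σ, hσ1, hσσ, hσfix⟩ := exists_involution_of_finrank_eq_two hdeg
  have hσα : σ α = -α := by
    have h1 : σ α ^ 2 = α ^ 2 := by rw [← map_pow, hα, map_mul, map_natCast, map_natCast]
    refine (sq_eq_sq_iff_eq_or_eq_neg.1 h1).resolve_left fun h => hσ1 ?_
    have h2 : σ.toAlgHom = AlgHom.id ℚ F := AlgHom.ext_of_adjoin_eq_top hgen (by simpa using h)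
    exact AlgEquiv.ext fun x => DFunLike.congr_fun h2 x
  have hα' : α ^ 2 = ((p * q : ℕ) : F) := by rw [hα, Nat.cast_mul]
  obtain ⟨δ, hδ⟩ := exists_ringOfIntegers_eq hα'
  obtain ⟨θ, hθ⟩ := exists_ringOfIntegers_mul_two_eq hα' (by
    rw [Nat.mul_mod, show p % 4 = 1 by omega, show q % 4 = 1 by omega])
  set s : 𝓞 F ≃ₐ[ℤ] 𝓞 F := (RingOfIntegers.mapRingEquiv (σ : F ≃+* F)).toIntAlgEquiv
  have hs : ∀ x, ((s x : 𝓞 F) : F) = σ x := fun x => rfl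
  refine exists_forall_classGroup_sq_eq_one s (δ := δ) (θ := θ) (fun x => ?_) (fun x hx => ?_) ?_ ?_
    hp hq hpq (Nat.odd_iff.2 (by omega)) (Nat.odd_iff.2 (by omega)) ?_
    ((RingOfIntegers.rank F).trans hdeg) ?_
  · ext
    rw [hs, hs, hσσ]
  · obtain ⟨y, hy⟩ := hσfix x (by rw [← hs, hx])
    have hintegral : IsIntegral ℤ y := by
      rw [← isIntegral_algebraMap_iff (FaithfulSMul.algebraMap_injective ℚ F), hy]
      exact RingOfIntegers.isIntegral_coe x
    obtain ⟨r, rfl⟩ := IsIntegrallyClosed.isIntegral_iff.1 hintegral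
    refine ⟨r, ?_⟩
    ext
    rw [← hy]
    simp
  · ext
    change σ (δ : F) = -(δ : F)
    rw [hδ, hσα]
  · ext
    have h := congrArg σ hθ
    rw [map_mul, map_ofNat, map_add, map_one, hσα] at h
    change (θ : F) - σ θ = δ
    rw [hδ]
    linear_combination (hθ - h) / 2
  · ext
    change (δ : F) ^ 2 = _
    rw [hδ, hα]
    simp
  · rw [finrank_units_of_isTotallyReal, hdeg]

end RealQuadratic

/-- Proposition 4.6(iii), equivalence (2) ⇔ (3): for distinct primes
`p ≡ q ≡ 1 (mod 8)` with `p` a quadratic residue mod `q`, the class number of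
`F = ℚ(√(pq))` is divisible by `4` iff the class number of the biquadratic
field `M = ℚ(√p, √q)` is even. -/
theorem four_dvd_classNumber_iff_even_classNumber_biquadratic
    (p q : ℕ) (hp : p.Prime) (hq : q.Prime) (hpq : p ≠ q)
    (hp8 : p % 8 = 1) (hq8 : q % 8 = 1)
    (hres : IsSquare ((p : ZMod q)))
    (F : Type*) [Field F] [NumberField F]
    (α : F) (hα : α ^ 2 = (p : F) * (q : F))
    (hFdeg : Module.finrank ℚ F = 2)
    (hFgen : Algebra.adjoin ℚ {α} = ⊤)
    (M : Type*) [Field M] [NumberField M]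
    (hMdeg : Module.finrank ℚ M = 4)
    (a b : M) (ha : a ^ 2 = (p : M)) (hb : b ^ 2 = (q : M))
    (hMgen : Algebra.adjoin ℚ {a, b} = ⊤) :
    4 ∣ NumberField.classNumber F ↔ 2 ∣ NumberField.classNumber M := by
  have hF : IsTotallyReal F := isTotallyReal_of_adjoin_eq_top hFgen fun x hx =>
    ⟨p * q, by rw [Set.mem_singleton_iff.1 hx, hα, Nat.cast_mul]⟩
  have hM : IsTotallyReal M := isTotallyReal_of_adjoin_eq_top hMgen fun x hx => by
    rcases hx with rfl | rfl
    exacts [⟨p, ha⟩, ⟨q, hb⟩]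
  obtain ⟨c, hc⟩ := exists_forall_classGroup_quadratic_sq_eq_one hp hq hpq hp8 hq8 hα hFdeg hFgen
  obtain ⟨f, hf⟩ := exists_algHom_of_sq_eq (β := a * b) (d := p * q) (by simpa using hα)
    (by rw [mul_pow, ha, hb]; simp) hFdeg hFgen
  let _ : Algebra F M := f.toAlgebra
  have hab : algebraMap F M α = a * b := hf
  have htower : Module.finrank F M = 2 := by
    have h := Module.finrank_mul_finrank ℚ F M
    rw [hFdeg, hMdeg] at h
    omega
  obtain ⟨σ, hσ1, hσσ, hσfix⟩ := exists_involution_of_finrank_eq_two htower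
  have ha0 : a ≠ 0 := by
    rintro rfl
    simp [eq_comm, hp.ne_zero] at ha
  have hσab : σ a * σ b = a * b := by rw [← map_mul, ← hab, AlgEquiv.commutes]
  have hσa : σ a = -a := by
    have h1 : σ a ^ 2 = a ^ 2 := by rw [← map_pow, ha, map_natCast]
    refine (sq_eq_sq_iff_eq_or_eq_neg.1 h1).resolve_left fun h => hσ1 ?_
    rw [h] at hσab
    have h2 : (σ.toAlgHom.restrictScalars ℚ) = AlgHom.id ℚ M := by
      refine AlgHom.ext_of_adjoin_eq_top hMgen ?_
      rintro x (rfl | rfl)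
      exacts [h, mul_left_cancel₀ ha0 hσab]
    exact AlgEquiv.ext fun x => DFunLike.congr_fun h2 x
  have hσb : σ b = -b := by
    rw [hσa] at hσab
    exact mul_left_cancel₀ ha0 (by linear_combination -hσab)
  obtain ⟨a', ha'⟩ := exists_ringOfIntegers_eq ha
  obtain ⟨b', hb'⟩ := exists_ringOfIntegers_eq hb
  obtain ⟨θ₁, hθ₁⟩ := exists_ringOfIntegers_mul_two_eq ha (by omega)
  obtain ⟨θ₂, hθ₂⟩ := exists_ringOfIntegers_mul_two_eq hb (by omega)
  set s : 𝓞 M ≃ₐ[𝓞 F] 𝓞 M := RingOfIntegers.mapAlgEquiv σ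
  have hs : ∀ x, ((s x : 𝓞 M) : M) = σ x := fun x => rfl
  have hθa : θ₁ - s θ₁ = a' := by
    ext
    have h := congrArg σ hθ₁
    rw [map_mul, map_ofNat, map_add, map_one, hσa] at h
    change (θ₁ : M) - σ θ₁ = a'
    rw [ha']
    linear_combination (hθ₁ - h) / 2
  have hθb : θ₂ - s θ₂ = b' := by
    ext
    have h := congrArg σ hθ₂
    rw [map_mul, map_ofNat, map_add, map_one, hσb] at h
    change (θ₂ : M) - σ θ₂ = b'
    rw [hb']
    linear_combination (hθ₂ - h) / 2
  have hcop : IsCoprime (θ₁ - s θ₁) (θ₂ - s θ₂) := by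
    have ha2 : a' ^ 2 = (p : 𝓞 M) := by
      ext
      change (a' : M) ^ 2 = _
      rw [ha', ha]
      simp
    have hb2 : b' ^ 2 = (q : 𝓞 M) := by
      ext
      change (b' : M) ^ 2 = _
      rw [hb', hb]
      simp
    rw [hθa, hθb, ← IsCoprime.pow_iff two_pos two_pos, ha2, hb2]
    simpa using ((Nat.coprime_primes hp hq).2 hpq).isCoprime.map (Int.castRingHom (𝓞 M))
  rw [classNumber, classNumber, ← Nat.card_eq_fintype_card, ← Nat.card_eq_fintype_card]
  refine four_dvd_card_classGroup_iff s (fun x => ?_) (fun x hx => ?_) hcop (δ := a') ?_ ?_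
    two_ne_zero ?_ ?_ hc
  · ext
    rw [hs, hs, hσσ]
  · obtain ⟨y, hy⟩ := hσfix x (by rw [← hs, hx])
    have hintegral : IsIntegral ℤ y := by
      rw [← isIntegral_algebraMap_iff (FaithfulSMul.algebraMap_injective F M), hy]
      exact RingOfIntegers.isIntegral_coe x
    exact ⟨⟨y, hintegral⟩, RingOfIntegers.ext hy⟩
  · rintro rfl
    exact ha0 ha'.symm
  · ext
    change σ (a' : M) = -(a' : M)
    rw [ha', hσa]
  · rw [← htower]
    exact (IsFractionRing.finrank_eq (𝓞 F) F (𝓞 M) M).symm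
  · rw [finrank_units_of_isTotallyReal, finrank_units_of_isTotallyReal, hMdeg, hFdeg]
end

section
/- Let p and q be distinct prime numbers with p ≡ q ≡ 1 (mod 8) such that p is a quadratic residue modulo q, and let F be a quadratic number field containing an element α with α² = p·q and F = ℚ(α). Then the class number of F is divisible by 4 if and only if the following biconditional holds: p is a fourth power in ℤ/qℤ if and only if q is a fourth power in ℤ/pℤ. -/
open NumberField

open scoped nonZeroDivisors

/-- In `ZMod q` with `q ≡ 1 (mod 8)`, there is a primitive eighth root of unity. -/
lemma ZMod.exists_pow_four_eq_neg_one {q : ℕ} [Fact q.Prime] (hq : q % 8 = 1) :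
    ∃ ζ : ZMod q, ζ ^ 4 = -1 := by
  have hq2 : q ≠ 2 := by rintro rfl; omega
  obtain ⟨i, hi⟩ := (ZMod.exists_sq_eq_neg_one_iff (p := q)).2 (by omega)
  obtain ⟨s, hs⟩ := (ZMod.exists_sq_eq_two_iff hq2).2 (Or.inl hq)
  have h2 : (2 : ZMod q) ≠ 0 := fun h ↦ by
    have : q ∣ 2 := (ZMod.natCast_eq_zero_iff 2 q).1 (by exact_mod_cast h)
    exact hq2 ((Nat.prime_dvd_prime_iff_eq Fact.out Nat.prime_two).1 this)
  have hs0 : s ≠ 0 := by rintro rfl; exact h2 (by simpa using hs)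
  refine ⟨(1 + i) / s, ?_⟩
  rw [div_pow, div_eq_iff (pow_ne_zero _ hs0)]
  linear_combination (-i ^ 2 - 4 * i - 5) * hi - (2 + s * s) * hs

lemma ZMod.exists_pow_four_eq_iff_isSquare {q : ℕ} [Fact q.Prime] (hq : q % 8 = 1)
    {a b c : ZMod q} (hb : b ≠ 0) (hc : c ≠ 0) (h : a * b ^ 2 = -c ^ 2) :
    (∃ u, u ^ 4 = a) ↔ IsSquare (b * c) := by
  obtain ⟨ζ, hζ⟩ := exists_pow_four_eq_neg_one hq
  have hζ0 : ζ ≠ 0 := by rintro rfl; simp at hζ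
  constructor
  · rintro ⟨u, rfl⟩
    have hu : u ≠ 0 := by
      rintro rfl
      have : c ^ 2 = 0 := by linear_combination h
      exact hc (pow_eq_zero_iff two_ne_zero |>.1 this)
    have h2 : (u ^ 2 * b) ^ 2 = (ζ ^ 2 * c) ^ 2 := by linear_combination h - c ^ 2 * hζ
    rcases sq_eq_sq_iff_eq_or_eq_neg.1 h2 with h3 | h3
    · exact ⟨ζ * c / u, by field_simp; linear_combination h3⟩
    · refine ⟨ζ ^ 3 * c / u, ?_⟩
      field_simp
      linear_combination h3 - c * ζ ^ 2 * hζ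
  · rintro ⟨t, ht⟩
    refine ⟨ζ * t / b, ?_⟩
    rw [div_pow, div_eq_iff (pow_ne_zero _ hb)]
    linear_combination t ^ 4 * hζ - b ^ 2 * h + (t * t + b * c) * ht

lemma jacobiSym_eq_one_of_dvd {a x y : ℤ} {m : ℕ} (h : (m : ℤ) ∣ a * x ^ 2 - y ^ 2)
    (hx : IsCoprime x m) (hy : IsCoprime y m) : jacobiSym a m = 1 := by
  have h1 : jacobiSym (a * x ^ 2) m = jacobiSym (y ^ 2) m :=
    jacobiSym.mod_left' (Int.modEq_iff_dvd.2 h).symm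
  rwa [jacobiSym.mul_left, jacobiSym.sq_one' (Int.isCoprime_iff_gcd_eq_one.1 hx),
    jacobiSym.sq_one' (Int.isCoprime_iff_gcd_eq_one.1 hy), mul_one] at h1

lemma legendreSym_two_pow {q : ℕ} [Fact q.Prime] (hq : q % 8 = 1) (k : ℕ) :
    legendreSym q (2 ^ k) = 1 := by
  have hq2 : q ≠ 2 := by rintro rfl; omega
  have h2 : legendreSym q 2 = 1 := by
    rw [legendreSym.at_two hq2, ZMod.χ₈_nat_eq_if_mod_eight, hq]
    simp; omega
  induction k with
  | zero => simp [legendreSym.at_one]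
  | succ n ih => rw [pow_succ, legendreSym.mul, ih, h2, one_mul]

lemma legendreSym_eq_jacobiSym_odd_part {q : ℕ} [Fact q.Prime] (hq : q % 8 = 1) {n : ℤ}
    {k m : ℕ} (hm : Odd m) (hn : n.natAbs = 2 ^ k * m) :
    legendreSym q n = jacobiSym q m := by
  have hq2 : q ≠ 2 := by rintro rfl; omega
  have h1 : legendreSym q (-1) = 1 := by
    rw [legendreSym.at_neg_one hq2, ZMod.χ₄_nat_one_mod_four (by omega)]
  have h3 : legendreSym q ((2 ^ k * m : ℕ) : ℤ) = jacobiSym q m := by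
    push_cast
    rw [legendreSym.mul, legendreSym_two_pow hq, one_mul, jacobiSym.legendreSym.to_jacobiSym,
      jacobiSym.quadratic_reciprocity_one_mod_four (by omega) hm]
  rcases Int.natAbs_eq n with h | h
  · rw [h, hn, h3]
  · rw [h, hn, neg_eq_neg_one_mul, legendreSym.mul, h1, one_mul, h3]

lemma jacobiSym_odd_part_eq_one {a n x y : ℤ} {k m : ℕ} (hm : Odd m)
    (hn : n.natAbs = 2 ^ k * m) (h : n ∣ a * x ^ 2 - y ^ 2)
    (hx : ∀ l : ℕ, l.Prime → (l : ℤ) ∣ n → (l : ℤ) ∣ x → l = 2)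
    (hy : ∀ l : ℕ, l.Prime → (l : ℤ) ∣ n → (l : ℤ) ∣ y → l = 2) : jacobiSym a m = 1 := by
  have hmn : (m : ℤ) ∣ n := by
    rw [Int.natCast_dvd, hn]; exact dvd_mul_left _ _
  have aux : ∀ z : ℤ, (∀ l : ℕ, l.Prime → (l : ℤ) ∣ n → (l : ℤ) ∣ z → l = 2) →
      IsCoprime z m := by
    intro z hz
    rw [Int.isCoprime_iff_gcd_eq_one]
    by_contra hg
    obtain ⟨l, hl, hlg⟩ := Nat.exists_prime_and_dvd hg
    have hlm : l ∣ m := Int.natCast_dvd_natCast.1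
      ((Int.natCast_dvd_natCast.2 hlg).trans (Int.gcd_dvd_right ..))
    have h2 := hz l hl ((Int.natCast_dvd_natCast.2 hlm).trans hmn)
      ((Int.natCast_dvd_natCast.2 hlg).trans (Int.gcd_dvd_left ..))
    subst h2
    exact (Nat.not_even_iff_odd.2 hm) (even_iff_two_dvd.2 hlm)
  exact jacobiSym_eq_one_of_dvd (hmn.trans h) (aux x hx) (aux y hy)

lemma exists_pow_four_iff_legendreSym {p q : ℕ} [Fact q.Prime] (hq : q % 8 = 1) (hqp : ¬ q ∣ p)
    {U V Z : ℤ} (h : q * V ^ 2 - p * U ^ 2 = Z ^ 2)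
    (hUV : ∀ l : ℕ, l.Prime → (l : ℤ) ∣ U → (l : ℤ) ∣ V → l = 2) :
    ¬ (q : ℤ) ∣ Z ∧ ((∃ u : ZMod q, u ^ 4 = (p : ZMod q)) ↔ legendreSym q Z = 1) := by
  have hq2 : q ≠ 2 := by rintro rfl; omega
  have hqP : q.Prime := Fact.out
  have hqI : Prime (q : ℤ) := Nat.prime_iff_prime_int.1 hqP
  have hqU : ¬ (q : ℤ) ∣ U := by
    intro hU
    have hZ : (q : ℤ) ∣ Z := hqI.dvd_of_dvd_pow (n := 2) (by
      rw [← h]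
      exact dvd_sub (dvd_mul_right _ _) ((dvd_pow hU two_ne_zero).mul_left _))
    obtain ⟨U', rfl⟩ := hU
    obtain ⟨Z', rfl⟩ := hZ
    have hV : (q : ℤ) ∣ V := hqI.dvd_of_dvd_pow (n := 2) ⟨p * U' ^ 2 + Z' ^ 2, by
      refine mul_left_cancel₀ hqI.ne_zero ?_
      linear_combination h⟩
    exact hq2 (hUV q hqP (dvd_mul_right _ _) hV)
  have hqZ : ¬ (q : ℤ) ∣ Z := by
    intro hZ
    have h1 : (q : ℤ) ∣ p * U ^ 2 := by
      have : (p : ℤ) * U ^ 2 = q * V ^ 2 - Z ^ 2 := by linear_combination -h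
      rw [this]
      exact dvd_sub (dvd_mul_right _ _) (dvd_pow hZ two_ne_zero)
    rcases hqI.dvd_or_dvd h1 with h2 | h2
    · exact hqp (Int.natCast_dvd_natCast.1 h2)
    · exact hqU (hqI.dvd_of_dvd_pow h2)
  refine ⟨hqZ, ?_⟩
  have hU1 : legendreSym q U = 1 := by
    obtain ⟨k, m, hm, hkm⟩ :=
      Nat.exists_eq_two_pow_mul_odd (n := U.natAbs) (by rintro h0; simp_all)
    rw [legendreSym_eq_jacobiSym_odd_part hq hm hkm]
    refine jacobiSym_odd_part_eq_one hm hkm (x := V) (y := Z)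
      ⟨p * U, by linear_combination h⟩ hUV fun l hl hlU hlZ ↦ ?_
    have hlI : Prime (l : ℤ) := Nat.prime_iff_prime_int.1 hl
    have h1 : (l : ℤ) ∣ q * V ^ 2 := by
      have : (q : ℤ) * V ^ 2 = p * U ^ 2 + Z ^ 2 := by linear_combination h
      rw [this]
      exact dvd_add ((dvd_pow hlU two_ne_zero).mul_left _) (dvd_pow hlZ two_ne_zero)
    rcases hlI.dvd_or_dvd h1 with h2 | h2
    · have := (Nat.prime_dvd_prime_iff_eq hl hqP).1 (Int.natCast_dvd_natCast.1 h2)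
      subst this
      exact absurd hlU hqU
    · exact hUV l hl hlU (hlI.dvd_of_dvd_pow h2)
  have hU0 : (U : ZMod q) ≠ 0 := fun h0 ↦ hqU ((ZMod.intCast_zmod_eq_zero_iff_dvd U q).1 h0)
  have hZ0 : (Z : ZMod q) ≠ 0 := fun h0 ↦ hqZ ((ZMod.intCast_zmod_eq_zero_iff_dvd Z q).1 h0)
  have hmod : (p : ZMod q) * (U : ZMod q) ^ 2 = -(Z : ZMod q) ^ 2 := by
    have h1 := congrArg (Int.cast : ℤ → ZMod q) h
    push_cast at h1
    rw [CharP.cast_eq_zero (ZMod q) q] at h1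
    linear_combination -h1
  rw [ZMod.exists_pow_four_eq_iff_isSquare hq hU0 hZ0 hmod, ← Int.cast_mul,
    ← legendreSym.eq_one_iff q (by push_cast; exact mul_ne_zero hU0 hZ0), legendreSym.mul, hU1,
    one_mul]

/-- If `n m² = ±(a² - p k b²)` has a solution with `m ≠ 0`, then `n` is a residue modulo `p`. -/
lemma legendreSym_eq_one_of_mul_sq {p : ℕ} [Fact p.Prime] (hp : p % 8 = 1) {n k : ℤ}
    (hk : ¬ (p : ℤ) ∣ k) (hn : ¬ (p : ℤ) ∣ n) {m a b : ℤ} (hm : m ≠ 0)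
    (h : |n * m ^ 2| = |a ^ 2 - p * k * b ^ 2|) : legendreSym p n = 1 := by
  have hpI : Prime (p : ℤ) := Nat.prime_iff_prime_int.1 Fact.out
  induction hN : m.natAbs using Nat.strong_induction_on generalizing m a b with
  | _ N ih =>
  subst hN
  by_cases hpm : (p : ℤ) ∣ m
  · have hdvd : (p : ℤ) ∣ a ^ 2 - p * k * b ^ 2 := by
      rw [← dvd_abs, ← h, dvd_abs]
      exact (dvd_pow hpm two_ne_zero).mul_left _
    have ha : (p : ℤ) ∣ a := hpI.dvd_of_dvd_pow (n := 2) (by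
      rw [show a ^ 2 = a ^ 2 - p * k * b ^ 2 + p * (k * b ^ 2) by ring]
      exact dvd_add hdvd (dvd_mul_right _ _))
    obtain ⟨m', rfl⟩ := hpm
    obtain ⟨a', rfl⟩ := ha
    have hb : (p : ℤ) ∣ b := by
      have h2 : (p : ℤ) * p ∣ p * (p * a' ^ 2 - k * b ^ 2) := by
        rw [show p * (p * a' ^ 2 - k * b ^ 2) = (p * a') ^ 2 - p * k * b ^ 2 by ring,
          ← dvd_abs, ← h, dvd_abs]
        exact ⟨n * m' ^ 2, by ring⟩
      have h3 := Int.dvd_of_mul_dvd_mul_left hpI.ne_zero h2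
      have h4 : (p : ℤ) ∣ k * b ^ 2 := by
        rw [show k * b ^ 2 = p * a' ^ 2 - (p * a' ^ 2 - k * b ^ 2) by ring]
        exact dvd_sub (dvd_mul_right _ _) h3
      exact hpI.dvd_of_dvd_pow ((hpI.dvd_or_dvd h4).resolve_left hk)
    obtain ⟨b', rfl⟩ := hb
    have hm' : m' ≠ 0 := by rintro rfl; simp at hm
    refine ih m'.natAbs ?_ hm' (a := a') (b := b') ?_ rfl
    · rw [Int.natAbs_mul]
      have : 1 < (p : ℤ).natAbs := by simpa using (Fact.out : p.Prime).one_lt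
      have := Int.natAbs_pos.2 hm'
      nlinarith
    · have h5 : |(p : ℤ) ^ 2| * |n * m' ^ 2| = |(p : ℤ) ^ 2| * |a' ^ 2 - p * k * b' ^ 2| := by
        rw [← abs_mul, ← abs_mul]
        rw [show (p : ℤ) ^ 2 * (n * m' ^ 2) = n * (p * m') ^ 2 by ring, h]
        congr 1
        ring
      exact mul_left_cancel₀ (abs_ne_zero.2 (pow_ne_zero _ hpI.ne_zero)) h5
  · have hm0 : (m : ZMod p) ≠ 0 := fun h0 ↦ hpm ((ZMod.intCast_zmod_eq_zero_iff_dvd m p).1 h0)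
    have hn0 : (n : ZMod p) ≠ 0 := fun h0 ↦ hn ((ZMod.intCast_zmod_eq_zero_iff_dvd n p).1 h0)
    obtain ⟨i, hi⟩ := (ZMod.exists_sq_eq_neg_one_iff (p := p)).2 (by omega)
    rw [legendreSym.eq_one_iff p hn0]
    rcases abs_eq_abs.1 h with h | h
    · have h2 := congrArg (Int.cast : ℤ → ZMod p) h
      push_cast at h2
      rw [CharP.cast_eq_zero (ZMod p) p] at h2
      exact ⟨a / m, by field_simp; linear_combination h2⟩
    · have h2 := congrArg (Int.cast : ℤ → ZMod p) h
      push_cast at h2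
      rw [CharP.cast_eq_zero (ZMod p) p] at h2
      exact ⟨i * a / m, by field_simp; linear_combination h2 + a ^ 2 * hi⟩

lemma exists_pow_four_iff_of_neg_pell_of_isCoprime {p q : ℕ} [Fact p.Prime] [Fact q.Prime]
    (hpq : p ≠ q) (hp : p % 8 = 1) (hq : q % 8 = 1) {r s : ℤ} (hrs : r ^ 2 - p * q * s ^ 2 = -1)
    {X Y Z : ℤ} (hZ : Z ≠ 0) (hXY : IsCoprime X Y) (h : p * X ^ 2 - q * Y ^ 2 = Z ^ 2) :
    (∃ u : ZMod q, u ^ 4 = (p : ZMod q)) ↔ (∃ v : ZMod p, v ^ 4 = (q : ZMod p)) := by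
  have hpP : p.Prime := Fact.out
  have hqP : q.Prime := Fact.out
  have hpq' : ¬ p ∣ q := fun h0 ↦ hpq ((Nat.prime_dvd_prime_iff_eq hpP hqP).1 h0)
  have hqp' : ¬ q ∣ p := fun h0 ↦ hpq ((Nat.prime_dvd_prime_iff_eq hqP hpP).1 h0).symm
  have hcop : ∀ l : ℕ, l.Prime → (l : ℤ) ∣ X → (l : ℤ) ∣ Y → False := fun l hl h1 h2 ↦
    (Nat.prime_iff_prime_int.1 hl).not_isUnit (hXY.isUnit_of_dvd' h1 h2)
  obtain ⟨hpZ, h1⟩ := exists_pow_four_iff_legendreSym hp hpq' (V := X) (U := Y) h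
    fun l hl h1 h2 ↦ (hcop l hl h2 h1).elim
  obtain ⟨hqZ, h2⟩ := exists_pow_four_iff_legendreSym hq hqp' (V := r * Y + p * s * X)
    (U := r * X + q * s * Y) (Z := Z) (by linear_combination h - (p * X ^ 2 - q * Y ^ 2) * hrs)
    fun l hl h1 h2 ↦ by
      refine (hcop l hl ?_ ?_).elim
      · rw [show X = q * s * (r * Y + p * s * X) - r * (r * X + q * s * Y) by
          linear_combination X * hrs]
        exact dvd_sub (h2.mul_left _) (h1.mul_left _)
      · rw [show Y = p * s * (r * X + q * s * Y) - r * (r * Y + p * s * X) by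
          linear_combination Y * hrs]
        exact dvd_sub (h1.mul_left _) (h2.mul_left _)
  rw [h1, h2]
  suffices legendreSym p Z = legendreSym q Z by rw [this]
  obtain ⟨k, m, hm, hkm⟩ := Nat.exists_eq_two_pow_mul_odd (Int.natAbs_ne_zero.2 hZ)
  rw [legendreSym_eq_jacobiSym_odd_part hp hm hkm, legendreSym_eq_jacobiSym_odd_part hq hm hkm]
  have hlX : ∀ l : ℕ, l.Prime → (l : ℤ) ∣ Z → (l : ℤ) ∣ X → False := by
    intro l hl hlZ hlX
    have hlI : Prime (l : ℤ) := Nat.prime_iff_prime_int.1 hl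
    have : (l : ℤ) ∣ q * Y ^ 2 := by
      rw [show (q : ℤ) * Y ^ 2 = p * X ^ 2 - Z ^ 2 by linear_combination -h]
      exact dvd_sub ((dvd_pow hlX two_ne_zero).mul_left _) (dvd_pow hlZ two_ne_zero)
    rcases hlI.dvd_or_dvd this with h3 | h3
    · have := (Nat.prime_dvd_prime_iff_eq hl hqP).1 (Int.natCast_dvd_natCast.1 h3)
      subst this
      exact hqZ hlZ
    · exact hcop l hl hlX (hlI.dvd_of_dvd_pow h3)
  have hlY : ∀ l : ℕ, l.Prime → (l : ℤ) ∣ Z → (l : ℤ) ∣ Y → False := by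
    intro l hl hlZ hlY
    have hlI : Prime (l : ℤ) := Nat.prime_iff_prime_int.1 hl
    have : (l : ℤ) ∣ p * X ^ 2 := by
      rw [show (p : ℤ) * X ^ 2 = q * Y ^ 2 + Z ^ 2 by linear_combination h]
      exact dvd_add ((dvd_pow hlY two_ne_zero).mul_left _) (dvd_pow hlZ two_ne_zero)
    rcases hlI.dvd_or_dvd this with h3 | h3
    · have := (Nat.prime_dvd_prime_iff_eq hl hpP).1 (Int.natCast_dvd_natCast.1 h3)
      subst this
      exact hpZ hlZ
    · exact hcop l hl (hlI.dvd_of_dvd_pow h3) hlY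
  have hJ : jacobiSym (p * q) m = 1 := by
    refine jacobiSym_odd_part_eq_one hm hkm (x := X) (y := q * Y)
      ⟨q * Z, by linear_combination q * h⟩ (fun l hl h3 h4 ↦ (hlX l hl h3 h4).elim)
      fun l hl hlZ hlq ↦ ?_
    rcases (Nat.prime_iff_prime_int.1 hl).dvd_or_dvd hlq with h3 | h3
    · have := (Nat.prime_dvd_prime_iff_eq hl hqP).1 (Int.natCast_dvd_natCast.1 h3)
      subst this
      exact absurd hlZ hqZ
    · exact (hlY l hl hlZ h3).elim
  rw [jacobiSym.mul_left] at hJ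
  exact Int.eq_of_mul_eq_one hJ

lemma exists_pow_four_iff_of_neg_pell {p q : ℕ} [Fact p.Prime] [Fact q.Prime]
    (hpq : p ≠ q) (hp : p % 8 = 1) (hq : q % 8 = 1) {r s : ℤ} (hrs : r ^ 2 - p * q * s ^ 2 = -1)
    {X Y Z : ℤ} (hZ : Z ≠ 0) (h : |p * X ^ 2 - q * Y ^ 2| = Z ^ 2) :
    (∃ u : ZMod q, u ^ 4 = (p : ZMod q)) ↔ (∃ v : ZMod p, v ^ 4 = (q : ZMod p)) := by
  wlog hpos : (p : ℤ) * X ^ 2 - q * Y ^ 2 = Z ^ 2 generalizing X Y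
  · have hneg : (p : ℤ) * X ^ 2 - q * Y ^ 2 = -Z ^ 2 :=
      ((abs_eq (sq_nonneg Z)).1 h).resolve_left hpos
    have hpos' : (p : ℤ) * (r * X + q * s * Y) ^ 2 - q * (r * Y + p * s * X) ^ 2 = Z ^ 2 := by
      linear_combination (p * X ^ 2 - q * Y ^ 2) * hrs - hneg
    exact this (by rw [hpos', abs_of_nonneg (sq_nonneg Z)]) hpos'
  have hg : 0 < Int.gcd X Y := Int.gcd_pos_iff.2 (by
    by_contra! h0
    obtain ⟨rfl, rfl⟩ := h0
    exact hZ (pow_eq_zero_iff two_ne_zero |>.1 (by linear_combination -hpos)))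
  obtain ⟨X', Y', hXY, hX, hY⟩ := Int.exists_gcd_one hg
  set g : ℤ := (Int.gcd X Y : ℤ) with hgdef
  have hg0 : g ≠ 0 := by rw [hgdef]; exact_mod_cast hg.ne'
  clear_value g
  subst hX hY
  have hgZ : g ∣ Z := by
    rw [← Int.pow_dvd_pow_iff two_ne_zero, ← hpos]
    exact ⟨p * X' ^ 2 - q * Y' ^ 2, by ring⟩
  obtain ⟨Z', rfl⟩ := hgZ
  refine exists_pow_four_iff_of_neg_pell_of_isCoprime hpq hp hq hrs (right_ne_zero_of_mul hZ)
    (Int.isCoprime_iff_gcd_eq_one.2 hXY) (mul_left_cancel₀ (pow_ne_zero 2 hg0) ?_)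
  linear_combination hpos

lemma not_isSquare_prime_mul_prime {p q : ℕ} (hpP : p.Prime) (hqP : q.Prime) (hpq : p ≠ q) :
    ¬ IsSquare ((p : ℤ) * q) := by
  have hpI : Prime (p : ℤ) := Nat.prime_iff_prime_int.1 hpP
  have hcop : IsCoprime (p : ℤ) q :=
    Nat.isCoprime_iff_coprime.2 ((Nat.coprime_primes hpP hqP).2 hpq)
  rintro ⟨a, ha⟩
  have h1 : (p : ℤ) ∣ a := (hpI.dvd_or_dvd (⟨q, ha.symm⟩ : (p : ℤ) ∣ a * a)).elim id id
  obtain ⟨b, rfl⟩ := h1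
  have h2 : (q : ℤ) = p * (b * b) := mul_left_cancel₀ hpI.ne_zero (by linear_combination ha)
  exact hpI.not_isUnit (hcop.isUnit_of_dvd' dvd_rfl ⟨_, h2⟩)

/-- The trichotomy for the Pell equation `x² - p q y² = 1` with `p ≡ q ≡ 1 (mod 8)`. -/
lemma exists_neg_pell_or {p q : ℕ} (hpP : p.Prime) (hqP : q.Prime) (hpq : p ≠ q)
    (hp : p % 8 = 1) (hq : q % 8 = 1) :
    (∃ r s : ℤ, r ^ 2 - p * q * s ^ 2 = -1) ∨ (∃ r s : ℤ, p * r ^ 2 - q * s ^ 2 = 1) ∨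
      ∃ r s : ℤ, q * r ^ 2 - p * s ^ 2 = 1 := by
  have hpI : Prime (p : ℤ) := Nat.prime_iff_prime_int.1 hpP
  have hqI : Prime (q : ℤ) := Nat.prime_iff_prime_int.1 hqP
  have hcop : IsCoprime (p : ℤ) q :=
    Nat.isCoprime_iff_coprime.2 ((Nat.coprime_primes hpP hqP).2 hpq)
  have hnsq := not_isSquare_prime_mul_prime hpP hqP hpq
  have hpos : (0 : ℤ) < p * q := by
    have := hpP.pos; have := hqP.pos; positivity
  obtain ⟨a, hx, hy, hmin⟩ := Pell.IsFundamental.exists_of_not_isSquare hpos hnsq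
  have hD : ((p : ℤ) * q) % 8 = 1 := by
    have h1 : (p : ℤ) % 8 = 1 := by omega
    have h2 : (q : ℤ) % 8 = 1 := by omega
    rw [Int.mul_emod, h1, h2]; rfl
  have hprop : a.x ^ 2 - p * q * a.y ^ 2 = 1 := a.prop
  have hpar : a.x % 2 = 1 ∧ a.y % 2 = 0 := by
    have h8 : (a.x ^ 2 - (p * q) * a.y ^ 2) % 8 = 1 := by rw [hprop]; rfl
    rw [Int.sub_emod, Int.mul_emod, hD, one_mul, Int.emod_emod_of_dvd _ dvd_rfl,
      ← Int.sub_emod] at h8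
    have hx8 : a.x % 8 = 0 ∨ a.x % 8 = 1 ∨ a.x % 8 = 2 ∨ a.x % 8 = 3 ∨ a.x % 8 = 4 ∨ a.x % 8 = 5 ∨
      a.x % 8 = 6 ∨ a.x % 8 = 7 := by omega
    have hy8 : a.y % 8 = 0 ∨ a.y % 8 = 1 ∨ a.y % 8 = 2 ∨ a.y % 8 = 3 ∨ a.y % 8 = 4 ∨ a.y % 8 = 5 ∨
      a.y % 8 = 6 ∨ a.y % 8 = 7 := by omega
    rcases hx8 with h | h | h | h | h | h | h | h <;>
    rcases hy8 with h' | h' | h' | h' | h' | h' | h' | h' <;>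
    first
      | omega
      | (exfalso; simp [pow_two, Int.sub_emod, Int.mul_emod, h, h'] at h8)
  obtain ⟨k, hk⟩ : ∃ k, a.x = 2 * k + 1 := ⟨a.x / 2, by omega⟩
  obtain ⟨z, hz⟩ : ∃ z, a.y = 2 * z := ⟨a.y / 2, by omega⟩
  rw [hk, hz] at hprop
  have hk0 : 0 < k := by omega
  have hkz : k * (k + 1) = p * q * z ^ 2 := by linarith
  have hkc : IsCoprime k (k + 1) := ⟨-1, 1, by ring⟩
  have sq_of : ∀ u v w : ℤ, 0 < u → 0 < v → IsCoprime u v → u * v = w ^ 2 →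
      (∃ s, u = s ^ 2) ∧ ∃ r, v = r ^ 2 := by
    have aux : ∀ u v w : ℤ, 0 < u → IsCoprime u v → u * v = w ^ 2 → ∃ s, u = s ^ 2 := by
      intro u v w hu huv h
      obtain ⟨s, hs | hs⟩ := Int.sq_of_isCoprime huv h
      · exact ⟨s, hs⟩
      · nlinarith [sq_nonneg s]
    exact fun u v w hu hv huv h ↦ ⟨aux u v w hu huv h, aux v u w hv huv.symm (by rw [mul_comm, h])⟩
  have hpk : (p : ℤ) ∣ k ∨ (p : ℤ) ∣ k + 1 := hpI.dvd_or_dvd ⟨q * z ^ 2, by rw [hkz]; ring⟩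
  have hqk : (q : ℤ) ∣ k ∨ (q : ℤ) ∣ k + 1 := hqI.dvd_or_dvd ⟨p * z ^ 2, by rw [hkz]; ring⟩
  have hp0 : (0 : ℤ) < p := by exact_mod_cast hpP.pos
  have hq0 : (0 : ℤ) < q := by exact_mod_cast hqP.pos
  rcases hpk with hpk | hpk <;> rcases hqk with hqk | hqk
  · obtain ⟨k', hk'⟩ := hcop.mul_dvd hpk hqk
    have hk'0 : 0 < k' := by by_contra! h0; nlinarith
    obtain ⟨⟨s, hs⟩, r, hr⟩ := sq_of k' (k + 1) z hk'0 (by omega)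
      (hkc.of_isCoprime_of_dvd_left ⟨p * q, by rw [hk']; ring⟩)
      (mul_left_cancel₀ hpos.ne' (by rw [← hkz, hk']; ring))
    have h1 : |r| ^ 2 - p * q * s ^ 2 = 1 := by rw [sq_abs, ← hr, ← hs, hk']; ring
    have hr1 : 1 < |r| := by
      rw [← one_lt_sq_iff₀ (abs_nonneg r), sq_abs, ← hr]; omega
    have := hmin (b := Pell.Solution₁.mk |r| s h1) hr1
    rw [Pell.Solution₁.x_mk, hk] at this
    have h2 : |r| ^ 2 = k + 1 := by rw [sq_abs, hr]
    nlinarith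
  · obtain ⟨k', hk'⟩ := hpk
    obtain ⟨l', hl'⟩ := hqk
    obtain ⟨⟨s, hs⟩, r, hr⟩ := sq_of k' l' z (by by_contra! h0; nlinarith)
      (by by_contra! h0; nlinarith)
      ((hkc.of_isCoprime_of_dvd_left ⟨p, by rw [hk']; ring⟩).of_isCoprime_of_dvd_right
        ⟨q, by rw [hl']; ring⟩)
      (mul_left_cancel₀ hpos.ne' (by rw [← hkz, hl', hk']; ring))
    exact Or.inr (Or.inr ⟨r, s, by rw [← hs, ← hr, ← hk', ← hl']; ring⟩)
  · obtain ⟨k', hk'⟩ := hqk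
    obtain ⟨l', hl'⟩ := hpk
    obtain ⟨⟨s, hs⟩, r, hr⟩ := sq_of k' l' z (by by_contra! h0; nlinarith)
      (by by_contra! h0; nlinarith)
      ((hkc.of_isCoprime_of_dvd_left ⟨q, by rw [hk']; ring⟩).of_isCoprime_of_dvd_right
        ⟨p, by rw [hl']; ring⟩)
      (mul_left_cancel₀ hpos.ne' (by rw [← hkz, hl', hk']; ring))
    exact Or.inr (Or.inl ⟨r, s, by rw [← hs, ← hr, ← hk', ← hl']; ring⟩)
  · obtain ⟨k', hk'⟩ := hcop.mul_dvd hpk hqk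
    have hk'0 : 0 < k' := by by_contra! h0; nlinarith
    obtain ⟨⟨s, hs⟩, r, hr⟩ := sq_of k k' z hk0 hk'0
      (hkc.of_isCoprime_of_dvd_right ⟨p * q, by rw [hk']; ring⟩)
      (mul_left_cancel₀ hpos.ne' (by rw [← hkz, hk']; ring))
    exact Or.inl ⟨s, r, by rw [← hs, ← hr, ← hk']; ring⟩

/-- There is a prime that is a non-residue modulo both `p` and `q`. -/
lemma exists_prime_legendreSym_eq_neg_one {p q : ℕ} [Fact p.Prime] [Fact q.Prime]
    (hpq : p ≠ q) (hp2 : p ≠ 2) (hq2 : q ≠ 2) :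
    ∃ l : ℕ, l.Prime ∧ l ≠ 2 ∧ legendreSym p l = -1 ∧ legendreSym q l = -1 := by
  have hpP : p.Prime := Fact.out
  have hqP : q.Prime := Fact.out
  obtain ⟨a, ha⟩ := FiniteField.exists_nonsquare (F := ZMod p) (by rwa [ZMod.ringChar_zmod_n])
  obtain ⟨b, hb⟩ := FiniteField.exists_nonsquare (F := ZMod q) (by rwa [ZMod.ringChar_zmod_n])
  obtain ⟨k, hka, hkb⟩ := Nat.chineseRemainder ((Nat.coprime_primes hpP hqP).2 hpq) a.val b.val
  have hka' : (k : ZMod p) = a := by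
    rw [(ZMod.natCast_eq_natCast_iff _ _ _).2 hka, ZMod.natCast_zmod_val]
  have hkb' : (k : ZMod q) = b := by
    rw [(ZMod.natCast_eq_natCast_iff _ _ _).2 hkb, ZMod.natCast_zmod_val]
  have hkp : k.Coprime p := by
    refine (hpP.coprime_iff_not_dvd.2 fun h ↦ ha ?_).symm
    rw [← hka', (ZMod.natCast_eq_zero_iff _ _).2 h]
    exact IsSquare.zero
  have hkq : k.Coprime q := by
    refine (hqP.coprime_iff_not_dvd.2 fun h ↦ hb ?_).symm
    rw [← hkb', (ZMod.natCast_eq_zero_iff _ _).2 h]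
    exact IsSquare.zero
  have : NeZero (p * q) := ⟨mul_ne_zero hpP.ne_zero hqP.ne_zero⟩
  obtain ⟨l, hl2, hl, hlk⟩ := Nat.forall_exists_prime_gt_and_eq_mod
    ((ZMod.isUnit_iff_coprime k (p * q)).2 (hkp.mul_right hkq)) 2
  have hmod := (ZMod.natCast_eq_natCast_iff _ _ _).1 hlk
  refine ⟨l, hl, hl2.ne', ?_, ?_⟩
  · rw [legendreSym.eq_neg_one_iff, Int.cast_natCast,
      (ZMod.natCast_eq_natCast_iff _ _ _).2 (hmod.of_mul_right q), hka']
    exact ha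
  · rw [legendreSym.eq_neg_one_iff, Int.cast_natCast,
      (ZMod.natCast_eq_natCast_iff _ _ _).2 (hmod.of_mul_left p), hkb']
    exact hb

section TwoTorsion

variable {G : Type*} [CommGroup G] {T : G}

lemma card_ker_powMonoidHom_two (hT : T ^ 2 = 1) (hT1 : T ≠ 1)
    (huniq : ∀ g : G, g ^ 2 = 1 → g ≠ 1 → g = T) :
    Nat.card (powMonoidHom 2 : G →* G).ker = 2 := by
  have : Fact (Nat.Prime 2) := ⟨Nat.prime_two⟩
  suffices (powMonoidHom 2 : G →* G).ker = Subgroup.zpowers T by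
    rw [this, Nat.card_zpowers, orderOf_eq_prime hT hT1]
  refine le_antisymm (fun g hg ↦ ?_) ?_
  · by_cases hg1 : g = 1
    · exact hg1 ▸ one_mem _
    · exact huniq g hg hg1 ▸ Subgroup.mem_zpowers T
  · rw [Subgroup.zpowers_le]
    exact hT

variable [Finite G]

lemma four_dvd_card_iff_isSquare (hT : T ^ 2 = 1) (hT1 : T ≠ 1)
    (huniq : ∀ g : G, g ^ 2 = 1 → g ≠ 1 → g = T) : 4 ∣ Nat.card G ↔ IsSquare T := by
  have hk := card_ker_powMonoidHom_two hT hT1 huniq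
  have hcard := (powMonoidHom 2 : G →* G).ker.card_mul_index
  rw [hk, Subgroup.index_ker] at hcard
  rw [← hcard, show 4 = 2 * 2 from rfl, Nat.mul_dvd_mul_iff_left two_pos]
  constructor
  · intro h
    have : Fact (Nat.Prime 2) := ⟨Nat.prime_two⟩
    obtain ⟨⟨x, hxm⟩, hx⟩ := exists_prime_orderOf_dvd_card' 2 h
    rw [Subgroup.orderOf_mk, orderOf_eq_prime_iff] at hx
    obtain ⟨y, hxy⟩ := hxm
    rw [← huniq x hx.1 hx.2, ← hxy]
    exact ⟨y, pow_two y⟩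
  · rintro ⟨y, hy⟩
    have hmem : T ∈ (powMonoidHom 2 : G →* G).range := ⟨y, by rw [hy]; exact pow_two y⟩
    have := orderOf_dvd_natCard (⟨T, hmem⟩ : (powMonoidHom 2 : G →* G).range)
    rwa [Subgroup.orderOf_mk, orderOf_eq_prime hT hT1] at this

lemma isSquare_or_isSquare_mul (hT : T ^ 2 = 1) (hT1 : T ≠ 1)
    (huniq : ∀ g : G, g ^ 2 = 1 → g ≠ 1 → g = T) (hsq : ¬ IsSquare T) (g : G) :
    IsSquare g ∨ IsSquare (g * T) := by
  have hk := card_ker_powMonoidHom_two hT hT1 huniq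
  have hcard := (powMonoidHom 2 : G →* G).ker.card_mul_index
  have hcard' := (powMonoidHom 2 : G →* G).range.card_mul_index
  rw [hk, Subgroup.index_ker] at hcard
  have hind : (powMonoidHom 2 : G →* G).range.index = 2 := by
    refine mul_left_cancel₀ (a := Nat.card (powMonoidHom 2 : G →* G).range) Nat.card_pos.ne' ?_
    rw [hcard', ← hcard, mul_comm]
  have hmem : ∀ x : G, x ∈ (powMonoidHom 2 : G →* G).range ↔ IsSquare x := fun x ↦
    ⟨fun ⟨y, hy⟩ ↦ ⟨y, by rw [← hy]; exact pow_two y⟩,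
      fun ⟨y, hy⟩ ↦ ⟨y, by rw [hy]; exact pow_two y⟩⟩
  have h := Subgroup.mul_mem_iff_of_index_two hind (a := g) (b := T)
  rw [hmem, hmem, hmem] at h
  tauto

lemma exists_sq_eq_one_of_not_isSquare {g : G} (hg : ¬ IsSquare g) :
    ∃ T : G, T ^ 2 = 1 ∧ T ≠ 1 := by
  by_contra! h
  have hinj : Function.Injective (powMonoidHom 2 : G →* G) :=
    (injective_iff_map_eq_one _).2 h
  obtain ⟨y, hy⟩ := Finite.surjective_of_injective hinj g
  exact hg ⟨y, by rw [← hy]; exact pow_two y⟩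

end TwoTorsion

/-- `δ` is a square root of `D` in the ring of integers of a quadratic field, and the integers of
the field are of the form `(a + b δ) / 2`. -/
structure IsSqrtGenerator {F : Type*} [Field F] [NumberField F] (D : ℤ) (δ : 𝓞 F) : Prop where
  sq : δ ^ 2 = D
  exists_coords : ∀ x : 𝓞 F, ∃ a b : ℤ, 2 * x = a + b * δ
  four_norm : ∀ (x : 𝓞 F) (a b : ℤ), 2 * x = a + b * δ → 4 * Algebra.norm ℤ x = a ^ 2 - D * b ^ 2
  two_dvd : 2 ∣ 1 + δ
  odd : Odd D
  not_isSquare : ¬ IsSquare D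

lemma Ideal.span_singleton_dvd_of_sq_dvd {R : Type*} [CommRing R] {I : Ideal R} {c : R}
    (hc : ∀ x : R, c ∣ x ^ 2 → c ∣ x) (h : I ^ 2 ≤ span {c}) : I ≤ span {c} := fun x hx ↦
  mem_span_singleton.2 (hc x (mem_span_singleton.1 (h (Ideal.pow_mem_pow hx 2))))

lemma natCast_dvd_of_dvd_two_mul {R : Type*} [CommRing R] {l : ℕ} (hl : Odd l) {x : R}
    (h : (l : R) ∣ 2 * x) : (l : R) ∣ x := by
  obtain ⟨k, rfl⟩ := hl
  rw [show x = ((2 * k + 1 : ℕ) : R) * x - k * (2 * x) by push_cast; ring]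
  exact dvd_sub (dvd_mul_right _ _) (h.mul_left _)

lemma natCast_dvd_of_dvd_coords {R : Type*} [CommRing R] {l : ℕ} (hl : Odd l) {x δ : R} {a b : ℤ}
    (hx : 2 * x = a + b * δ) (ha : (l : ℤ) ∣ a) (hb : (l : ℤ) ∣ b) : (l : R) ∣ x := by
  refine natCast_dvd_of_dvd_two_mul hl ?_
  rw [hx]
  have key : ∀ z : ℤ, (l : ℤ) ∣ z → (l : R) ∣ z := fun z hz ↦ by
    simpa using (Int.castRingHom R).map_dvd hz
  exact dvd_add (key a ha) ((key b hb).mul_right _)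

lemma ClassGroup.exists_mk0_eq_of_span_dvd {R : Type*} [CommRing R] [IsDedekindDomain R]
    {A : (Ideal R)⁰} {c : R} (hc : c ≠ 0) (h : Ideal.span {c} ∣ (A : Ideal R)) :
    ∃ B : (Ideal R)⁰, (A : Ideal R) = Ideal.span {c} * B ∧ mk0 B = mk0 A := by
  obtain ⟨B, hB⟩ := h
  have hB0 : B ∈ (Ideal R)⁰ := by
    rw [mem_nonZeroDivisors_iff_ne_zero]
    rintro rfl
    exact nonZeroDivisors.coe_ne_zero A (by rw [hB, mul_zero])
  refine ⟨⟨B, hB0⟩, hB, mk0_eq_mk0_iff.2 ⟨c, 1, hc, one_ne_zero, ?_⟩⟩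
  rw [← hB, Ideal.span_singleton_one, Ideal.top_mul]

/-- A nonzero ideal of least norm in its class is not divisible by any non-unit principal ideal. -/
lemma ClassGroup.exists_mk0_eq_of_minimal {R : Type*} [CommRing R] [IsDedekindDomain R]
    [Module.Free ℤ R] [Module.Finite ℤ R] (C : ClassGroup R) :
    ∃ J : (Ideal R)⁰, mk0 J = C ∧ ∀ c : R, c ≠ 0 → Ideal.span {c} ∣ (J : Ideal R) → IsUnit c := by
  obtain ⟨J, hJ, hmin⟩ := (measure fun I : (Ideal R)⁰ ↦ Ideal.absNorm (I : Ideal R)).wf.has_min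
    {I | mk0 I = C} (mk0_surjective C)
  refine ⟨J, hJ, fun c hc hcJ ↦ ?_⟩
  obtain ⟨B, hB, hBJ⟩ := exists_mk0_eq_of_span_dvd hc hcJ
  have h1 : ¬ Ideal.absNorm (B : Ideal R) < Ideal.absNorm (J : Ideal R) :=
    hmin B (hBJ.trans hJ)
  have hB0 := Ideal.absNorm_pos_of_nonZeroDivisors B
  have hJ0 := Ideal.absNorm_pos_of_nonZeroDivisors J
  rw [hB, map_mul] at h1 hJ0
  have h2 : Ideal.absNorm (Ideal.span {c}) = 1 := by
    have := pos_of_mul_pos_left hJ0 hB0.le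
    by_contra h3
    have : 2 ≤ Ideal.absNorm (Ideal.span {c}) := by omega
    nlinarith
  rwa [Ideal.absNorm_eq_one_iff, Ideal.span_singleton_eq_top] at h2

namespace IsSqrtGenerator

variable {F : Type*} [Field F] [NumberField F] {D : ℤ} {δ : 𝓞 F}

lemma norm_intCast (h : IsSqrtGenerator D δ) (n : ℤ) : Algebra.norm ℤ (n : 𝓞 F) = n ^ 2 := by
  have := h.four_norm n (2 * n) 0 (by push_cast; ring)
  linarith

lemma norm_add_mul (h : IsSqrtGenerator D δ) (a b : ℤ) :
    Algebra.norm ℤ (a + b * δ : 𝓞 F) = a ^ 2 - D * b ^ 2 := by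
  have := h.four_norm (a + b * δ) (2 * a) (2 * b) (by push_cast; ring)
  linarith

lemma sq_eq (h : IsSqrtGenerator D δ) {x : 𝓞 F} {a b : ℤ} (hx : 2 * x = a + b * δ) :
    x ^ 2 = a * x - (Algebra.norm ℤ x : ℤ) := by
  have h4 : (4 : 𝓞 F) * (Algebra.norm ℤ x : ℤ) = a ^ 2 - D * b ^ 2 := by
    exact_mod_cast congrArg (Int.cast : ℤ → 𝓞 F) (h.four_norm x a b hx)
  refine mul_left_cancel₀ (by norm_num : (4 : 𝓞 F) ≠ 0) ?_
  linear_combination (2 * x - a + b * δ) * hx + h4 + b ^ 2 * h.sq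

lemma eq_zero (h : IsSqrtGenerator D δ) {a b : ℤ} (hab : (a + b * δ : 𝓞 F) = 0) : b = 0 := by
  have h1 := h.norm_add_mul a b
  rw [hab, Algebra.norm_zero] at h1
  by_contra hb
  have h2 : b ^ 2 ∣ a ^ 2 := ⟨D, by linarith⟩
  obtain ⟨c, rfl⟩ := (Int.pow_dvd_pow_iff two_ne_zero).1 h2
  exact h.not_isSquare ⟨c, mul_left_cancel₀ (pow_ne_zero 2 hb) (by linear_combination h1)⟩

/-- The ring of integers modulo an unramified prime is reduced. -/
lemma natCast_dvd_of_dvd_sq (h : IsSqrtGenerator D δ) {l : ℕ} (hl : l.Prime)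
    (hlD : ¬ (l : ℤ) ∣ D) {x : 𝓞 F} (hx : (l : 𝓞 F) ∣ x ^ 2) : (l : 𝓞 F) ∣ x := by
  have hlI : Prime (l : ℤ) := Nat.prime_iff_prime_int.1 hl
  obtain ⟨a, b, hab⟩ := h.exists_coords x
  have h4 := h.four_norm x a b hab
  have hsq := h.sq_eq hab
  have hN : (l : ℤ) ∣ Algebra.norm ℤ x := by
    refine hlI.dvd_of_dvd_pow (n := 2) ?_
    have h1 : Algebra.norm ℤ (l : 𝓞 F) ∣ Algebra.norm ℤ (x ^ 2) := (Algebra.norm ℤ).map_dvd hx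
    rw [← Int.cast_natCast, h.norm_intCast, map_pow] at h1
    exact (dvd_pow_self _ two_ne_zero).trans h1
  have hN' : (l : 𝓞 F) ∣ (Algebra.norm ℤ x : ℤ) := by
    simpa using (Int.castRingHom (𝓞 F)).map_dvd hN
  have hax : (l : 𝓞 F) ∣ a * x := by
    rw [show (a : 𝓞 F) * x = x ^ 2 + (Algebra.norm ℤ x : ℤ) by rw [hsq]; ring]
    exact dvd_add hx hN'
  by_cases hla : (l : ℤ) ∣ a
  · have hlb : (l : ℤ) ∣ b := by
      have : (l : ℤ) ∣ D * b ^ 2 := by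
        rw [show D * b ^ 2 = a ^ 2 - 4 * Algebra.norm ℤ x by linarith]
        exact dvd_sub (dvd_pow hla two_ne_zero) (hN.mul_left _)
      exact hlI.dvd_of_dvd_pow ((hlI.dvd_or_dvd this).resolve_left hlD)
    rcases hl.eq_two_or_odd' with rfl | hodd
    · obtain ⟨a', rfl⟩ := hla
      obtain ⟨b', rfl⟩ := hlb
      have hx' : x = a' + b' * δ := by
        refine mul_left_cancel₀ (two_ne_zero (α := 𝓞 F)) ?_
        rw [hab]; push_cast; ring
      obtain ⟨e, he⟩ := hN
      obtain ⟨d, hd⟩ := h.odd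
      have hpar : (2 : ℤ) ∣ a' - b' := by
        have h5 : (2 : ℤ) ∣ (a' - b') ^ 2 := by
          rw [he] at h4
          rw [hd] at h4
          push_cast at h4
          exact ⟨e + d * b' ^ 2 + b' ^ 2 - a' * b', by linarith⟩
        exact Int.prime_two.dvd_of_dvd_pow h5
      obtain ⟨f, hf⟩ := hpar
      have hf' : (a' : 𝓞 F) = b' + 2 * f := by
        have : a' = b' + 2 * f := by linarith
        exact_mod_cast congrArg (Int.cast : ℤ → 𝓞 F) this
      rw [hx', hf', show (b' + 2 * f + b' * δ : 𝓞 F) = 2 * f + b' * (1 + δ) by ring]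
      exact dvd_add (by simp) (by simpa using h.two_dvd.mul_left _)
    · exact natCast_dvd_of_dvd_coords hodd hab hla hlb
  · obtain ⟨u, v, huv⟩ := (hlI.coprime_iff_not_dvd (n := a)).2 hla
    have huv' : (u * l + v * a : 𝓞 F) = 1 := by
      exact_mod_cast congrArg (Int.cast : ℤ → 𝓞 F) huv
    rw [show x = l * (u * x) + v * (a * x) by linear_combination -x * huv']
    exact dvd_add (dvd_mul_right _ _) (hax.mul_left _)

lemma exists_absNorm_mul_sq_of_isSquare (h : IsSqrtGenerator D δ) {I : (Ideal (𝓞 F))⁰}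
    (hI : IsSquare (ClassGroup.mk0 I)) : ∃ m a b : ℤ, m ≠ 0 ∧
      |(Ideal.absNorm (I : Ideal (𝓞 F)) : ℤ) * m ^ 2| = |a ^ 2 - D * b ^ 2| := by
  obtain ⟨C, hC⟩ := hI
  obtain ⟨K, rfl⟩ := ClassGroup.mk0_surjective C
  rw [← map_mul, ClassGroup.mk0_eq_mk0_iff] at hC
  obtain ⟨x, y, hx, hy, hxy⟩ := hC
  have hN := congrArg (fun J ↦ (Ideal.absNorm J : ℤ)) hxy
  simp only [map_mul, Ideal.absNorm_span_singleton, Submonoid.coe_mul, Nat.cast_mul,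
    Int.natCast_natAbs] at hN
  set k := Ideal.absNorm (K : Ideal (𝓞 F))
  obtain ⟨a, b, hab⟩ := h.exists_coords (x * y * ((k : ℤ) : 𝓞 F))
  have h4 := h.four_norm _ a b hab
  rw [map_mul, map_mul, h.norm_intCast] at h4
  refine ⟨2 * Algebra.norm ℤ x, a, b,
    mul_ne_zero two_ne_zero (Algebra.norm_ne_zero_iff.2 hx), ?_⟩
  rw [← h4]
  simp only [abs_mul, abs_pow, Nat.abs_cast, Nat.abs_ofNat]
  linear_combination 4 * |Algebra.norm ℤ x| * hN

lemma exists_ideal_absNorm_eq (h : IsSqrtGenerator D δ) {l : ℕ} (hl : l.Prime) (hl2 : l ≠ 2)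
    (hD : IsSquare (D : ZMod l)) : ∃ L : (Ideal (𝓞 F))⁰, Ideal.absNorm (L : Ideal (𝓞 F)) = l := by
  obtain ⟨t', ht⟩ := hD
  obtain ⟨t, rfl⟩ := ZMod.intCast_surjective t'
  have hdvd : (l : ℤ) ∣ t ^ 2 - D := by
    rw [← ZMod.intCast_zmod_eq_zero_iff_dvd]
    push_cast
    rw [ht]; ring
  obtain ⟨c, hc⟩ := hdvd
  have hc' : ((t : 𝓞 F) + δ) * (t - δ) = l * c := by
    have : (t ^ 2 - D : 𝓞 F) = l * c := by exact_mod_cast congrArg (Int.cast : ℤ → 𝓞 F) hc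
    linear_combination this - h.sq
  have hnd : ∀ e : ℤ, IsUnit e → ¬ (l : 𝓞 F) ∣ t + e * δ := by
    rintro e he ⟨x, hx⟩
    obtain ⟨a, b, hab⟩ := h.exists_coords x
    have h0 := h.eq_zero (a := 2 * t - l * a) (b := 2 * e - l * b) (by
      push_cast
      linear_combination 2 * hx + l * hab)
    have h3 : (l : ℤ) ∣ 2 * e := ⟨b, by linarith⟩
    exact hl2 ((Nat.prime_dvd_prime_iff_eq hl Nat.prime_two).1
      (by exact_mod_cast he.dvd_mul_right.1 h3))
  have hnd1 : ¬ (l : 𝓞 F) ∣ t + δ := by simpa using hnd 1 isUnit_one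
  have hnd2 : ¬ (l : 𝓞 F) ∣ t - δ := by simpa [sub_eq_add_neg] using hnd (-1) (by simp)
  set L : Ideal (𝓞 F) := Ideal.span {(l : 𝓞 F), t + δ} with hL
  have hLtop : L ≠ ⊤ := by
    intro h1
    rw [Ideal.eq_top_iff_one, hL, Ideal.mem_span_pair] at h1
    obtain ⟨u, v, huv⟩ := h1
    exact hnd2 ⟨u * (t - δ) + v * c, by linear_combination -(t - δ) * huv + v * hc'⟩
  have hle : Ideal.span {(l : 𝓞 F)} ≤ L := Ideal.span_mono (by simp)
  obtain ⟨M, hM⟩ := Ideal.dvd_iff_le.2 hle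
  have hN : Ideal.absNorm L * Ideal.absNorm M = l ^ 2 := by
    rw [← map_mul, ← hM, Ideal.absNorm_span_singleton, ← Int.cast_natCast, h.norm_intCast,
      Int.natAbs_pow, Int.natAbs_natCast]
  have hLl : Ideal.absNorm L = l := by
    obtain ⟨i, hi, hLi⟩ := (Nat.dvd_prime_pow hl).1 ⟨_, hN.symm⟩
    interval_cases i
    · exact absurd (Ideal.absNorm_eq_one_iff.1 (by simpa using hLi)) hLtop
    · simpa using hLi
    · rw [hLi] at hN
      have hM1 : Ideal.absNorm M = 1 := by
        simpa [hl.ne_zero] using hN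
      rw [Ideal.absNorm_eq_one_iff] at hM1
      rw [hM1, Ideal.mul_top] at hM
      refine absurd (Ideal.mem_span_singleton.1 ?_) hnd1
      rw [hM]
      exact Ideal.subset_span (by simp)
  refine ⟨⟨L, mem_nonZeroDivisors_iff_ne_zero.2 fun h0 ↦ ?_⟩, hLl⟩
  rw [h0, Ideal.zero_eq_bot, Ideal.absNorm_bot] at hLl
  exact hl.ne_zero hLl.symm

lemma natCast_dvd_natCast (h : IsSqrtGenerator D δ) {m n : ℕ} (hmn : (m : 𝓞 F) ∣ n) : m ∣ n := by
  have h1 : Algebra.norm ℤ (m : 𝓞 F) ∣ Algebra.norm ℤ (n : 𝓞 F) := (Algebra.norm ℤ).map_dvd hmn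
  rw [← Int.cast_natCast, ← Int.cast_natCast n, h.norm_intCast, h.norm_intCast,
    Int.pow_dvd_pow_iff two_ne_zero] at h1
  exact Int.natCast_dvd_natCast.1 h1

lemma exists_mk0_eq_of_sq_eq_span {p q : ℕ} (hp : p.Prime) (hq : q.Prime) (hpq : p ≠ q)
    (h : IsSqrtGenerator (p * q) δ) {N : ℕ} (hN : N ≠ 0) {A : (Ideal (𝓞 F))⁰}
    (hA : (A : Ideal (𝓞 F)) ^ 2 = Ideal.span {(N : 𝓞 F)}) :
    ∃ B : (Ideal (𝓞 F))⁰, ClassGroup.mk0 B = ClassGroup.mk0 A ∧ ∃ d : ℕ, d ∣ p * q ∧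
      (B : Ideal (𝓞 F)) ^ 2 = Ideal.span {(d : 𝓞 F)} := by
  induction N using Nat.strong_induction_on generalizing A with
  | _ N ih =>
  by_cases hex : ∃ l : ℕ, l.Prime ∧ Ideal.span {(l : 𝓞 F)} ∣ (A : Ideal (𝓞 F))
  · obtain ⟨l, hl, hlA⟩ := hex
    have hl0 : (l : 𝓞 F) ≠ 0 := by exact_mod_cast hl.ne_zero
    obtain ⟨B, hB, hBA⟩ := ClassGroup.exists_mk0_eq_of_span_dvd hl0 hlA
    rw [hB, mul_pow, Ideal.span_singleton_pow] at hA
    have hlN : l ^ 2 ∣ N := h.natCast_dvd_natCast (by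
      push_cast
      have hle : Ideal.span {(l : 𝓞 F) ^ 2} * (B : Ideal (𝓞 F)) ^ 2 ≤ Ideal.span {(l : 𝓞 F) ^ 2} :=
        Ideal.mul_le_left
      rwa [hA, Ideal.span_singleton_le_span_singleton] at hle)
    obtain ⟨N', rfl⟩ := hlN
    have hN' : N' ≠ 0 := right_ne_zero_of_mul hN
    rw [Nat.cast_mul, ← Ideal.span_singleton_mul_span_singleton, Nat.cast_pow] at hA
    have hB2 := mul_left_cancel₀ (by simpa using hl0) hA
    rw [← hBA]
    refine ih N' ?_ hN' hB2
    have := hl.one_lt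
    nlinarith [Nat.pos_of_ne_zero hN', Nat.one_lt_pow two_ne_zero this]
  · push Not at hex
    refine ⟨A, rfl, N, ?_, hA⟩
    have hsqf : Squarefree N := by
      rw [Nat.squarefree_iff_prime_squarefree]
      rintro l hl ⟨c, hc⟩
      refine hex l hl ((UniqueFactorizationMonoid.pow_dvd_pow_iff_dvd two_ne_zero).1 ?_)
      rw [hA, Ideal.span_singleton_pow, Ideal.dvd_iff_le, Ideal.span_singleton_le_span_singleton]
      exact ⟨c, by rw [hc]; push_cast; ring⟩
    rw [← Nat.prod_primeFactors_of_squarefree hsqf, ← Finset.prod_pair (f := fun l ↦ l) hpq]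
    refine Finset.prod_dvd_prod_of_subset _ _ _ fun l hl ↦ ?_
    have hlP := Nat.prime_of_mem_primeFactors hl
    have hlN := Nat.dvd_of_mem_primeFactors hl
    have hlD : (l : ℤ) ∣ p * q := by
      by_contra hlD
      refine hex l hlP (Ideal.dvd_iff_le.2 (Ideal.span_singleton_dvd_of_sq_dvd
        (fun x hx ↦ h.natCast_dvd_of_dvd_sq hlP hlD hx) ?_))
      rw [hA, Ideal.span_singleton_le_span_singleton]
      exact Nat.cast_dvd_cast hlN
    have hlD' : l ∣ p * q := by exact_mod_cast hlD
    rcases hlP.dvd_mul.1 hlD' with h1 | h1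
    · simp [(Nat.prime_dvd_prime_iff_eq hlP hp).1 h1]
    · simp [(Nat.prime_dvd_prime_iff_eq hlP hq).1 h1]

/-- An ideal whose square is generated by an element of positive norm is equivalent to an
ambiguous ideal. -/
lemma exists_mk0_eq_of_norm_eq_sq {p q : ℕ} (hp : p.Prime) (hq : q.Prime) (hpq : p ≠ q)
    (h : IsSqrtGenerator (p * q) δ) {I : (Ideal (𝓞 F))⁰} {ι : 𝓞 F}
    (hI : (I : Ideal (𝓞 F)) ^ 2 = Ideal.span {ι}) {n : ℤ} (hn : n ≠ 0)
    (hι : Algebra.norm ℤ ι = n ^ 2) :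
    ∃ B : (Ideal (𝓞 F))⁰, ClassGroup.mk0 B = ClassGroup.mk0 I ∧ ∃ d : ℕ, d ∣ p * q ∧
      (B : Ideal (𝓞 F)) ^ 2 = Ideal.span {(d : 𝓞 F)} := by
  have span_natAbs : ∀ z : ℤ, Ideal.span {((z.natAbs : ℕ) : 𝓞 F)} = Ideal.span {(z : 𝓞 F)} := by
    intro z
    rcases Int.natAbs_eq z with hz | hz <;> rw [hz] <;> simp [Ideal.span_singleton_neg]
  obtain ⟨a, b, hab⟩ := h.exists_coords ι
  have hsq := h.sq_eq hab
  rw [hι] at hsq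
  push_cast at hsq
  have hι0 : ι ≠ 0 := by
    rintro rfl
    rw [Algebra.norm_zero] at hι
    exact hn (pow_eq_zero_iff two_ne_zero |>.1 hι.symm)
  have hmul : ι * (n + a - ι) ^ 2 = ((n ^ 2 * (2 * n + a) : ℤ) : 𝓞 F) := by
    push_cast
    linear_combination (ι - 2 * n - a) * hsq
  by_cases hc : (n + a - ι : 𝓞 F) = 0
  · rw [hc, zero_pow two_ne_zero, mul_zero] at hmul
    have h2 : 2 * n + a = 0 := by
      have := Int.cast_eq_zero.1 hmul.symm
      simpa [hn] using this
    have hιn : ι = ((-n : ℤ) : 𝓞 F) := by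
      have : (2 * n + a : 𝓞 F) = 0 := by exact_mod_cast congrArg (Int.cast : ℤ → 𝓞 F) h2
      push_cast
      linear_combination this - hc
    exact h.exists_mk0_eq_of_sq_eq_span hp hq hpq (N := (-n).natAbs) (by simpa using hn)
      (by rw [hI, span_natAbs, hιn])
  · set A : (Ideal (𝓞 F))⁰ := ⟨Ideal.span {(n + a - ι : 𝓞 F)},
      mem_nonZeroDivisors_iff_ne_zero.2 (by simpa using hc)⟩ * I with hA
    have hAI : ClassGroup.mk0 A = ClassGroup.mk0 I :=
      ClassGroup.mk0_eq_mk0_iff.2 ⟨1, _, one_ne_zero, hc, by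
        rw [Ideal.span_singleton_one, Ideal.top_mul, hA]; rfl⟩
    rw [← hAI]
    refine h.exists_mk0_eq_of_sq_eq_span hp hq hpq (N := (n ^ 2 * (2 * n + a)).natAbs) ?_ ?_
    · rw [Int.natAbs_ne_zero]
      intro h0
      rw [h0, Int.cast_zero] at hmul
      exact mul_ne_zero hι0 (pow_ne_zero 2 hc) hmul
    · rw [span_natAbs, ← hmul, hA, Submonoid.coe_mul, mul_pow, hI, Ideal.span_singleton_pow,
        Ideal.span_singleton_mul_span_singleton, mul_comm]

lemma exists_generator_of_sq_eq_one {I : (Ideal (𝓞 F))⁰} (hI : ClassGroup.mk0 I ^ 2 = 1) :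
    ∃ ι : 𝓞 F, (I : Ideal (𝓞 F)) ^ 2 = Ideal.span {ι} ∧
      |Algebra.norm ℤ ι| = (Ideal.absNorm (I : Ideal (𝓞 F)) : ℤ) ^ 2 := by
  rw [← map_pow, ClassGroup.mk0_eq_one_iff (SetLike.coe_mem _)] at hI
  obtain ⟨ι, hι⟩ := hI
  have hι' : (I : Ideal (𝓞 F)) ^ 2 = Ideal.span {ι} := hι
  refine ⟨ι, hι', ?_⟩
  have := congrArg (fun J ↦ (Ideal.absNorm J : ℤ)) hι'
  simpa [Ideal.absNorm_span_singleton] using this.symm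

end IsSqrtGenerator

lemma ClassGroup.mk0_eq_one_of_sq_eq_span_sq {R : Type*} [CommRing R] [IsDedekindDomain R]
    {I : (Ideal R)⁰} {c : R} (h : (I : Ideal R) ^ 2 = Ideal.span {c ^ 2}) : mk0 I = 1 := by
  rw [← Ideal.span_singleton_pow] at h
  have hI : (I : Ideal R) = Ideal.span {c} := dvd_antisymm
    ((UniqueFactorizationMonoid.pow_dvd_pow_iff_dvd two_ne_zero).1 h.dvd)
    ((UniqueFactorizationMonoid.pow_dvd_pow_iff_dvd two_ne_zero).1 h.symm.dvd)
  exact (mk0_eq_one_iff (SetLike.coe_mem I)).2 (hI ▸ ⟨⟨c, rfl⟩⟩)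

lemma dvd_prime_mul_prime {p q d : ℕ} (hp : p.Prime) (hq : q.Prime) (h : d ∣ p * q) :
    d = 1 ∨ d = p ∨ d = q ∨ d = p * q := by
  obtain ⟨a, b, ha, hb, rfl⟩ := (Nat.dvd_mul).1 h
  rcases (Nat.dvd_prime hp).1 ha with rfl | rfl <;>
    rcases (Nat.dvd_prime hq).1 hb with rfl | rfl <;> simp

lemma eq_of_sq_eq_one_of_mul_eq_one {G : Type*} [Group G] {g k : G} (hk : k ^ 2 = 1)
    (h : g * k = 1) : g = k :=
  mul_right_cancel (h.trans (by rw [← sq, hk]))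

namespace IsSqrtGenerator

variable {F : Type*} [Field F] [NumberField F] {δ : 𝓞 F} {p q : ℕ}

lemma swap (h : IsSqrtGenerator (p * q) δ) : IsSqrtGenerator (q * p) δ := mul_comm (p : ℤ) q ▸ h

lemma legendreSym_absNorm_eq_one [Fact p.Prime] (h : IsSqrtGenerator (p * q) δ) (hp : p % 8 = 1)
    (hpq : ¬ p ∣ q) {I : (Ideal (𝓞 F))⁰} (hI : IsSquare (ClassGroup.mk0 I))
    (hn : ¬ p ∣ Ideal.absNorm (I : Ideal (𝓞 F))) :
    legendreSym p (Ideal.absNorm (I : Ideal (𝓞 F))) = 1 := by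
  obtain ⟨m, a, b, hm, hmab⟩ := h.exists_absNorm_mul_sq_of_isSquare hI
  exact legendreSym_eq_one_of_mul_sq hp (by exact_mod_cast hpq) (by exact_mod_cast hn) hm hmab

lemma not_isSquare_mk0 [Fact p.Prime] (h : IsSqrtGenerator (p * q) δ) (hp : p % 8 = 1)
    (hpq : ¬ p ∣ q) {I : (Ideal (𝓞 F))⁰}
    (hI : legendreSym p (Ideal.absNorm (I : Ideal (𝓞 F))) = -1) :
    ¬ IsSquare (ClassGroup.mk0 I) := by
  intro hsq
  have := h.legendreSym_absNorm_eq_one hp hpq hsq fun hdvd ↦ by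
    rw [(legendreSym.eq_zero_iff p _).2 ((ZMod.intCast_zmod_eq_zero_iff_dvd _ _).2
      (by exact_mod_cast hdvd))] at hI
    norm_num at hI
  rw [this] at hI
  norm_num at hI

lemma exists_ideal_legendreSym_eq_neg_one [Fact p.Prime] [Fact q.Prime]
    (h : IsSqrtGenerator (p * q) δ) (hpq : p ≠ q) (hp : p % 8 = 1) (hq : q % 8 = 1) :
    ∃ L : (Ideal (𝓞 F))⁰, legendreSym p (Ideal.absNorm (L : Ideal (𝓞 F))) = -1 ∧
      legendreSym q (Ideal.absNorm (L : Ideal (𝓞 F))) = -1 := by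
  obtain ⟨l, hl, hl2, hlp, hlq⟩ :=
    exists_prime_legendreSym_eq_neg_one hpq (by omega) (by omega)
  have : Fact l.Prime := ⟨hl⟩
  have hrec : legendreSym l ((p * q : ℤ)) = 1 := by
    rw [legendreSym.mul, legendreSym.quadratic_reciprocity_one_mod_four (p := p) (by omega) hl2,
      legendreSym.quadratic_reciprocity_one_mod_four (p := q) (by omega) hl2, hlp, hlq]
    norm_num
  have h0 : ((p * q : ℤ) : ZMod l) ≠ 0 := fun h0 ↦ by
    rw [(legendreSym.eq_zero_iff l _).2 h0] at hrec
    norm_num at hrec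
  obtain ⟨L, hL⟩ := h.exists_ideal_absNorm_eq hl hl2 ((legendreSym.eq_one_iff l h0).1 hrec)
  exact ⟨L, hL ▸ hlp, hL ▸ hlq⟩

/-- In the presence of a unit of norm `-1`, every class of order two contains a ramified prime. -/
lemma exists_sq_eq_span_prime_of_neg_pell [Fact p.Prime] [Fact q.Prime]
    (h : IsSqrtGenerator (p * q) δ) (hpq : p ≠ q) {r s : ℤ} (hrs : r ^ 2 - p * q * s ^ 2 = -1)
    {C : ClassGroup (𝓞 F)} (hC : C ^ 2 = 1) (hC1 : C ≠ 1) :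
    ∃ B : (Ideal (𝓞 F))⁰, ClassGroup.mk0 B = C ∧
      ((B : Ideal (𝓞 F)) ^ 2 = Ideal.span {(p : 𝓞 F)} ∨
        (B : Ideal (𝓞 F)) ^ 2 = Ideal.span {(q : 𝓞 F)}) := by
  obtain ⟨I, rfl⟩ := ClassGroup.mk0_surjective C
  obtain ⟨ι, hι, hN⟩ := exists_generator_of_sq_eq_one hC
  have hI0 : (Ideal.absNorm (I : Ideal (𝓞 F)) : ℤ) ≠ 0 :=
    Nat.cast_ne_zero.2 (Ideal.absNorm_pos_of_nonZeroDivisors I).ne'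
  obtain ⟨κ, hκ, hNκ⟩ : ∃ κ : 𝓞 F, (I : Ideal (𝓞 F)) ^ 2 = Ideal.span {κ} ∧
      Algebra.norm ℤ κ = (Ideal.absNorm (I : Ideal (𝓞 F)) : ℤ) ^ 2 := by
    rcases abs_choice (Algebra.norm ℤ ι) with hc | hc <;> rw [hc] at hN
    · exact ⟨ι, hι, hN⟩
    · have hunit : IsUnit (r + s * δ : 𝓞 F) := by
        refine IsUnit.of_mul_eq_one (-(r - s * δ)) ?_
        have : (r ^ 2 - p * q * s ^ 2 : 𝓞 F) = -1 := by
          exact_mod_cast congrArg (Int.cast : ℤ → 𝓞 F) hrs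
        have hsq := h.sq
        push_cast at hsq
        linear_combination -this + s ^ 2 * hsq
      refine ⟨ι * (r + s * δ), ?_, ?_⟩
      · rw [hι, Ideal.span_singleton_mul_right_unit hunit]
      · rw [map_mul, h.norm_add_mul, hrs, ← hN]
        ring
  obtain ⟨B, hB, d, hd, hBd⟩ :=
    h.exists_mk0_eq_of_norm_eq_sq Fact.out Fact.out hpq hκ hI0 hNκ
  refine ⟨B, hB, ?_⟩
  rcases dvd_prime_mul_prime Fact.out Fact.out hd with rfl | rfl | rfl | rfl
  · refine absurd ?_ hC1
    rw [← hB]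
    exact ClassGroup.mk0_eq_one_of_sq_eq_span_sq (c := 1) (by simpa using hBd)
  · exact .inl hBd
  · exact .inr hBd
  · refine absurd ?_ hC1
    rw [← hB]
    exact ClassGroup.mk0_eq_one_of_sq_eq_span_sq (c := δ) (by rw [hBd, h.sq]; push_cast; rfl)

lemma eq_of_sq_eq_one_of_neg_pell [Fact p.Prime] [Fact q.Prime]
    (h : IsSqrtGenerator (p * q) δ) (hpq : p ≠ q) {r s : ℤ} (hrs : r ^ 2 - p * q * s ^ 2 = -1)
    {C C' : ClassGroup (𝓞 F)} (hC : C ^ 2 = 1) (hC1 : C ≠ 1) (hC' : C' ^ 2 = 1) (hC1' : C' ≠ 1) :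
    C = C' := by
  obtain ⟨B, rfl, hB⟩ := h.exists_sq_eq_span_prime_of_neg_pell hpq hrs hC hC1
  obtain ⟨B', rfl, hB'⟩ := h.exists_sq_eq_span_prime_of_neg_pell hpq hrs hC' hC1'
  refine eq_of_sq_eq_one_of_mul_eq_one hC' ?_
  rw [← map_mul]
  have hsq := h.sq
  push_cast at hsq
  rcases hB with hB | hB <;> rcases hB' with hB' | hB'
  · exact ClassGroup.mk0_eq_one_of_sq_eq_span_sq (c := (p : 𝓞 F)) (by
      rw [Submonoid.coe_mul, mul_pow, hB, hB', Ideal.span_singleton_mul_span_singleton, pow_two])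
  · exact ClassGroup.mk0_eq_one_of_sq_eq_span_sq (c := δ) (by
      rw [Submonoid.coe_mul, mul_pow, hB, hB', Ideal.span_singleton_mul_span_singleton, hsq])
  · exact ClassGroup.mk0_eq_one_of_sq_eq_span_sq (c := δ) (by
      rw [Submonoid.coe_mul, mul_pow, hB, hB', Ideal.span_singleton_mul_span_singleton, hsq,
        mul_comm])
  · exact ClassGroup.mk0_eq_one_of_sq_eq_span_sq (c := (q : 𝓞 F)) (by
      rw [Submonoid.coe_mul, mul_pow, hB, hB', Ideal.span_singleton_mul_span_singleton, pow_two])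

lemma absNorm_eq_of_sq_eq_span (h : IsSqrtGenerator (p * q) δ) {n : ℕ} {B : Ideal (𝓞 F)}
    (hB : B ^ 2 = Ideal.span {(n : 𝓞 F)}) : Ideal.absNorm B = n := by
  have := congrArg Ideal.absNorm hB
  rw [map_pow, Ideal.absNorm_span_singleton, ← Int.cast_natCast, h.norm_intCast, Int.natAbs_pow,
    Int.natAbs_natCast] at this
  exact Nat.pow_left_injective two_ne_zero this

lemma isSquare_and_exists_pow_four_iff [Fact p.Prime] [Fact q.Prime]
    (h : IsSqrtGenerator (p * q) δ) (hpq : p ≠ q) (hp : p % 8 = 1) (hq : q % 8 = 1)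
    (hres : legendreSym q p = 1) {r s : ℤ} (hrs : r ^ 2 - p * q * s ^ 2 = -1)
    {B : (Ideal (𝓞 F))⁰} (hB : (B : Ideal (𝓞 F)) ^ 2 = Ideal.span {(p : 𝓞 F)})
    (hB1 : ClassGroup.mk0 B ≠ 1) (hB2 : ClassGroup.mk0 B ^ 2 = 1) :
    IsSquare (ClassGroup.mk0 B) ∧
      ((∃ u : ZMod q, u ^ 4 = (p : ZMod q)) ↔ ∃ v : ZMod p, v ^ 4 = (q : ZMod p)) := by
  have hqp : ¬ q ∣ p := fun hd ↦ hpq ((Nat.prime_dvd_prime_iff_eq Fact.out Fact.out).1 hd).symm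
  have hN := h.absNorm_eq_of_sq_eq_span hB
  have hsq : IsSquare (ClassGroup.mk0 B) := by
    by_contra hsq
    obtain ⟨L, -, hL⟩ := h.exists_ideal_legendreSym_eq_neg_one hpq hp hq
    rcases isSquare_or_isSquare_mul hB2 hB1
      (fun g hg hg1 ↦ h.eq_of_sq_eq_one_of_neg_pell hpq hrs hg hg1 hB2 hB1) hsq
      (ClassGroup.mk0 L) with h1 | h1
    · exact h.swap.not_isSquare_mk0 hq hqp hL h1
    · rw [← map_mul] at h1
      refine h.swap.not_isSquare_mk0 hq hqp ?_ h1
      rw [Submonoid.coe_mul, map_mul, hN, Nat.cast_mul, legendreSym.mul, hL, hres, mul_one]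
  refine ⟨hsq, ?_⟩
  obtain ⟨m, a, b, hm, hmab⟩ := h.exists_absNorm_mul_sq_of_isSquare hsq
  rw [hN] at hmab
  have hp0 : (p : ℤ) ≠ 0 := Nat.cast_ne_zero.2 (Fact.out : p.Prime).ne_zero
  have hpa : (p : ℤ) ∣ a := by
    refine (Nat.prime_iff_prime_int.1 Fact.out).dvd_of_dvd_pow (n := 2) ?_
    have h1 : (p : ℤ) ∣ a ^ 2 - p * q * b ^ 2 := by
      rw [← dvd_abs, ← hmab, dvd_abs]
      exact dvd_mul_right _ _
    rw [mul_assoc] at h1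
    exact (dvd_sub_left (dvd_mul_right _ _)).1 h1
  obtain ⟨X, rfl⟩ := hpa
  refine exists_pow_four_iff_of_neg_pell hpq hp hq hrs hm (X := X) (Y := b) ?_
  refine mul_left_cancel₀ (abs_ne_zero.2 hp0) ?_
  rw [← abs_mul, ← abs_of_nonneg (sq_nonneg m), ← abs_mul, hmab]
  congr 1
  ring

lemma four_dvd_card_iff_of_neg_pell [Fact p.Prime] [Fact q.Prime]
    (h : IsSqrtGenerator (p * q) δ) (hpq : p ≠ q) (hp : p % 8 = 1) (hq : q % 8 = 1)
    (hres : legendreSym q p = 1) {r s : ℤ} (hrs : r ^ 2 - p * q * s ^ 2 = -1) :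
    4 ∣ Nat.card (ClassGroup (𝓞 F)) ↔
      ((∃ u : ZMod q, u ^ 4 = (p : ZMod q)) ↔ ∃ v : ZMod p, v ^ 4 = (q : ZMod p)) := by
  have hpq' : ¬ p ∣ q := fun hd ↦ hpq ((Nat.prime_dvd_prime_iff_eq Fact.out Fact.out).1 hd)
  obtain ⟨L, hL, -⟩ := h.exists_ideal_legendreSym_eq_neg_one hpq hp hq
  obtain ⟨T, hT, hT1⟩ := exists_sq_eq_one_of_not_isSquare (h.not_isSquare_mk0 hp hpq' hL)
  rw [four_dvd_card_iff_isSquare hT hT1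
    fun g hg hg1 ↦ h.eq_of_sq_eq_one_of_neg_pell hpq hrs hg hg1 hT hT1]
  obtain ⟨B, rfl, hB | hB⟩ := h.exists_sq_eq_span_prime_of_neg_pell hpq hrs hT hT1
  · obtain ⟨h1, h2⟩ := h.isSquare_and_exists_pow_four_iff hpq hp hq hres hrs hB hT1 hT
    exact iff_of_true h1 h2
  · have hres' : legendreSym p q = 1 := by
      rwa [← legendreSym.quadratic_reciprocity_one_mod_four (by omega) (by omega)]
    obtain ⟨h1, h2⟩ := h.swap.isSquare_and_exists_pow_four_iff hpq.symm hq hp hres'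
      (r := r) (s := s) (by linarith) hB hT1 hT
    exact iff_of_true h1 h2.symm

lemma exists_span_eq_span_sq_of_pell (hp : p.Prime) (hq : q.Prime)
    (h : IsSqrtGenerator (p * q) δ) {r s : ℤ} (hrs : p * r ^ 2 - q * s ^ 2 = 1) {d : ℕ}
    (hd : d ∣ p * q) : ∃ c : 𝓞 F, Ideal.span {(d : 𝓞 F)} = Ideal.span {c ^ 2} := by
  have hsq := h.sq
  push_cast at hsq
  have hrs' : (p * r ^ 2 - q * s ^ 2 : 𝓞 F) = 1 := by
    exact_mod_cast congrArg (Int.cast : ℤ → 𝓞 F) hrs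
  have hη : IsUnit (p * r ^ 2 + q * s ^ 2 + 2 * r * s * δ : 𝓞 F) :=
    IsUnit.of_mul_eq_one (p * r ^ 2 + q * s ^ 2 - 2 * r * s * δ) (by
      linear_combination -4 * r ^ 2 * s ^ 2 * hsq + (p * r ^ 2 - q * s ^ 2 + 1) * hrs')
  rcases dvd_prime_mul_prime hp hq hd with rfl | rfl | rfl | rfl
  · exact ⟨1, by simp⟩
  · refine ⟨d * r + s * δ, ?_⟩
    rw [← Ideal.span_singleton_mul_right_unit hη]
    congr 2
    linear_combination -s ^ 2 * hsq
  · refine ⟨d * s + r * δ, ?_⟩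
    rw [← Ideal.span_singleton_mul_right_unit hη]
    congr 2
    linear_combination -r ^ 2 * hsq
  · exact ⟨δ, by rw [hsq, Nat.cast_mul]⟩

lemma mk0_eq_one_of_pell [Fact p.Prime] [Fact q.Prime] (h : IsSqrtGenerator (p * q) δ)
    (hpq : p ≠ q) {r s : ℤ} (hrs : p * r ^ 2 - q * s ^ 2 = 1) {I : (Ideal (𝓞 F))⁰} {ι : 𝓞 F}
    (hI : (I : Ideal (𝓞 F)) ^ 2 = Ideal.span {ι}) {n : ℤ} (hn : n ≠ 0)
    (hι : Algebra.norm ℤ ι = n ^ 2) : ClassGroup.mk0 I = 1 := by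
  obtain ⟨B, hB, d, hd, hBd⟩ := h.exists_mk0_eq_of_norm_eq_sq Fact.out Fact.out hpq hI hn hι
  obtain ⟨c, hc⟩ := h.exists_span_eq_span_sq_of_pell Fact.out Fact.out hrs hd
  rw [← hB]
  exact ClassGroup.mk0_eq_one_of_sq_eq_span_sq (hBd.trans hc)

lemma exists_generator_of_pell [Fact p.Prime] [Fact q.Prime] (h : IsSqrtGenerator (p * q) δ)
    (hpq : p ≠ q) {r s : ℤ} (hrs : p * r ^ 2 - q * s ^ 2 = 1) {I : (Ideal (𝓞 F))⁰}
    (hI : ClassGroup.mk0 I ^ 2 = 1) (hI1 : ClassGroup.mk0 I ≠ 1) :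
    ∃ ι : 𝓞 F, (I : Ideal (𝓞 F)) ^ 2 = Ideal.span {ι} ∧
      Algebra.norm ℤ ι = -(Ideal.absNorm (I : Ideal (𝓞 F)) : ℤ) ^ 2 := by
  obtain ⟨ι, hι, hN⟩ := exists_generator_of_sq_eq_one hI
  refine ⟨ι, hι, ?_⟩
  rcases abs_choice (Algebra.norm ℤ ι) with hc | hc <;> rw [hc] at hN
  · exact absurd (h.mk0_eq_one_of_pell hpq hrs hι
      (Nat.cast_ne_zero.2 (Ideal.absNorm_pos_of_nonZeroDivisors I).ne') hN) hI1
  · rw [← hN, neg_neg]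

lemma eq_of_sq_eq_one_of_pell [Fact p.Prime] [Fact q.Prime] (h : IsSqrtGenerator (p * q) δ)
    (hpq : p ≠ q) {r s : ℤ} (hrs : p * r ^ 2 - q * s ^ 2 = 1)
    {C C' : ClassGroup (𝓞 F)} (hC : C ^ 2 = 1) (hC1 : C ≠ 1) (hC' : C' ^ 2 = 1) (hC1' : C' ≠ 1) :
    C = C' := by
  obtain ⟨I, rfl⟩ := ClassGroup.mk0_surjective C
  obtain ⟨I', rfl⟩ := ClassGroup.mk0_surjective C'
  obtain ⟨ι, hι, hN⟩ := h.exists_generator_of_pell hpq hrs hC hC1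
  obtain ⟨ι', hι', hN'⟩ := h.exists_generator_of_pell hpq hrs hC' hC1'
  refine eq_of_sq_eq_one_of_mul_eq_one hC' ?_
  rw [← map_mul]
  refine h.mk0_eq_one_of_pell hpq hrs (ι := ι * ι') (n := (Ideal.absNorm (I : Ideal (𝓞 F)) : ℤ) *
    Ideal.absNorm (I' : Ideal (𝓞 F))) ?_ ?_ ?_
  · rw [Submonoid.coe_mul, mul_pow, hι, hι', Ideal.span_singleton_mul_span_singleton]
  · exact mul_ne_zero (Nat.cast_ne_zero.2 (Ideal.absNorm_pos_of_nonZeroDivisors I).ne')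
      (Nat.cast_ne_zero.2 (Ideal.absNorm_pos_of_nonZeroDivisors I').ne')
  · rw [map_mul, hN, hN']
    ring

/-- For an ideal not divisible by a nontrivial principal ideal, a generator of its square is not
divisible by an odd prime. -/
lemma not_natCast_dvd_of_pell [Fact p.Prime] [Fact q.Prime] (h : IsSqrtGenerator (p * q) δ)
    {r s : ℤ} (hrs : p * r ^ 2 - q * s ^ 2 = 1) {J : Ideal (𝓞 F)} {ι : 𝓞 F}
    (hJ : J ^ 2 = Ideal.span {ι}) (hmin : ∀ c : 𝓞 F, c ≠ 0 → Ideal.span {c} ∣ J → IsUnit c)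
    {l : ℕ} (hl : l.Prime) : ¬ (l : 𝓞 F) ∣ ι := by
  intro hlι
  have hl0 : (l : 𝓞 F) ≠ 0 := Nat.cast_ne_zero.2 hl.ne_zero
  have hnu : ¬ IsUnit (l : 𝓞 F) := fun hu ↦ hl.one_lt.ne' (Nat.dvd_one.1
    (h.natCast_dvd_natCast (by simpa using hu.dvd)))
  have hle : J ^ 2 ≤ Ideal.span {(l : 𝓞 F)} := by
    rwa [hJ, Ideal.span_singleton_le_span_singleton]
  by_cases hlD : (l : ℤ) ∣ p * q
  · obtain ⟨c, hc⟩ := h.exists_span_eq_span_sq_of_pell Fact.out Fact.out hrs (d := l)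
      (by exact_mod_cast hlD)
    have hc0 : c ≠ 0 := by
      rintro rfl
      rw [zero_pow two_ne_zero, Ideal.span_singleton_eq_span_singleton] at hc
      exact hl0 (associated_zero_iff_eq_zero _ |>.1 hc)
    rw [hc, ← Ideal.span_singleton_pow, ← Ideal.dvd_iff_le,
      UniqueFactorizationMonoid.pow_dvd_pow_iff_dvd two_ne_zero] at hle
    have hu := (hmin c hc0 hle).pow 2
    rw [← Ideal.span_singleton_eq_top, ← hc, Ideal.span_singleton_eq_top] at hu
    exact hnu hu
  · exact hnu (hmin _ hl0 (Ideal.dvd_iff_le.2 (Ideal.span_singleton_dvd_of_sq_dvd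
      (fun x hx ↦ h.natCast_dvd_of_dvd_sq hl hlD hx) hle)))

lemma four_dvd_card_iff_of_pell [Fact p.Prime] [Fact q.Prime]
    (h : IsSqrtGenerator (p * q) δ) (hpq : p ≠ q) (hp : p % 8 = 1) (hq : q % 8 = 1)
    {r s : ℤ} (hrs : p * r ^ 2 - q * s ^ 2 = 1) :
    4 ∣ Nat.card (ClassGroup (𝓞 F)) ↔
      ((∃ u : ZMod q, u ^ 4 = (p : ZMod q)) ↔ ∃ v : ZMod p, v ^ 4 = (q : ZMod p)) := by
  have hpq' : ¬ p ∣ q := fun hd ↦ hpq ((Nat.prime_dvd_prime_iff_eq Fact.out Fact.out).1 hd)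
  have hqp : ¬ q ∣ p := fun hd ↦ hpq ((Nat.prime_dvd_prime_iff_eq Fact.out Fact.out).1 hd).symm
  obtain ⟨L, -, hL⟩ := h.exists_ideal_legendreSym_eq_neg_one hpq hp hq
  have hLsq := h.swap.not_isSquare_mk0 hq hqp hL
  obtain ⟨T, hT, hT1⟩ := exists_sq_eq_one_of_not_isSquare hLsq
  have huniq : ∀ g : ClassGroup (𝓞 F), g ^ 2 = 1 → g ≠ 1 → g = T :=
    fun g hg hg1 ↦ h.eq_of_sq_eq_one_of_pell hpq hrs hg hg1 hT hT1
  have hq4 : ∃ v : ZMod p, v ^ 4 = (q : ZMod p) := by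
    refine (exists_pow_four_iff_legendreSym hp hpq' (U := s) (V := r) (Z := 1)
      (by linarith) fun l hl hls hlr ↦ ?_).2.2 (legendreSym.at_one p)
    have h1 : (l : ℤ) ∣ 1 := by
      rw [← hrs]
      exact dvd_sub ((dvd_pow hlr two_ne_zero).mul_left _) ((dvd_pow hls two_ne_zero).mul_left _)
    exact absurd (Nat.dvd_one.1 (by exact_mod_cast h1)) hl.one_lt.ne'
  rw [four_dvd_card_iff_isSquare hT hT1 huniq, iff_true_right hq4]
  obtain ⟨J, rfl, hJmin⟩ := ClassGroup.exists_mk0_eq_of_minimal T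
  obtain ⟨ι, hι, hN⟩ := h.exists_generator_of_pell hpq hrs hT hT1
  obtain ⟨u, v, huv⟩ := h.exists_coords ι
  have h4 := h.four_norm ι u v huv
  rw [hN] at h4
  set w := Ideal.absNorm (J : Ideal (𝓞 F)) with hw
  obtain ⟨hqw, hiff⟩ := exists_pow_four_iff_legendreSym (p := p) hq hqp
    (U := u * r + v * q * s) (V := u * s + v * p * r) (Z := 2 ^ 1 * w)
    (by linear_combination h4 - (u ^ 2 - p * q * v ^ 2) * hrs) fun l hl hlU hlV ↦ by
      by_contra hl2
      refine h.not_natCast_dvd_of_pell hrs hι hJmin hl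
        (natCast_dvd_of_dvd_coords (hl.odd_of_ne_two hl2) huv ?_ ?_)
      · rw [show u = (u * r + v * q * s) * (p * r) - (u * s + v * p * r) * (q * s) by
          linear_combination -u * hrs]
        exact dvd_sub (hlU.mul_right _) (hlV.mul_right _)
      · rw [show v = (u * s + v * p * r) * r - (u * r + v * q * s) * s by
          linear_combination -v * hrs]
        exact dvd_sub (hlV.mul_right _) (hlU.mul_right _)
  have hqw' : ¬ q ∣ w := fun hd ↦ hqw ((Int.natCast_dvd_natCast.2 hd).mul_left _)
  rw [hiff, legendreSym.mul, legendreSym_two_pow hq, one_mul]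
  refine ⟨fun hsq ↦ h.swap.legendreSym_absNorm_eq_one hq hqp hsq hqw', fun hw1 ↦ ?_⟩
  by_contra hsq
  rcases isSquare_or_isSquare_mul hT hT1 huniq hsq (ClassGroup.mk0 L) with h1 | h1
  · exact hLsq h1
  · rw [← map_mul] at h1
    refine h.swap.not_isSquare_mk0 hq hqp ?_ h1
    rw [Submonoid.coe_mul, map_mul, ← hw, Nat.cast_mul, legendreSym.mul, hL, hw1, mul_one]

theorem four_dvd_card_iff [Fact p.Prime] [Fact q.Prime]
    (h : IsSqrtGenerator (p * q) δ) (hpq : p ≠ q) (hp : p % 8 = 1) (hq : q % 8 = 1)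
    (hres : legendreSym q p = 1) :
    4 ∣ Nat.card (ClassGroup (𝓞 F)) ↔
      ((∃ u : ZMod q, u ^ 4 = (p : ZMod q)) ↔ ∃ v : ZMod p, v ^ 4 = (q : ZMod p)) := by
  rcases exists_neg_pell_or Fact.out Fact.out hpq hp hq with ⟨r, s, hrs⟩ | ⟨r, s, hrs⟩ | ⟨r, s, hrs⟩
  · exact h.four_dvd_card_iff_of_neg_pell hpq hp hq hres hrs
  · exact h.four_dvd_card_iff_of_pell hpq hp hq hrs
  · rw [h.swap.four_dvd_card_iff_of_pell hpq.symm hq hp hrs]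
    exact Iff.comm

end IsSqrtGenerator

lemma Int.exists_intCast_eq_of_squarefree_mul_sq {D : ℤ} (hD : Squarefree D) {y : ℚ} {m : ℤ}
    (h : D * y ^ 2 = m) : ∃ n : ℤ, y = n := by
  have hd : (y.den : ℚ) ≠ 0 := Nat.cast_ne_zero.2 y.den_nz
  have h1 : D * y.num ^ 2 = m * (y.den : ℤ) ^ 2 := by
    have h2 : (D * y.num ^ 2 : ℚ) = m * (y.den : ℚ) ^ 2 := by
      rw [← h, ← Rat.mul_den_eq_num y]
      ring
    exact_mod_cast h2
  have hcop : IsCoprime ((y.den : ℤ) ^ 2) (y.num ^ 2) :=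
    (Int.isCoprime_iff_gcd_eq_one.2 (by simpa [Int.gcd] using y.reduced.symm)).pow
  have h3 : (y.den : ℤ) ^ 2 ∣ D := hcop.dvd_of_dvd_mul_right ⟨m, by rw [h1]; ring⟩
  have h4 : y.den = 1 := by
    exact Int.natAbs_natCast y.den ▸ Int.isUnit_iff_natAbs_eq.1 (hD _ (by rwa [← sq]))
  exact ⟨y.num, (Rat.den_eq_one_iff y).1 h4 |>.symm⟩

section

variable {F : Type*} [Field F] [NumberField F] {D : ℤ} {α : F}

lemma exists_basis_of_sq_eq_intCast (hD : ¬ IsSquare D) (hα : α ^ 2 = D)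
    (hF : Module.finrank ℚ F = 2) : ∃ B : Module.Basis (Fin 2) ℚ F, B 0 = 1 ∧ B 1 = α := by
  have hli : LinearIndependent ℚ ![1, α] := by
    rw [LinearIndependent.pair_iff]
    intro s t hst
    have ht : t = 0 := by
      by_contra ht
      refine hD (Rat.isSquare_intCast_iff.1 ⟨s / t, (algebraMap ℚ F).injective ?_⟩)
      have ht' : (t : F) ≠ 0 := by exact_mod_cast ht
      have hα' : α = -(s / t : F) := by
        rw [Algebra.smul_def, Algebra.smul_def] at hst
        field_simp
        rw [eq_neg_iff_add_eq_zero]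
        simpa [add_comm, mul_comm] using hst
      rw [hα'] at hα
      simp only [map_intCast, map_mul, map_div₀, eq_ratCast]
      rw [← hα]; ring
    subst ht
    simpa using hst
  refine ⟨basisOfLinearIndependentOfCardEqFinrank hli (by simp [hF]), ?_, ?_⟩ <;> simp

lemma norm_and_trace_of_sq_eq_intCast (hD : ¬ IsSquare D) (hα : α ^ 2 = D)
    (hF : Module.finrank ℚ F = 2) (s t : ℚ) :
    Algebra.norm ℚ (s + t * α : F) = s ^ 2 - D * t ^ 2 ∧
      Algebra.trace ℚ F (s + t * α) = 2 * s := by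
  obtain ⟨B, h0, h1⟩ := exists_basis_of_sq_eq_intCast hD hα hF
  have hrepr : ∀ a b : ℚ, ∀ i, B.repr (a + b * α : F) i = ![a, b] i := by
    intro a b i
    rw [show (a + b * α : F) = a • B 0 + b • B 1 by rw [h0, h1]; simp [Algebra.smul_def]]
    fin_cases i <;> simp
  have hmul : (s + t * α : F) * α = ((D * t : ℚ) : F) + (s : ℚ) * α := by
    push_cast
    linear_combination (t : F) * hα
  have hM : Algebra.leftMulMatrix B (s + t * α : F) = !![s, D * t; t, s] := by
    ext i j
    rw [Algebra.leftMulMatrix_eq_repr_mul]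
    fin_cases j
    · simp only [Fin.zero_eta, h0, mul_one, hrepr]
      fin_cases i <;> rfl
    · simp only [Fin.mk_one, h1, hmul, hrepr]
      fin_cases i <;> rfl
  constructor
  · rw [Algebra.norm_eq_matrix_det B, hM, Matrix.det_fin_two_of]
    ring
  · rw [Algebra.trace_eq_matrix_trace B, hM, Matrix.trace_fin_two_of]
    ring

lemma exists_rat_coords_of_sq_eq_intCast (hD : ¬ IsSquare D) (hα : α ^ 2 = D)
    (hF : Module.finrank ℚ F = 2) (x : F) : ∃ s t : ℚ, x = s + t * α := by
  obtain ⟨B, h0, h1⟩ := exists_basis_of_sq_eq_intCast hD hα hF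
  refine ⟨B.repr x 0, B.repr x 1, ?_⟩
  conv_lhs => rw [← B.sum_repr x]
  simp [Fin.sum_univ_two, h0, h1, Algebra.smul_def]

lemma exists_isSqrtGenerator (hsqf : Squarefree D) (hD : ¬ IsSquare D) (hD4 : D % 4 = 1)
    (hα : α ^ 2 = D) (hF : Module.finrank ℚ F = 2) : ∃ δ : 𝓞 F, IsSqrtGenerator D δ := by
  have hαZ : IsIntegral ℤ α := .of_pow two_pos (hα ▸ isIntegral_algebraMap (R := ℤ) (x := D))
  set δ : 𝓞 F := ⟨α, hαZ⟩ with hδ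
  have hδα : algebraMap (𝓞 F) F δ = α := rfl
  have hδ2 : δ ^ 2 = D := RingOfIntegers.ext (by simpa [hδα] using hα)
  refine ⟨δ, hδ2, fun x ↦ ?_, fun x a b hab ↦ ?_, ?_, ?_, hD⟩
  · obtain ⟨s, t, hst⟩ := exists_rat_coords_of_sq_eq_intCast hD hα hF (x : F)
    obtain ⟨hN, hT⟩ := norm_and_trace_of_sq_eq_intCast hD hα hF s t
    rw [← hst, ← Algebra.coe_norm_int] at hN
    rw [← hst, ← Algebra.coe_trace_int] at hT
    obtain ⟨b, hb⟩ := Int.exists_intCast_eq_of_squarefree_mul_sq hsqf (y := 2 * t)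
      (m := (Algebra.trace ℤ (𝓞 F) x) ^ 2 - 4 * Algebra.norm ℤ x) (by
        push_cast
        rw [hN, hT]
        ring)
    refine ⟨Algebra.trace ℤ (𝓞 F) x, b, RingOfIntegers.ext ?_⟩
    have hb' : (2 * t : F) = b := by exact_mod_cast congrArg (Rat.cast : ℚ → F) hb
    have hT' : (Algebra.trace ℤ (𝓞 F) x : F) = 2 * s := by
      exact_mod_cast congrArg (Rat.cast : ℚ → F) hT
    simp only [map_mul, map_add, map_ofNat, map_intCast, hδα]
    rw [hT', ← hb']
    linear_combination 2 * hst
  · have hab' : (2 * x : F) = a + b * α := by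
      have := congrArg (algebraMap (𝓞 F) F) hab
      simpa only [map_mul, map_add, map_ofNat, map_intCast, hδα] using this
    have hx : (x : F) = ((a / 2 : ℚ) : F) + ((b / 2 : ℚ) : F) * α := by
      push_cast
      linear_combination hab' / 2
    have hN := (norm_and_trace_of_sq_eq_intCast hD hα hF (a / 2) (b / 2)).1
    rw [← hx, ← Algebra.coe_norm_int] at hN
    have : (4 * Algebra.norm ℤ x : ℚ) = a ^ 2 - D * b ^ 2 := by
      rw [hN]; ring
    exact_mod_cast this
  · obtain ⟨k, hk⟩ : (4 : ℤ) ∣ D - 1 := by omega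
    have hk' : (D : F) = 4 * k + 1 := by
      have : D = 4 * k + 1 := by linarith
      exact_mod_cast congrArg (Int.cast : ℤ → F) this
    have hω : IsIntegral ℤ ((1 + α) / 2) := by
      refine ⟨.X ^ 2 - .X - .C k, by monicity!, ?_⟩
      rw [Polynomial.eval₂_sub, Polynomial.eval₂_sub, Polynomial.eval₂_pow, Polynomial.eval₂_X,
        Polynomial.eval₂_C, eq_intCast]
      linear_combination hα / 4 + hk' / 4
    set ω : 𝓞 F := ⟨(1 + α) / 2, hω⟩
    have hωα : algebraMap (𝓞 F) F ω = (1 + α) / 2 := rfl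
    refine ⟨ω, RingOfIntegers.ext ?_⟩
    change algebraMap (𝓞 F) F (1 + δ) = algebraMap (𝓞 F) F (2 * ω)
    rw [map_add, map_one, map_mul, map_ofNat, hδα, hωα]
    ring
  · exact Int.odd_iff.2 (by omega)

end

/-- Proposition 4.6(iii), equivalence (2) ⇔ (4): for distinct primes
`p ≡ q ≡ 1 (mod 8)` with `p` a quadratic residue mod `q`, the class number of
`F = ℚ(√(pq))` is divisible by `4` iff (`p` is a fourth power mod `q` ↔ `q` is
a fourth power mod `p`). -/
theorem four_dvd_classNumber_iff_fourth_power_residues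
    (p q : ℕ) (hp : p.Prime) (hq : q.Prime) (hpq : p ≠ q)
    (hp8 : p % 8 = 1) (hq8 : q % 8 = 1)
    (hres : IsSquare ((p : ZMod q)))
    (F : Type*) [Field F] [NumberField F]
    (α : F) (hα : α ^ 2 = (p : F) * (q : F))
    (hFdeg : Module.finrank ℚ F = 2)
    (hFgen : Algebra.adjoin ℚ {α} = ⊤) :
    4 ∣ NumberField.classNumber F ↔
      ((∃ u : ZMod q, u ^ 4 = (p : ZMod q)) ↔
       (∃ v : ZMod p, v ^ 4 = (q : ZMod p))) := by
  have := Fact.mk hp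
  have := Fact.mk hq
  have hqp : ((p : ℤ) : ZMod q) ≠ 0 := by
    rw [Int.cast_natCast, Ne, ZMod.natCast_eq_zero_iff]
    exact fun hd ↦ hpq ((Nat.prime_dvd_prime_iff_eq hq hp).1 hd).symm
  have hD := not_isSquare_prime_mul_prime hp hq hpq
  have hsqf : Squarefree (p * q : ℤ) := by
    rw [← Nat.cast_mul, Int.squarefree_natCast]
    exact (Nat.squarefree_mul ((Nat.coprime_primes hp hq).2 hpq)).2
      ⟨hp.squarefree, hq.squarefree⟩
  obtain ⟨δ, hδ⟩ := exists_isSqrtGenerator hsqf hD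
    (by rw [Int.mul_emod, show (p : ℤ) % 4 = 1 by omega, show (q : ℤ) % 4 = 1 by omega]; rfl)
    (by rw [hα]; push_cast; rfl) hFdeg
  rw [NumberField.classNumber, ← Nat.card_eq_fintype_card]
  exact hδ.four_dvd_card_iff hpq hp8 hq8
    ((legendreSym.eq_one_iff q hqp).2 (by simpa using hres))
end

section
/- Let p be a prime number with p ≡ 1 (mod 8), and write p = y² + z² with integers y, z such that 4 divides y. Let s ∈ ℝ be the positive square root of p and let a ∈ ℝ be the positive square root of p + y·s, and set K = ℚ(a) ⊆ ℝ. Then K is a totally real number field of degree 4 over ℚ, the extension K/ℚ is Galois with cyclic Galois group of order 4, K contains ℚ(√p), and every rational prime number r ≠ p is unramified in K. -/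
open NumberField

open Polynomial in
/-- The quartic polynomial `X⁴ - 2pX² + pz²`, Eisenstein at `p` when `p ∤ z`. -/
noncomputable def biquadraticPoly (p z : ℤ) : ℤ[X] :=
  X ^ 4 - C (2 * p) * X ^ 2 + C (p * z ^ 2)

section

open Polynomial

lemma biquadraticPoly_natDegree (p z : ℤ) : (biquadraticPoly p z).natDegree = 4 := by
  unfold biquadraticPoly
  compute_degree!

lemma biquadraticPoly_monic (p z : ℤ) : (biquadraticPoly p z).Monic := by
  unfold biquadraticPoly
  monicity!

lemma biquadraticPoly_irreducible {p z : ℤ} (hp : Prime p) (hz : ¬ p ∣ z) :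
    Irreducible (biquadraticPoly p z) := by
  have hmonic := biquadraticPoly_monic p z
  have hdeg := biquadraticPoly_natDegree p z
  have hcoeff (n : ℕ) : (biquadraticPoly p z).coeff n =
      (if n = 4 then 1 else 0) - 2 * p * (if n = 2 then 1 else 0) +
        (if n = 0 then p * z ^ 2 else 0) := by
    simp only [biquadraticPoly, coeff_add, coeff_sub, coeff_C_mul, coeff_X_pow, coeff_C]
  refine IsEisensteinAt.irreducible (𝓟 := Ideal.span {p}) ⟨?_, ?_, ?_⟩ ?_
    hmonic.isPrimitive (by lia)
  · rw [hmonic.leadingCoeff, Ideal.mem_span_singleton]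
    exact fun h ↦ hp.not_isUnit (isUnit_of_dvd_one h)
  · intro n hn
    rw [hdeg] at hn
    rw [Ideal.mem_span_singleton, hcoeff]
    interval_cases n <;> simp
  · rw [Ideal.span_singleton_pow, Ideal.mem_span_singleton, hcoeff]
    simp only [OfNat.zero_ne_ofNat, if_false, if_true, mul_zero, sub_zero, zero_add]
    rw [sq p, mul_dvd_mul_iff_left hp.ne_zero]
    exact fun h ↦ hz (hp.dvd_of_dvd_pow h)
  · rwa [Ideal.span_singleton_prime hp.ne_zero]

lemma minpoly_eq_biquadraticPoly {L : Type*} [Field L] [Algebra ℚ L] {p z : ℤ} (hp : Prime p)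
    (hz : ¬ p ∣ z) {a : L} (ha : a ^ 4 - 2 * p * a ^ 2 + p * z ^ 2 = 0) :
    minpoly ℚ a = (biquadraticPoly p z).map (algebraMap ℤ ℚ) := by
  have hmonic := biquadraticPoly_monic p z
  refine (minpoly.eq_of_irreducible_of_monic
    (hmonic.irreducible_iff_irreducible_map_fraction_map.mp (biquadraticPoly_irreducible hp hz))
    ?_ (hmonic.map _)).symm
  rw [aeval_map_algebraMap]
  simpa [biquadraticPoly, map_ofNat] using ha

lemma isIntegral_half_one_add {K : Type*} [Field K] [CharZero K] {p k m : ℤ} (hpm : p = 8 * m + 1)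
    {a : K} (ha : (a ^ 2 - p) ^ 2 = p * (4 * k) ^ 2) : IsIntegral ℤ ((1 + a) / 2) := by
  refine ⟨(X ^ 2 - X - C (2 * m)) ^ 2 - C (k ^ 2 * p), by monicity!, ?_⟩
  have hpm' : (p : K) = 8 * m + 1 := by exact_mod_cast congrArg (Int.cast : ℤ → K) hpm
  simp only [eval₂_sub, eval₂_pow, eval₂_X, eval₂_C]
  push_cast
  simp only [eq_intCast]
  push_cast
  rw [hpm'] at ha ⊢
  linear_combination ha / 16

end

lemma not_dvd_of_eq_sq_add_sq {p y z : ℤ} (hp : Prime p) (h : p = y ^ 2 + z ^ 2) : ¬ p ∣ y := by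
  intro hy
  have hz : p ∣ z := hp.dvd_of_dvd_pow (n := 2) (by
    rw [show z ^ 2 = p - y ^ 2 by linarith]
    exact dvd_sub_self_left.mpr (hy.pow two_ne_zero))
  obtain ⟨u, rfl⟩ := hy
  obtain ⟨v, rfl⟩ := hz
  refine hp.not_isUnit (IsUnit.of_mul_eq_one (u ^ 2 + v ^ 2) ?_)
  exact mul_left_cancel₀ hp.ne_zero (by linarith)

/-- A rational prime is unramified in a Galois number field if the inertia groups above it are
trivial. -/
lemma squarefree_span_natCast_of_inertia_eq_bot {K : Type*} [Field K] [NumberField K]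
    [IsGalois ℚ K] {r : ℕ} (hr : r.Prime)
    (h : ∀ P : Ideal (𝓞 K), P.IsPrime → (r : 𝓞 K) ∈ P → P.inertia (K ≃ₐ[ℚ] K) = ⊥) :
    Squarefree (Ideal.span {(r : 𝓞 K)} : Ideal (𝓞 K)) := by
  classical
  have hr0 : (r : 𝓞 K) ≠ 0 := Nat.cast_ne_zero.mpr hr.ne_zero
  have hI : (Ideal.span {(r : 𝓞 K)} : Ideal (𝓞 K)) ≠ 0 := by
    simpa [Ideal.zero_eq_bot, Ideal.span_singleton_eq_bot] using hr0
  have hmap : (Ideal.span {(r : ℤ)}).map (algebraMap ℤ (𝓞 K)) = Ideal.span {(r : 𝓞 K)} := by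
    simp [Ideal.map_span]
  have hrZ : Prime (r : ℤ) := Nat.prime_iff_prime_int.mp hr
  have hp : (Ideal.span {(r : ℤ)}).IsPrime := (Ideal.span_singleton_prime hrZ.ne_zero).mpr hrZ
  have hmax : (Ideal.span {(r : ℤ)}).IsMaximal :=
    hp.isMaximal (by simpa [Ideal.span_singleton_eq_bot] using hr.ne_zero)
  rw [UniqueFactorizationMonoid.squarefree_iff_nodup_normalizedFactors hI,
    Multiset.nodup_iff_count_le_one]
  intro P
  by_cases hP : P ∈ UniqueFactorizationMonoid.normalizedFactors (Ideal.span {(r : 𝓞 K)})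
  swap
  · simp [Multiset.count_eq_zero_of_notMem hP]
  have hPp : P.IsPrime :=
    Ideal.isPrime_of_prime (UniqueFactorizationMonoid.prime_of_normalized_factor P hP)
  have hrP : (r : 𝓞 K) ∈ P :=
    Ideal.dvd_span_singleton.mp (UniqueFactorizationMonoid.dvd_of_mem_normalizedFactors hP)
  have : P.LiesOver (Ideal.span {(r : ℤ)}) := by
    refine ⟨hmax.eq_of_le (hPp.under ℤ).ne_top ?_⟩
    rw [Ideal.span_singleton_le_iff_mem, Ideal.mem_comap]
    simpa using hrP
  rw [← hmap, ← Ideal.IsDedekindDomain.ramificationIdx_eq_normalizedFactors_count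
    (Ideal.span {(r : ℤ)}) P (by rw [hmap]; exact hI),
    ← Ideal.ramificationIdxIn_eq_ramificationIdx (Ideal.span {(r : ℤ)}) P (K ≃ₐ[ℚ] K),
    ← Ideal.card_inertia_eq_ramificationIdxIn (G := K ≃ₐ[ℚ] K) (Ideal.span {(r : ℤ)}) P, h P hPp hrP]
  simp

lemma sq_mem_of_orderOf_eq_four {G : Type*} [Group G] {σ : G} (hσ : orderOf σ = 4)
    (hgen : ∀ g, g ∈ Subgroup.zpowers σ) {H : Subgroup G} (hH : H ≠ ⊥) : σ ^ 2 ∈ H := by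
  obtain ⟨g, hg, hg1⟩ := H.bot_or_exists_ne_one.resolve_left hH
  obtain ⟨k, rfl⟩ := Subgroup.mem_zpowers_iff.mp (hgen g)
  have hmod (n : ℤ) : σ ^ n = σ ^ (n % 4) := by
    rw [← zpow_mod_orderOf, hσ]; rfl
  have hk : k % 4 = 0 ∨ k % 4 = 2 ∨ (k * 2) % 4 = 2 := by lia
  rcases hk with hk | hk | hk
  · exact absurd (by rw [hmod, hk, zpow_zero]) hg1
  · rw [hmod, hk] at hg
    exact_mod_cast hg
  · have := H.pow_mem hg 2
    rw [← zpow_natCast, ← zpow_mul, Nat.cast_ofNat, hmod, hk] at this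
    exact_mod_cast this

/-- If `α ∈ 𝓞 K` satisfies `α = 2β - 1`, and an automorphism negates `α` and lies in the inertia
group of `P`, then `α ∈ P`. -/
lemma mem_of_mem_inertia_of_neg {K : Type*} [Field K] [NumberField K] {P : Ideal (𝓞 K)}
    {τ : K ≃ₐ[ℚ] K} (hτ : τ ∈ P.inertia (K ≃ₐ[ℚ] K)) {α β : 𝓞 K} (hαβ : 2 * β = 1 + α)
    (hneg : τ • α = -α) : α ∈ P := by
  have h : τ • β - β = -α := by
    have h2 : τ • (2 * β) = τ • (1 + α) := by rw [hαβ]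
    rw [two_mul, smul_add, smul_add, smul_one, hneg] at h2
    refine mul_left_cancel₀ (two_ne_zero (α := 𝓞 K)) ?_
    linear_combination h2 - hαβ
  simpa [h] using hτ β

/-- Every element of a Galois number field inside `ℝ` is totally real. -/
lemma im_eq_zero_of_isGalois_real {K : IntermediateField ℚ ℝ} [IsGalois ℚ K] (φ : K →+* ℂ)
    (w : K) : (φ w).im = 0 := by
  obtain ⟨σ, hσ⟩ := ComplexEmbedding.exists_comp_symm_eq_of_comp_eq (k := ℚ)
    (Complex.ofRealHom.comp (algebraMap K ℝ)) φ (Subsingleton.elim _ _)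
  rw [← hσ]
  simp

/-- If `σ` sends `α` to `β` and `β` to `-α`, where `α, β ≡ 1` modulo `2` are integers with
`α² + β² = 2p` and `α²β² = pz²`, `z` odd, then only `p` can ramify. -/
lemma squarefree_span_natCast_of_cyclic_quartic {K : Type*} [Field K] [NumberField K]
    [IsGalois ℚ K] {σ : K ≃ₐ[ℚ] K} (hσ : orderOf σ = 4) (hgen : ∀ g, g ∈ Subgroup.zpowers σ)
    {p r : ℕ} (hp : p.Prime) (hr : r.Prime) (hrp : r ≠ p) {z : ℤ} (hz : Odd z)
    {α β α' β' : 𝓞 K} (hα' : 2 * α' = 1 + α) (hβ' : 2 * β' = 1 + β)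
    (hσα : σ • α = β) (hσβ : σ • β = -α) (hadd : α ^ 2 + β ^ 2 = 2 * p)
    (hmul : α ^ 2 * β ^ 2 = p * z ^ 2) :
    Squarefree (Ideal.span {(r : 𝓞 K)} : Ideal (𝓞 K)) := by
  refine squarefree_span_natCast_of_inertia_eq_bot hr fun P hP hrP ↦ ?_
  by_contra hne
  have hτ := sq_mem_of_orderOf_eq_four hσ hgen hne
  have hα : α ∈ P := mem_of_mem_inertia_of_neg hτ hα' (by rw [sq, mul_smul, hσα, hσβ])
  have hβ : β ∈ P := mem_of_mem_inertia_of_neg hτ hβ' (by rw [sq, mul_smul, hσβ, smul_neg, hσα])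
  have h2p : (2 * p : 𝓞 K) ∈ P := by
    rw [← hadd]
    exact P.add_mem (P.pow_mem_of_mem hα 2 two_pos) (P.pow_mem_of_mem hβ 2 two_pos)
  have hpz : (p * z ^ 2 : 𝓞 K) ∈ P := by
    rw [← hmul]
    exact P.mul_mem_right _ (P.pow_mem_of_mem hα 2 two_pos)
  obtain ⟨k, hk⟩ := hz.pow (n := 2)
  have hpP : (p : 𝓞 K) ∈ P := by
    have hk' : (z : 𝓞 K) ^ 2 = 2 * k + 1 := by exact_mod_cast congrArg (Int.cast : ℤ → 𝓞 K) hk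
    have := P.sub_mem hpz (P.mul_mem_right (k : 𝓞 K) h2p)
    rwa [hk', show (p * (2 * k + 1) - 2 * p * k : 𝓞 K) = p by ring] at this
  obtain ⟨u, v, huv⟩ := Nat.isCoprime_iff_coprime.mpr ((Nat.coprime_primes hr hp).mpr hrp)
  refine hP.ne_top ((Ideal.eq_top_iff_one P).mpr ?_)
  have huv' : (u * r + v * p : 𝓞 K) = 1 := by exact_mod_cast congrArg (Int.cast : ℤ → 𝓞 K) huv
  rw [← huv']
  exact P.add_mem (P.mul_mem_left _ hrP) (P.mul_mem_left _ hpP)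

lemma isGalois_adjoin_simple_of_splits {F E : Type*} [Field F] [Field E] [Algebra F E] {α : E}
    (hα : IsIntegral F α) (hsep : IsSeparable F α)
    (hsplits : ((minpoly F α).map (algebraMap F (IntermediateField.adjoin F {α}))).Splits) :
    IsGalois F (IntermediateField.adjoin F {α}) := by
  have := IntermediateField.adjoin.finiteDimensional hα
  refine IsGalois.of_card_aut_eq_finrank _ _ ?_
  rw [IntermediateField.adjoin.finrank hα,
    ← IntermediateField.card_algHom_adjoin_integral F hα hsep hsplits]
  exact Nat.card_congr (algEquivEquivAlgHom F (IntermediateField.adjoin F {α})).toEquiv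

lemma isGalois_adjoin_of_roots {a : ℝ} {p z : ℤ} (hp : Prime p) (hz : ¬ p ∣ z)
    {A B : IntermediateField.adjoin ℚ {a}} (hA : algebraMap _ ℝ A = a)
    (hadd : A ^ 2 + B ^ 2 = 2 * p) (hmul : A ^ 2 * B ^ 2 = p * z ^ 2) :
    FiniteDimensional ℚ (IntermediateField.adjoin ℚ {a}) ∧
    Module.finrank ℚ (IntermediateField.adjoin ℚ {a}) = 4 ∧
    IsGalois ℚ (IntermediateField.adjoin ℚ {a}) := by
  have hmonic := biquadraticPoly_monic p z
  have hroot : a ^ 4 - 2 * p * a ^ 2 + p * z ^ 2 = 0 := by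
    have h : A ^ 4 - 2 * p * A ^ 2 + p * z ^ 2 = 0 := by
      linear_combination -hmul + A ^ 2 * hadd
    simpa only [map_add, map_sub, map_mul, map_pow, map_intCast, map_ofNat, map_zero, hA]
      using congrArg (algebraMap _ ℝ) h
  have hmina := minpoly_eq_biquadraticPoly hp hz hroot
  have hint : IsIntegral ℚ a := by
    by_contra h
    exact (hmonic.map (algebraMap ℤ ℚ)).ne_zero (hmina ▸ minpoly.eq_zero h)
  refine ⟨IntermediateField.adjoin.finiteDimensional hint, ?_,
    isGalois_adjoin_simple_of_splits hint (minpoly.irreducible hint).separable ?_⟩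
  · rw [IntermediateField.adjoin.finrank hint, hmina, hmonic.natDegree_map,
      biquadraticPoly_natDegree]
  · have hfac (φ : ℚ →+* IntermediateField.adjoin ℚ {a}) : (minpoly ℚ a).map φ =
        (Polynomial.X - Polynomial.C A) * (Polynomial.X - Polynomial.C (-A)) *
          ((Polynomial.X - Polynomial.C B) * (Polynomial.X - Polynomial.C (-B))) := by
      rw [hmina, Polynomial.map_map]
      have h1 := congrArg Polynomial.C hadd
      have h2 := congrArg Polynomial.C hmul
      simp only [biquadraticPoly, Polynomial.map_add, Polynomial.map_sub, Polynomial.map_mul,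
        Polynomial.map_pow, Polynomial.map_X, Polynomial.map_C]
      simp only [map_mul, map_add, map_pow, map_neg, map_ofNat, eq_intCast, map_intCast] at h1 h2 ⊢
      linear_combination Polynomial.X ^ 2 * h1 - h2
    rw [hfac]
    exact ((Polynomial.Splits.X_sub_C _).mul (Polynomial.Splits.X_sub_C _)).mul
      ((Polynomial.Splits.X_sub_C _).mul (Polynomial.Splits.X_sub_C _))

/-- Propositions 4.5(i) (case `l_i = l_j`), 4.6(i) and the ramification part of
4.5(ii): for a prime `p ≡ 1 (mod 8)` written as `p = y² + z²` with `4 ∣ y`, the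
field `K = ℚ(√(p + y√p)) ⊆ ℝ` is a totally real number field of degree `4`,
cyclic Galois of order `4` over `ℚ`, contains `ℚ(√p)`, and every rational prime
`r ≠ p` is unramified in `K`. -/
theorem cyclic_quartic_field_totally_real_unramified
    (p : ℕ) (hp : p.Prime) (hp8 : p % 8 = 1)
    (y z : ℤ) (hpyz : (p : ℤ) = y ^ 2 + z ^ 2) (hy : 4 ∣ y)
    (s : ℝ) (hs : s = Real.sqrt p)
    (a : ℝ) (ha : a = Real.sqrt (p + y * s))
    (K : IntermediateField ℚ ℝ)
    (hK : K = IntermediateField.adjoin ℚ {a}) :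
    NumberField K ∧
    (∀ (φ : K →+* ℂ) (w : K), (φ w).im = 0) ∧
    Module.finrank ℚ K = 4 ∧
    IsGalois ℚ K ∧
    IsCyclic (K ≃ₐ[ℚ] K) ∧
    Nat.card (K ≃ₐ[ℚ] K) = 4 ∧
    Real.sqrt p ∈ K ∧
    ∀ r : ℕ, r.Prime → r ≠ p →
      Squarefree (Ideal.span {((r : 𝓞 K))} : Ideal (𝓞 K)) := by
  have hpZ : Prime (p : ℤ) := Nat.prime_iff_prime_int.mp hp
  have hpy : ¬ (p : ℤ) ∣ y := not_dvd_of_eq_sq_add_sq hpZ hpyz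
  have hpz : ¬ (p : ℤ) ∣ z := not_dvd_of_eq_sq_add_sq hpZ (hpyz.trans (add_comm _ _))
  have hy0 : y ≠ 0 := fun h ↦ hpy (h ▸ dvd_zero _)
  have hz0 : z ≠ 0 := fun h ↦ hpz (h ▸ dvd_zero _)
  obtain ⟨k, rfl⟩ := hy
  obtain ⟨m, hm⟩ : ∃ m : ℤ, (p : ℤ) = 8 * m + 1 := ⟨p / 8, by lia⟩
  have hzodd : Odd z := by
    by_contra h
    obtain ⟨t, rfl⟩ := Int.not_odd_iff_even.mp h
    have : 8 * m + 1 = 2 * (8 * k ^ 2 + 2 * t ^ 2) := by rw [← hm, hpyz]; ring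
    lia
  have hs2 : s ^ 2 = p := by rw [hs, Real.sq_sqrt (Nat.cast_nonneg p)]
  have hp0 : (0 : ℝ) < p := by exact_mod_cast hp.pos
  have hpyzR : (p : ℝ) = ((4 * k : ℤ) : ℝ) ^ 2 + (z : ℝ) ^ 2 := by exact_mod_cast hpyz
  have hz0R : (0 : ℝ) < (z : ℝ) ^ 2 := by positivity
  have hpos : 0 < p + ((4 * k : ℤ) : ℝ) * s := by
    have : |((4 * k : ℤ) : ℝ) * s| < p := by
      apply abs_lt_of_sq_lt_sq _ hp0.le
      rw [mul_pow, hs2]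
      nlinarith
    linarith [(abs_lt.mp this).1]
  have ha2 : a ^ 2 = p + ((4 * k : ℤ) : ℝ) * s := by rw [ha, Real.sq_sqrt hpos.le]
  have ha0 : a ≠ 0 := fun h ↦ hpos.ne' (by rw [← ha2, h]; simp)
  have hyR : ((4 * k : ℤ) : ℝ) ≠ 0 := Int.cast_ne_zero.mpr hy0
  subst hK
  set L := IntermediateField.adjoin ℚ {a}
  have haL : a ∈ L := IntermediateField.mem_adjoin_simple_self ℚ a
  have hsL : s ∈ L := by
    have : s = (a ^ 2 - p) / ((4 * k : ℤ) : ℝ) := by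
      rw [ha2]; field_simp; ring
    rw [this]
    exact L.div_mem (L.sub_mem (L.pow_mem haL 2) (natCast_mem L p)) (intCast_mem L _)
  let A : L := ⟨a, haL⟩
  let S : L := ⟨s, hsL⟩
  have hA0 : A ≠ 0 := fun h ↦ ha0 (congrArg Subtype.val h)
  have hS2 : S ^ 2 = p := Subtype.ext (by simpa [S] using hs2)
  have hA2 : A ^ 2 = p + ((4 * k : ℤ) : L) * S := Subtype.ext (by push_cast [A, S] at ha2 ⊢; exact ha2)
  have hpyzL : (p : L) = ((4 * k : ℤ) : L) ^ 2 + (z : L) ^ 2 := by exact_mod_cast hpyz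
  obtain ⟨B, hAB⟩ : ∃ B : L, A * B = z * S := ⟨z * S / A, by field_simp⟩
  have hB2 : B ^ 2 = p - ((4 * k : ℤ) : L) * S := by
    refine mul_left_cancel₀ (pow_ne_zero 2 hA0) ?_
    rw [← mul_pow, hAB, hA2]
    linear_combination (z ^ 2 + ((4 * k : ℤ) : L) ^ 2) * hS2 - (p : L) * hpyzL
  have hadd : A ^ 2 + B ^ 2 = 2 * ((p : ℤ) : L) := by rw [hA2, hB2]; push_cast; ring
  have hmul : A ^ 2 * B ^ 2 = ((p : ℤ) : L) * z ^ 2 := by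
    rw [← mul_pow, hAB, mul_pow, hS2]; push_cast; ring
  obtain ⟨hfd, hrank, hgal⟩ := isGalois_adjoin_of_roots hpZ hpz (A := A) rfl hadd hmul
  have hnf : NumberField L := { }
  have hcard : Nat.card (L ≃ₐ[ℚ] L) = 4 := by rw [IsGalois.card_aut_eq_finrank, hrank]
  have hrootA : A ^ 4 - 2 * ((p : ℤ) : L) * A ^ 2 + ((p : ℤ) : L) * z ^ 2 = 0 := by
    linear_combination -hmul + A ^ 2 * hadd
  have hrootB : B ^ 4 - 2 * ((p : ℤ) : L) * B ^ 2 + ((p : ℤ) : L) * z ^ 2 = 0 := by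
    linear_combination -hmul + B ^ 2 * hadd
  obtain ⟨σ, hσA⟩ : ∃ σ : L ≃ₐ[ℚ] L, σ A = B := by
    refine minpoly.exists_algEquiv_of_root (Algebra.IsAlgebraic.isAlgebraic B) ?_
    rw [minpoly_eq_biquadraticPoly hpZ hpz hrootB, ← minpoly_eq_biquadraticPoly hpZ hpz hrootA,
      minpoly.aeval]
  have hyL : ((4 * k : ℤ) : L) ≠ 0 := Int.cast_ne_zero.mpr hy0
  have hzL : (z : L) ≠ 0 := Int.cast_ne_zero.mpr hz0
  have hσS : σ S = -S := by
    have h := congrArg σ hA2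
    rw [map_pow, hσA, hB2, map_add, map_mul, map_natCast, map_intCast] at h
    exact mul_left_cancel₀ hyL (by linear_combination -h)
  have hB0 : B ≠ 0 := by
    rintro rfl
    have hS0 : S ≠ 0 := by
      rintro h
      rw [h] at hS2
      exact hp.ne_zero (by exact_mod_cast (by simpa using hS2.symm : (p : L) = 0))
    exact mul_ne_zero hzL hS0 (by rw [← hAB, mul_zero])
  have hσB : σ B = -A := by
    have h := congrArg σ hAB
    rw [map_mul, hσA, map_mul, map_intCast, hσS] at h
    exact mul_left_cancel₀ hB0 (by linear_combination h + hAB)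
  have hσ : orderOf σ = 4 := by
    have := Fact.mk Nat.prime_two
    refine orderOf_eq_prime_pow (p := 2) (n := 1) (fun h ↦ ?_) ?_
    · have hA : (σ ^ 2) A = A := by rw [show σ ^ 2 = 1 by simpa using h]; rfl
      rw [sq, AlgEquiv.mul_apply, hσA, hσB, neg_eq_self] at hA
      exact hA0 hA
    · rw [show 2 ^ (1 + 1) = Nat.card (L ≃ₐ[ℚ] L) from hcard.symm, pow_card_eq_one']
  have hgen (g : L ≃ₐ[ℚ] L) : g ∈ Subgroup.zpowers σ :=
    Subgroup.eq_top_of_card_eq (Subgroup.zpowers σ) (by rw [Nat.card_zpowers, hσ, hcard]) ▸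
      Subgroup.mem_top g
  refine ⟨hnf, im_eq_zero_of_isGalois_real, hrank, hgal,
    isCyclic_of_orderOf_eq_card σ (hσ.trans hcard.symm), hcard, hs ▸ hsL, fun r hr hrp ↦ ?_⟩
  have hA4 : (A ^ 2 - ((p : ℤ) : L)) ^ 2 = ((p : ℤ) : L) * (4 * k) ^ 2 := by
    rw [hA2]; push_cast; linear_combination (4 * k : L) ^ 2 * hS2
  have hB4 : (B ^ 2 - ((p : ℤ) : L)) ^ 2 = ((p : ℤ) : L) * (4 * k) ^ 2 := by
    rw [hB2]; push_cast; linear_combination (4 * k : L) ^ 2 * hS2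
  let α' : 𝓞 L := ⟨(1 + A) / 2, isIntegral_half_one_add hm hA4⟩
  let β' : 𝓞 L := ⟨(1 + B) / 2, isIntegral_half_one_add hm hB4⟩
  have hα : algebraMap (𝓞 L) L (2 * α' - 1) = A := by
    rw [map_sub, map_mul, map_ofNat, map_one]
    change 2 * ((1 + A) / 2) - 1 = A
    ring
  have hβ : algebraMap (𝓞 L) L (2 * β' - 1) = B := by
    rw [map_sub, map_mul, map_ofNat, map_one]
    change 2 * ((1 + B) / 2) - 1 = B
    ring
  refine squarefree_span_natCast_of_cyclic_quartic (α := 2 * α' - 1) (β := 2 * β' - 1)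
    hσ hgen hp hr hrp hzodd (by ring) (by ring) ?_ ?_ ?_ ?_ <;> apply RingOfIntegers.coe_injective
  · exact (congrArg σ hα).trans (hσA.trans hβ.symm)
  · rw [map_neg, hα]
    exact (congrArg σ hβ).trans hσB
  · rw [map_add, map_pow, map_pow, hα, hβ]
    simpa [map_ofNat] using hadd
  · rw [map_mul, map_pow, map_pow, hα, hβ]
    simpa [map_ofNat] using hmul
end
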